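/- arXiv:1306.5289 — 17 statements merged into one kernel-verified Lean document; each statement's English description precedes it below -/
import Mathlib

section
/- Suppose 0 < v1 ≤ v2 ≤ v3 ≤ v4 < v1 + v2 + v3. Then any point (p1,p2,p3,p4) that maximizes f over the simplex S4 satisfies 0 < pi < 1 for all i = 1,2,3,4. -/
theorem mul_mul_le_of_add_add_eq_one {x y z : ℝ} (hx : 0 ≤ x) (hy : 0 ≤ y) (hz : 0 ≤ z)
    (h : x + y + z = 1) : x * y * z ≤ 1 / 27 := by
  have key : x * y * z * 27 ≤ (x + y + z) ^ 3 := by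
    nlinarith [mul_nonneg hx (sq_nonneg (y - z)), mul_nonneg hy (sq_nonneg (x - z)),
      mul_nonneg hz (sq_nonneg (x - y)), mul_nonneg hx (sq_nonneg (x - y)),
      mul_nonneg hx (sq_nonneg (x - z)), mul_nonneg hy (sq_nonneg (y - x)),
      mul_nonneg hy (sq_nonneg (y - z)), mul_nonneg hz (sq_nonneg (z - x)),
      mul_nonneg hz (sq_nonneg (z - y))]
  rw [h] at key
  linarith

/-- Moving from the barycenter of a face towards the opposite vertex increases the objective beyond
its maximum over the face, if the weight `a` of that vertex is less than the sum `s` of the others. -/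
theorem exists_lt_of_face {a s x y z : ℝ} (ha : 0 < a) (has : a < s)
    (hx : 0 ≤ x) (hy : 0 ≤ y) (hz : 0 ≤ z) (h : x + y + z = 1) :
    ∃ t u : ℝ, 0 ≤ t ∧ 0 ≤ u ∧ t + 3 * u = 1 ∧
      a * (x * y * z) < a * u ^ 3 + s * (t * u ^ 2) := by
  obtain ⟨d, rfl⟩ : ∃ d, s = a + d := ⟨s - a, by ring⟩
  have hd : 0 < d := by linarith
  obtain ⟨t, ht⟩ : ∃ t, 4 * (a + d) * t = d := ⟨d / (4 * (a + d)), by field_simp⟩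
  have ht0 : 0 < t := by
    by_contra! hn
    nlinarith
  have ht1 : t < 1 / 4 := by
    by_contra! hn
    nlinarith
  have hat : a * t ≤ d / 4 := by nlinarith [mul_pos hd ht0]
  have hsq : 9 / 16 ≤ (1 - t) ^ 2 := by nlinarith
  have hface := mul_le_mul_of_nonneg_left (mul_mul_le_of_add_add_eq_one hx hy hz h) ha.le
  refine ⟨t, (1 - t) / 3, ht0.le, by linarith, by ring, hface.trans_lt ?_⟩
  have hgain : 0 < t * (d * (1 - t) ^ 2 - a * t + 2 / 3 * (a * t * t)) := by
    have := mul_le_mul_of_nonneg_left hsq hd.le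
    have := mul_pos (mul_pos ha ht0) ht0
    exact mul_pos ht0 (by linarith)
  linarith


/-- Lemma 1 (Lemma 2.1 / special case of Lemma 4.2): if
`0 < v1 ≤ v2 ≤ v3 ≤ v4 < v1 + v2 + v3`, then any maximizer of
`f(p) = v1 p2 p3 p4 + v2 p1 p3 p4 + v3 p1 p2 p4 + v4 p1 p2 p3` over the
simplex `S4` has all coordinates strictly between 0 and 1. -/
theorem stmt_0 (v1 v2 v3 v4 : ℝ)
    (hv1 : 0 < v1) (hv12 : v1 ≤ v2) (hv23 : v2 ≤ v3) (hv34 : v3 ≤ v4)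
    (hv4 : v4 < v1 + v2 + v3)
    (p1 p2 p3 p4 : ℝ)
    (hp1 : 0 ≤ p1) (hp2 : 0 ≤ p2) (hp3 : 0 ≤ p3) (hp4 : 0 ≤ p4)
    (hsum : p1 + p2 + p3 + p4 = 1)
    (hmax : ∀ q1 q2 q3 q4 : ℝ, 0 ≤ q1 → 0 ≤ q2 → 0 ≤ q3 → 0 ≤ q4 →
      q1 + q2 + q3 + q4 = 1 →
      v1*q2*q3*q4 + v2*q1*q3*q4 + v3*q1*q2*q4 + v4*q1*q2*q3 ≤
      v1*p2*p3*p4 + v2*p1*p3*p4 + v3*p1*p2*p4 + v4*p1*p2*p3) :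
    (0 < p1 ∧ p1 < 1) ∧ (0 < p2 ∧ p2 < 1) ∧ (0 < p3 ∧ p3 < 1) ∧ (0 < p4 ∧ p4 < 1) := by
  have h1 : 0 < p1 := by
    refine hp1.lt_of_ne fun h => ?_
    subst h
    obtain ⟨t, u, ht, hu, htu, hlt⟩ := exists_lt_of_face (a := v1) (s := v2 + v3 + v4)
      (by linarith) (by linarith) hp2 hp3 hp4 (by linarith)
    linarith [hmax t u u u ht hu hu hu (by linarith)]
  have h2 : 0 < p2 := by
    refine hp2.lt_of_ne fun h => ?_
    subst h
    obtain ⟨t, u, ht, hu, htu, hlt⟩ := exists_lt_of_face (a := v2) (s := v1 + v3 + v4)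
      (by linarith) (by linarith) hp1 hp3 hp4 (by linarith)
    linarith [hmax u t u u hu ht hu hu (by linarith)]
  have h3 : 0 < p3 := by
    refine hp3.lt_of_ne fun h => ?_
    subst h
    obtain ⟨t, u, ht, hu, htu, hlt⟩ := exists_lt_of_face (a := v3) (s := v1 + v2 + v4)
      (by linarith) (by linarith) hp1 hp2 hp4 (by linarith)
    linarith [hmax u u t u hu hu ht hu (by linarith)]
  have h4 : 0 < p4 := by
    refine hp4.lt_of_ne fun h => ?_
    subst h
    obtain ⟨t, u, ht, hu, htu, hlt⟩ := exists_lt_of_face (a := v4) (s := v1 + v2 + v3)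
      (by linarith) (by linarith) hp1 hp2 hp3 (by linarith)
    linarith [hmax u u u t hu hu hu ht (by linarith)]
  refine ⟨⟨h1, ?_⟩, ⟨h2, ?_⟩, ⟨h3, ?_⟩, ⟨h4, ?_⟩⟩ <;> linarith
end

section
/- Suppose 0 < v1 < v2 < v3 < v4 < v1 + v2 + v3. If (p1,p2,p3,p4) maximizes f over the simplex S4, then all four partial derivatives of f are equal at this point; equivalently, (v4 − v1) p2 p3 + (v3 p2 + v2 p3)(p4 − p1) = 0, (v4 − v2) p1 p3 + (v3 p1 + v1 p3)(p4 − p2) = 0, and (v4 − v3) p1 p2 + (v2 p1 + v1 p2)(p4 − p3) = 0. -/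
theorem mul_mul_le_of_add_eq_one {a b c : ℝ} (ha : 0 ≤ a) (hb : 0 ≤ b) (hc : 0 ≤ c)
    (h : a + b + c = 1) : a * b * c ≤ 1 / 27 := by
  obtain rfl : c = 1 - a - b := by linarith
  nlinarith [mul_nonneg ha (sq_nonneg (b - (1 - a - b))), mul_nonneg hb (sq_nonneg (a - (1 - a - b))),
    mul_nonneg hc (sq_nonneg (a - b)), sq_nonneg (a - b), sq_nonneg (a - (1 - a - b)),
    sq_nonneg (b - (1 - a - b))]

theorem linear_coeff_eq_zero_of_le_sq {B C a b : ℝ} (ha : 0 < a) (hb : 0 < b)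
    (h : ∀ t, -a ≤ t → t ≤ b → B * t ≤ C * t ^ 2) : B = 0 := by
  have hmax : IsLocalMax (fun t : ℝ => B * t - C * t ^ 2) 0 := by
    filter_upwards [Icc_mem_nhds (neg_lt_zero.mpr ha) hb] with t ht
    simpa using h t ht.1 ht.2
  have hderiv : HasDerivAt (fun t : ℝ => B * t - C * t ^ 2) B 0 := by
    simpa using ((hasDerivAt_id (0 : ℝ)).const_mul B).fun_sub
      (((hasDerivAt_id (0 : ℝ)).fun_pow 2).const_mul C)
  exact hmax.hasDerivAt_eq_zero hderiv

/-- Moving a little mass from the first three coordinates of `(1/3, 1/3, 1/3, 0)` to the last one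
increases the objective as soon as `v < s`, where `s` is the sum of the first three weights. -/
theorem exists_lt_cubic {v s : ℝ} (hv : 0 < v) (hs : v < s) :
    ∃ t : ℝ, 0 ≤ t ∧ t ≤ 1 ∧ v < v * (1 - t) ^ 3 + 3 * s * t * (1 - t) ^ 2 := by
  have hd : 0 < s - v := sub_pos.mpr hs
  have hpos : 0 < v + 2 * (s - v) := by positivity
  obtain ⟨t, ht⟩ : ∃ t, t = (s - v) / (v + 2 * (s - v)) := ⟨_, rfl⟩
  have ht0 : 0 < t := ht ▸ div_pos hd hpos
  have hvt : v * t = (s - v) * (1 - 2 * t) := by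
    rw [eq_div_iff hpos.ne'] at ht
    linarith
  have ht1 : t ≤ 1 := by nlinarith [mul_pos hv ht0]
  refine ⟨t, ht0.le, ht1, ?_⟩
  have hgap : v * t < (s - v) * (1 - t) ^ 2 := by
    nlinarith [mul_pos hd (pow_pos ht0 2)]
  nlinarith [mul_pos ht0 (sub_pos.mpr hgap), mul_pos hv (pow_pos ht0 3)]


/-- Lemma 2.2: under `0 < v1 < v2 < v3 < v4 < v1 + v2 + v3`, a maximizer of
`f` over the simplex satisfies the equality of all four partial derivatives,
equivalently the three stated polynomial equations. -/
theorem stmt_1 (v1 v2 v3 v4 : ℝ)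
    (hv1 : 0 < v1) (hv12 : v1 < v2) (hv23 : v2 < v3) (hv34 : v3 < v4)
    (hv4 : v4 < v1 + v2 + v3)
    (p1 p2 p3 p4 : ℝ)
    (hp1 : 0 ≤ p1) (hp2 : 0 ≤ p2) (hp3 : 0 ≤ p3) (hp4 : 0 ≤ p4)
    (hsum : p1 + p2 + p3 + p4 = 1)
    (hmax : ∀ q1 q2 q3 q4 : ℝ, 0 ≤ q1 → 0 ≤ q2 → 0 ≤ q3 → 0 ≤ q4 →
      q1 + q2 + q3 + q4 = 1 →
      v1*q2*q3*q4 + v2*q1*q3*q4 + v3*q1*q2*q4 + v4*q1*q2*q3 ≤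
      v1*p2*p3*p4 + v2*p1*p3*p4 + v3*p1*p2*p4 + v4*p1*p2*p3) :
    (v4 - v1) * p2 * p3 + (v3*p2 + v2*p3) * (p4 - p1) = 0 ∧
    (v4 - v2) * p1 * p3 + (v3*p1 + v1*p3) * (p4 - p2) = 0 ∧
    (v4 - v3) * p1 * p2 + (v2*p1 + v1*p2) * (p4 - p3) = 0 := by
  have hbig : v4 / 27 < v1*p2*p3*p4 + v2*p1*p3*p4 + v3*p1*p2*p4 + v4*p1*p2*p3 := by
    obtain ⟨t, ht0, ht1, ht⟩ := exists_lt_cubic (by linarith : 0 < v4) hv4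
    have hq : 0 ≤ (1 - t) / 3 := by linarith
    have := hmax _ _ _ t hq hq hq ht0 (by ring)
    linarith
  have hle {v a b c : ℝ} (hv : 0 < v) (hv' : v ≤ v4) (ha : 0 ≤ a) (hb : 0 ≤ b) (hc : 0 ≤ c)
      (h : a + b + c = 1) : v * a * b * c ≤ v4 / 27 := by
    have := mul_le_mul_of_nonneg_left (mul_mul_le_of_add_eq_one ha hb hc h) hv.le
    linarith
  have h1 : 0 < p1 := hp1.lt_of_ne' fun h0 => by
    subst h0
    linarith [hle hv1 (by linarith) hp2 hp3 hp4 (by linarith)]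
  have h2 : 0 < p2 := hp2.lt_of_ne' fun h0 => by
    subst h0
    linarith [hle (v := v2) (by linarith) (by linarith) hp1 hp3 hp4 (by linarith)]
  have h3 : 0 < p3 := hp3.lt_of_ne' fun h0 => by
    subst h0
    linarith [hle (v := v3) (by linarith) (by linarith) hp1 hp2 hp4 (by linarith)]
  have h4 : 0 < p4 := hp4.lt_of_ne' fun h0 => by
    subst h0
    linarith [hle (v := v4) (by linarith) le_rfl hp1 hp2 hp3 (by linarith)]
  refine ⟨linear_coeff_eq_zero_of_le_sq (C := v3 * p2 + v2 * p3) h1 h4 fun t hl hr => ?_,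
    linear_coeff_eq_zero_of_le_sq (C := v3 * p1 + v1 * p3) h2 h4 fun t hl hr => ?_,
    linear_coeff_eq_zero_of_le_sq (C := v2 * p1 + v1 * p2) h3 h4 fun t hl hr => ?_⟩
  · linarith [hmax (p1 + t) p2 p3 (p4 - t) (by linarith) hp2 hp3 (by linarith) (by linarith)]
  · linarith [hmax p1 (p2 + t) p3 (p4 - t) hp1 (by linarith) hp3 (by linarith) (by linarith)]
  · linarith [hmax p1 p2 (p3 + t) (p4 - t) hp1 hp2 (by linarith) (by linarith) (by linarith)]
end

section
/- Suppose 0 < v1 < v2 < v3 < v4 < v1 + v2 + v3 and let y1 > 0. Then the quadratic equation in y2, namely v2 y1 [v1 + (−v2 + v3 + v4) y1] + [v1² + 2 v1 (v4 − v2) y1 + v4 (v4 − v2 − v3) y1²] y2 − v1 (v1 + v4 y1) y2² = 0, has exactly one positive real solution, given by y2 = 1/2 + (v3 − v2) y1 / (2 (v1 + v4 y1)) − (v2 + v3 − v4) y1 / (2 v1) + √D2 / (2 v1 (v1 + v4 y1)), where D2 = [(v1 + v4 y1)² − (v3 − v2) v4 y1²]² − 4 v2 (v4 − v3) (v1 +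 v4 y1)² y1² (in particular D2 ≥ 0). -/
/-- The quadratic equation in `y2` obtained by eliminating `y3` has exactly one
positive real solution, given by the explicit formula involving `√D2`
(in particular `D2 ≥ 0`). -/
theorem stmt_2 (v1 v2 v3 v4 : ℝ)
    (hv1 : 0 < v1) (hv12 : v1 < v2) (hv23 : v2 < v3) (hv34 : v3 < v4)
    (hv4 : v4 < v1 + v2 + v3)
    (y1 : ℝ) (hy1 : 0 < y1)
    (D2 : ℝ)
    (hD2 : D2 = ((v1 + v4*y1)^2 - (v3 - v2)*v4*y1^2)^2
        - 4*v2*(v4 - v3)*(v1 + v4*y1)^2*y1^2)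
    (y2 : ℝ)
    (hy2 : y2 = 1/2 + (v3 - v2)*y1/(2*(v1 + v4*y1)) - (v2 + v3 - v4)*y1/(2*v1)
        + Real.sqrt D2/(2*v1*(v1 + v4*y1))) :
    0 ≤ D2 ∧ 0 < y2 ∧
    v2*y1*(v1 + (-v2 + v3 + v4)*y1)
      + (v1^2 + 2*v1*(v4 - v2)*y1 + v4*(v4 - v2 - v3)*y1^2)*y2
      - v1*(v1 + v4*y1)*y2^2 = 0 ∧
    ∀ z : ℝ, 0 < z →
      v2*y1*(v1 + (-v2 + v3 + v4)*y1)
        + (v1^2 + 2*v1*(v4 - v2)*y1 + v4*(v4 - v2 - v3)*y1^2)*z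
        - v1*(v1 + v4*y1)*z^2 = 0 → z = y2 := by
  have hS : 0 < v1 + v4 * y1 := by nlinarith
  set a := v1 * (v1 + v4 * y1) with ha
  set b := v1^2 + 2*v1*(v4 - v2)*y1 + v4*(v4 - v2 - v3)*y1^2 with hb
  set c := v2*y1*(v1 + (-v2 + v3 + v4)*y1) with hc
  have ha0 : 0 < a := mul_pos hv1 hS
  have hc0 : 0 < c := by
    have h2 : 0 < v2 := by linarith
    have h3 : 0 < -v2 + v3 + v4 := by linarith
    positivity
  have hdisc : D2 = b^2 + 4*a*c := by
    rw [hD2, ha, hb, hc]; ring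
  have hac : 0 < 4*a*c := by positivity
  have hD0 : 0 ≤ D2 := by rw [hdisc]; positivity
  have hsq : Real.sqrt D2 ^ 2 = D2 := Real.sq_sqrt hD0
  have hlt : |b| < Real.sqrt D2 := by
    apply Real.lt_sqrt_of_sq_lt
    rw [sq_abs, hdisc]; linarith
  have hy : 2*a*y2 = b + Real.sqrt D2 := by
    rw [hy2, ha, hb]
    field_simp
    ring
  have hy0 : 0 < y2 := by
    have : 0 < 2*a*y2 := by rw [hy]; linarith [neg_abs_le b]
    exact pos_of_mul_pos_right this (by positivity)
  have hroot : c + b*y2 - a*y2^2 = 0 := by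
    have h : 4*a*(c + b*y2 - a*y2^2) = 0 := by
      have hr : Real.sqrt D2 = 2*a*y2 - b := by linarith
      rw [hr, hdisc] at hsq
      linarith
    exact (mul_eq_zero.mp h).resolve_left (by positivity)
  refine ⟨hD0, hy0, hroot, fun z hz hzroot => ?_⟩
  -- Subtracting multiples of the two equations cancels the linear term and leaves this product.
  have h : (z - y2) * (c + a*(z*y2)) = 0 := by
    linear_combination z*hroot - y2*hzroot
  have hpos : 0 < c + a*(z*y2) := by positivity
  exact sub_eq_zero.mp ((mul_eq_zero.mp h).resolve_right hpos.ne')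
end

section
/- Suppose 0 < v1 < v2 < v3 < v4 < v1 + v2 + v3. If y1, y2, y3 are positive reals satisfying the stationarity system (v4 − v1) y2 y3 + (v3 y2 + v2 y3)(1 − y1) = 0, (v4 − v2) y1 y3 + (v3 y1 + v1 y3)(1 − y2) = 0, and (v4 − v3) y1 y2 + (v2 y1 + v1 y2)(1 − y3) = 0, then y1 satisfies the quartic equation c0 + c1 y1 + c2 y1² + c3 y1³ + c4 y1⁴ = 0. -/
/-- If positive reals `y1, y2, y3` satisfy the stationarity system, then `y1`
satisfies the quartic equation `c0 + c1 y1 + c2 y1² + c3 y1³ + c4 y1⁴ = 0`. -/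
theorem stmt_3 (v1 v2 v3 v4 : ℝ)
    (hv1 : 0 < v1) (hv12 : v1 < v2) (hv23 : v2 < v3) (hv34 : v3 < v4)
    (hv4 : v4 < v1 + v2 + v3)
    (y1 y2 y3 : ℝ) (hy1 : 0 < y1) (hy2 : 0 < y2) (hy3 : 0 < y3)
    (he1 : (v4 - v1)*y2*y3 + (v3*y2 + v2*y3)*(1 - y1) = 0)
    (he2 : (v4 - v2)*y1*y3 + (v3*y1 + v1*y3)*(1 - y2) = 0)
    (he3 : (v4 - v3)*y1*y2 + (v2*y1 + v1*y2)*(1 - y3) = 0)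
    (c0 c1 c2 c3 c4 : ℝ)
    (hc0 : c0 = 2*v1^3*(-v1 + v2 + v3 + v4))
    (hc1 : c1 = v1^2*((-v1 - v2 + v3 + v4)^2 + 4*(v4 - v1)*(v2 + v4)))
    (hc2 : c2 = 2*v1*v4*(2*(v1 - v4)^2 - (v2 - v3)^2 - (v1 + v4)*(v2 + v3)))
    (hc3 : c3 = v4^2*((v1 - v2 + v3 - v4)^2 - 4*(v4 - v1)*(v1 + v2)))
    (hc4 : c4 = 2*v4^3*(v1 + v2 + v3 - v4)) :
    c0 + c1*y1 + c2*y1^2 + c3*y1^3 + c4*y1^4 = 0 := by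
  -- In terms of `a = v2/y2`, `b = v3/y3`, `S = v1/y1 + a + b`, the stationarity system says that
  -- each summand `x = vi/yi` of `S` satisfies `x² - (S + v4) x + S vi = 0`.
  obtain ⟨a, ha⟩ : ∃ a, a = v2/y2 := ⟨_, rfl⟩
  obtain ⟨b, hb⟩ : ∃ b, b = v3/y3 := ⟨_, rfl⟩
  obtain ⟨S, hS⟩ : ∃ S, S = v1/y1 + a + b := ⟨_, rfl⟩
  have hA : (y1 - 1)*(a + b) = v4 - v1 := by
    rw [ha, hb]; field_simp; linear_combination -he1
  have h2 : (y2 - 1)*(S - a) = v4 - v2 := by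
    rw [show S - a = v1/y1 + b by rw [hS]; ring, hb]; field_simp; linear_combination -he2
  have h3 : (y3 - 1)*(S - b) = v4 - v3 := by
    rw [show S - b = v1/y1 + a by rw [hS]; ring, ha]; field_simp; linear_combination -he3
  have hay : a*y2 = v2 := by rw [ha]; field_simp
  have hby : b*y3 = v3 := by rw [hb]; field_simp
  have hSy : S*y1 = v1 + (a + b)*y1 := by rw [hS]; field_simp; ring
  have q2 : a^2 - (S + v4)*a + S*v2 = 0 := by linear_combination a*h2 - (S - a)*hay
  have q3 : b^2 - (S + v4)*b + S*v3 = 0 := by linear_combination b*h3 - (S - b)*hby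
  have hC : y1*(y1 - 1)*S = v4*y1 - v1 := by linear_combination (y1 - 1)*hSy + y1*hA
  have hq : (a - b)*(v4*y1 + v1) = S*y1*(v2 - v3) := by
    linear_combination -y1*(q2 - q3) - (a - b)*hSy
  have hB : (y1 - 1)*((a - b)*(v4*y1 + v1)) = (v4*y1 - v1)*(v2 - v3) := by
    rw [hq]; linear_combination (v2 - v3)*hC
  have hE : (a + b)^2 + (a - b)^2 - 2*(S + v4)*(a + b) + 2*S*(v2 + v3) = 0 := by
    linear_combination 2*q2 + 2*q3
  subst hc0 hc1 hc2 hc3 hc4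
  linear_combination y1*(y1 - 1)^2*(v4*y1 + v1)^2*hE
    - (v4*y1 + v1)^2*y1*((y1 - 1)*(a + b) + (v4 - v1))*hA
    - y1*((y1 - 1)*((a - b)*(v4*y1 + v1)) + (v4*y1 - v1)*(v2 - v3))*hB
    + 2*(v4*y1 + v1)^2*((y1*(y1 - 1)*S + v4*y1*(y1 - 1))*hA + (v4 - v1)*hC)
    - 2*(v2 + v3)*(y1 - 1)*(v4*y1 + v1)^2*hC
end

section
/- Suppose 0 < v1 < v2 < v3 < v4 < v1 + v2 + v3. Then there is exactly one real number y1 > 1 satisfying c0 + c1 y1 + c2 y1² + c3 y1³ + c4 y1⁴ = 0. -/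
/-- A quartic whose coefficients of degree `0`, `1`, `4` are positive and which is negative at `1`
has at most one root above `1`, because `x ↦ f x / x ^ 2` is strictly convex on `(0, ∞)`. -/
lemma quartic_not_two_roots_gt_one {c0 c1 c2 c3 c4 y z : ℝ} (h0 : 0 < c0) (h1 : 0 < c1)
    (h4 : 0 < c4) (hf : c0 + c1 + c2 + c3 + c4 < 0) (hy : 1 < y) (hyz : y < z)
    (ey : c0 + c1*y + c2*y^2 + c3*y^3 + c4*y^4 = 0)
    (ez : c0 + c1*z + c2*z^2 + c3*z^3 + c4*z^4 = 0) : False := by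
  have key : (z - y)*y^2*z^2*(c0 + c1 + c2 + c3 + c4)
      = (z - 1)*(z - y)*(y - 1)*(c0*(y*z + y + z) + c1*(y*z) + c4*(y^2*z^2)) := by
    linear_combination (z - 1)*z^2*ey - (y - 1)*y^2*ez
  have y0 : 0 < y := by linarith
  have z0 : 0 < z := by linarith
  have a1 : 0 < z - y := by linarith
  have a2 : 0 < z - 1 := by linarith
  have a3 : 0 < y - 1 := by linarith
  have hl : (z - y)*y^2*z^2*(c0 + c1 + c2 + c3 + c4) < 0 :=
    mul_neg_of_pos_of_neg (by positivity) hf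
  have hr : 0 < (z - 1)*(z - y)*(y - 1)*(c0*(y*z + y + z) + c1*(y*z) + c4*(y^2*z^2)) := by
    positivity
  linarith

/-- A quartic with positive leading coefficient that is negative at `1` has a root above `1`. -/
lemma quartic_exists_root_gt_one {c0 c1 c2 c3 c4 : ℝ} (h0 : 0 < c0) (h1 : 0 < c1)
    (h4 : 0 < c4) (hf : c0 + c1 + c2 + c3 + c4 < 0) :
    ∃ y : ℝ, 1 < y ∧ c0 + c1*y + c2*y^2 + c3*y^3 + c4*y^4 = 0 := by
  obtain ⟨Y, hY⟩ : ∃ Y : ℝ, Y = 1 + (|c2| + |c3|)/c4 := ⟨_, rfl⟩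
  have hY1 : 1 ≤ Y := by
    rw [hY]
    have : 0 ≤ (|c2| + |c3|)/c4 := by positivity
    linarith
  have hY0 : 0 < Y := by linarith
  have hcY : c4*Y = c4 + |c2| + |c3| := by
    rw [hY]
    field_simp
    ring
  have hpos : 0 < c0 + c1*Y + c2*Y^2 + c3*Y^3 + c4*Y^4 := by
    have e : c0 + c1*Y + c2*Y^2 + c3*Y^3 + c4*Y^4
        = c0 + c1*Y + c4*Y^3 + (c3 + |c3|)*Y^3 + (c2 + |c2|)*Y^2 + |c2| * (Y^2*(Y - 1)) := by
      linear_combination Y^3*hcY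
    have b2 : 0 ≤ c2 + |c2| := by linarith [neg_abs_le c2]
    have b3 : 0 ≤ c3 + |c3| := by linarith [neg_abs_le c3]
    have b1 : 0 ≤ Y - 1 := by linarith
    rw [e]
    positivity
  have hcont : ContinuousOn (fun y : ℝ => c0 + c1*y + c2*y^2 + c3*y^3 + c4*y^4)
      (Set.Icc 1 Y) := by fun_prop
  obtain ⟨y, hy, hfy⟩ := intermediate_value_Ioo hY1 hcont
    (show (0 : ℝ) ∈ Set.Ioo _ _ from ⟨by simpa using hf, hpos⟩)
  exact ⟨y, hy.1, hfy⟩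

/-- Lemma 2.3 (Lemma `y1>1`): there is exactly one real `y1 > 1` solving the
quartic equation `c0 + c1 y1 + c2 y1² + c3 y1³ + c4 y1⁴ = 0`. -/
theorem stmt_4 (v1 v2 v3 v4 : ℝ)
    (hv1 : 0 < v1) (hv12 : v1 < v2) (hv23 : v2 < v3) (hv34 : v3 < v4)
    (hv4 : v4 < v1 + v2 + v3)
    (c0 c1 c2 c3 c4 : ℝ)
    (hc0 : c0 = 2*v1^3*(-v1 + v2 + v3 + v4))
    (hc1 : c1 = v1^2*((-v1 - v2 + v3 + v4)^2 + 4*(v4 - v1)*(v2 + v4)))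
    (hc2 : c2 = 2*v1*v4*(2*(v1 - v4)^2 - (v2 - v3)^2 - (v1 + v4)*(v2 + v3)))
    (hc3 : c3 = v4^2*((v1 - v2 + v3 - v4)^2 - 4*(v4 - v1)*(v1 + v2)))
    (hc4 : c4 = 2*v4^3*(v1 + v2 + v3 - v4)) :
    ∃! y1 : ℝ, 1 < y1 ∧ c0 + c1*y1 + c2*y1^2 + c3*y1^3 + c4*y1^4 = 0 := by
  have h0 : 0 < c0 := by
    rw [hc0]
    have : 0 < -v1 + v2 + v3 + v4 := by linarith
    positivity
  have h1 : 0 < c1 := by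
    rw [hc1]
    have : 0 < v4 - v1 := by linarith
    have : 0 < v2 + v4 := by linarith
    positivity
  have h4 : 0 < c4 := by
    rw [hc4]
    have : 0 < v1 + v2 + v3 - v4 := by linarith
    have : 0 < v4 := by linarith
    positivity
  have hf : c0 + c1 + c2 + c3 + c4 < 0 := by
    have e : c0 + c1 + c2 + c3 + c4
        = (v4 - v1)^2*((v3 - v2 - v1 - v4)*(v3 - v2 + v1 + v4)) := by
      rw [hc0, hc1, hc2, hc3, hc4]
      ring
    rw [e]
    have : 0 < v4 - v1 := by linarith
    exact mul_neg_of_pos_of_neg (by positivity)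
      (mul_neg_of_neg_of_pos (by linarith) (by linarith))
  obtain ⟨y, hy, ey⟩ := quartic_exists_root_gt_one h0 h1 h4 hf
  refine ⟨y, ⟨hy, ey⟩, fun z ⟨hz, ez⟩ => ?_⟩
  rcases lt_trichotomy z y with h | h | h
  · exact (quartic_not_two_roots_gt_one h0 h1 h4 hf hz h ez ey).elim
  · exact h
  · exact (quartic_not_two_roots_gt_one h0 h1 h4 hf hy h ey ez).elim
end

section
/- Suppose 0 < v1 < v2 < v3 < v4 < v1 + v2 + v3 and let h(y) = c0 + c1 y + c2 y² + c3 y³ + c4 y⁴. Then h(−v1/v4) = −4 v1³ (v2 − v3)²/v4 < 0 and h(1) = −(v1 − v4)² [(v1 + v4)² − (v2 − v3)²] < 0, and h has exactly one real root in each of the four intervals (−∞, −v1/v4), (−v1/v4, 0), (0, 1), and (1, ∞). -/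
/-- A real quartic with nonzero leading coefficient has at most four distinct roots. -/
theorem quartic_not_five_roots {c0 c1 c2 c3 c4 : ℝ} (hc4 : c4 ≠ 0) {r : Fin 5 → ℝ}
    (hr : Function.Injective r)
    (hz : ∀ i, c0 + c1 * r i + c2 * r i ^ 2 + c3 * r i ^ 3 + c4 * r i ^ 4 = 0) : False := by
  open Polynomial in
  let p : ℝ[X] := C c0 + C c1 * X + C c2 * X ^ 2 + C c3 * X ^ 3 + C c4 * X ^ 4
  have hdeg : p.natDegree ≤ 4 := by
    unfold p
    compute_degree
  have hp : p = 0 := by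
    refine Polynomial.eq_zero_of_natDegree_lt_card_of_eval_eq_zero p hr (fun i => ?_) ?_
    · simpa [p] using hz i
    · simp only [Fintype.card_fin]
      omega
  have hcoeff : p.coeff 4 = c4 := by
    simp [p]
  exact hc4 (by rw [← hcoeff, hp, Polynomial.coeff_zero])

/-- A real quartic with positive leading coefficient is positive somewhere beyond any bound. -/
theorem exists_gt_quartic_pos (c0 c1 c2 c3 : ℝ) {c4 : ℝ} (hc4 : 0 < c4) (b : ℝ) :
    ∃ x, b < x ∧ 0 < c0 + c1 * x + c2 * x ^ 2 + c3 * x ^ 3 + c4 * x ^ 4 := by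
  obtain ⟨x, hx⟩ := exists_gt (max (max b 1) ((|c0| + |c1| + |c2| + |c3|) / c4))
  simp only [max_lt_iff] at hx
  obtain ⟨⟨hb, h1⟩, hS⟩ := hx
  rw [div_lt_iff₀ hc4] at hS
  refine ⟨x, hb, ?_⟩
  have hx0 : 0 < x := by linarith
  have e0 : -|c0| * x ^ 3 ≤ c0 := by
    nlinarith [neg_abs_le c0, abs_nonneg c0, one_le_pow₀ h1.le (n := 3)]
  have e1 : -|c1| * x ^ 3 ≤ c1 * x := by
    have : 0 ≤ |c1| * x * (x ^ 2 - 1) :=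
      mul_nonneg (by positivity) (by nlinarith)
    nlinarith [mul_le_mul_of_nonneg_right (neg_abs_le c1) hx0.le]
  have e2 : -|c2| * x ^ 3 ≤ c2 * x ^ 2 := by
    have : 0 ≤ |c2| * x ^ 2 * (x - 1) := mul_nonneg (by positivity) (by linarith)
    nlinarith [mul_le_mul_of_nonneg_right (neg_abs_le c2) (sq_nonneg x)]
  have e3 : -|c3| * x ^ 3 ≤ c3 * x ^ 3 :=
    mul_le_mul_of_nonneg_right (neg_abs_le c3) (by positivity)
  have e4 : (|c0| + |c1| + |c2| + |c3|) * x ^ 3 < x * c4 * x ^ 3 :=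
    mul_lt_mul_of_pos_right hS (by positivity)
  nlinarith

/-- A real quartic that is positive at `0` and near `±∞` and negative at some `a < 0` and some
`b > 0` has exactly one root in each of the four intervals cut out by `a`, `0` and `b`. -/
theorem quartic_existsUnique_roots {c0 c1 c2 c3 c4 a b : ℝ} {h : ℝ → ℝ}
    (hh : ∀ y, h y = c0 + c1 * y + c2 * y ^ 2 + c3 * y ^ 3 + c4 * y ^ 4)
    (hc0 : 0 < c0) (hc4 : 0 < c4) (ha : a < 0) (hb : 0 < b) (hha : h a < 0) (hhb : h b < 0) :
    (∃! y : ℝ, y < a ∧ h y = 0) ∧ (∃! y : ℝ, (a < y ∧ y < 0) ∧ h y = 0) ∧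
    (∃! y : ℝ, (0 < y ∧ y < b) ∧ h y = 0) ∧ (∃! y : ℝ, b < y ∧ h y = 0) := by
  have hcont : Continuous h := by
    rw [funext hh]
    fun_prop
  have h0 : 0 < h 0 := by simpa [hh] using hc0
  obtain ⟨R, hbR, hR⟩ := exists_gt_quartic_pos c0 c1 c2 c3 hc4 b
  rw [← hh] at hR
  obtain ⟨L, haL, hL⟩ := exists_gt_quartic_pos c0 (-c1) c2 (-c3) hc4 (-a)
  replace hL : 0 < h (-L) := by
    rw [hh]
    linarith
  obtain ⟨r1, ⟨-, l1⟩, z1⟩ :=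
    intermediate_value_Ioo' (show -L ≤ a by linarith) hcont.continuousOn ⟨hha, hL⟩
  obtain ⟨r2, ⟨g2, l2⟩, z2⟩ := intermediate_value_Ioo ha.le hcont.continuousOn ⟨hha, h0⟩
  obtain ⟨r3, ⟨g3, l3⟩, z3⟩ := intermediate_value_Ioo' hb.le hcont.continuousOn ⟨hhb, h0⟩
  obtain ⟨r4, ⟨g4, -⟩, z4⟩ := intermediate_value_Ioo hbR.le hcont.continuousOn ⟨hhb, hR⟩
  have root_mem : ∀ y, h y = 0 → y = r1 ∨ y = r2 ∨ y = r3 ∨ y = r4 := by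
    intro y hy
    by_contra! hne
    obtain ⟨n1, n2, n3, n4⟩ := hne
    refine quartic_not_five_roots (c0 := c0) (c1 := c1) (c2 := c2) (c3 := c3)
      (r := ![y, r1, r2, r3, r4]) hc4.ne' ?_ (fun i => ?_)
    · intro i j hij
      fin_cases i <;> fin_cases j <;> simp at hij ⊢ <;> grind
    · rw [← hh]
      fin_cases i <;> simpa
  refine ⟨⟨r1, ⟨l1, z1⟩, ?_⟩, ⟨r2, ⟨⟨g2, l2⟩, z2⟩, ?_⟩, ⟨r3, ⟨⟨g3, l3⟩, z3⟩, ?_⟩,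
    ⟨r4, ⟨g4, z4⟩, ?_⟩⟩ <;>
  · rintro y ⟨hy, hz⟩
    rcases root_mem y hz with rfl | rfl | rfl | rfl <;> grind

/-- Values and sign of the quartic `h` at `-v1/v4` and `1`, and the location of
its four real roots: exactly one in each of `(-∞, -v1/v4)`, `(-v1/v4, 0)`,
`(0, 1)` and `(1, ∞)`. -/
theorem stmt_5 (v1 v2 v3 v4 : ℝ)
    (hv1 : 0 < v1) (hv12 : v1 < v2) (hv23 : v2 < v3) (hv34 : v3 < v4)
    (hv4 : v4 < v1 + v2 + v3)
    (c0 c1 c2 c3 c4 : ℝ)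
    (hc0 : c0 = 2*v1^3*(-v1 + v2 + v3 + v4))
    (hc1 : c1 = v1^2*((-v1 - v2 + v3 + v4)^2 + 4*(v4 - v1)*(v2 + v4)))
    (hc2 : c2 = 2*v1*v4*(2*(v1 - v4)^2 - (v2 - v3)^2 - (v1 + v4)*(v2 + v3)))
    (hc3 : c3 = v4^2*((v1 - v2 + v3 - v4)^2 - 4*(v4 - v1)*(v1 + v2)))
    (hc4 : c4 = 2*v4^3*(v1 + v2 + v3 - v4))
    (h : ℝ → ℝ)
    (hh : ∀ y : ℝ, h y = c0 + c1*y + c2*y^2 + c3*y^3 + c4*y^4) :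
    (h (-v1/v4) = -4*v1^3*(v2 - v3)^2/v4 ∧ h (-v1/v4) < 0) ∧
    (h 1 = -(v1 - v4)^2*((v1 + v4)^2 - (v2 - v3)^2) ∧ h 1 < 0) ∧
    (∃! y : ℝ, y < -v1/v4 ∧ h y = 0) ∧
    (∃! y : ℝ, (-v1/v4 < y ∧ y < 0) ∧ h y = 0) ∧
    (∃! y : ℝ, (0 < y ∧ y < 1) ∧ h y = 0) ∧
    (∃! y : ℝ, 1 < y ∧ h y = 0) := by
  have hv40 : 0 < v4 := by linarith
  have hval : h (-v1/v4) = -4*v1^3*(v2 - v3)^2/v4 := by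
    rw [hh, hc0, hc1, hc2, hc3, hc4]
    field_simp
    ring
  have hval1 : h 1 = -(v1 - v4)^2*((v1 + v4)^2 - (v2 - v3)^2) := by
    rw [hh, hc0, hc1, hc2, hc3, hc4]
    ring
  have hneg : h (-v1/v4) < 0 := by
    rw [hval]
    have : 0 < (v2 - v3)^2 := sq_pos_of_neg (by linarith)
    have : 0 < 4*v1^3*(v2 - v3)^2 := by positivity
    exact div_neg_of_neg_of_pos (by linarith) hv40
  have hneg1 : h 1 < 0 := by
    rw [hval1]
    have h1 : 0 < (v1 - v4)^2 := sq_pos_of_neg (by linarith)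
    have h2 : 0 < (v1 + v4)^2 - (v2 - v3)^2 := by nlinarith
    linarith [mul_pos h1 h2]
  have hc0pos : 0 < c0 := by
    rw [hc0]
    exact mul_pos (by positivity) (by linarith)
  have hc4pos : 0 < c4 := by
    rw [hc4]
    exact mul_pos (by positivity) (by linarith)
  exact ⟨⟨hval, hneg⟩, ⟨hval1, hneg1⟩, quartic_existsUnique_roots hh hc0pos hc4pos
    (div_neg_of_neg_of_pos (by linarith) hv40) one_pos hneg hneg1⟩
end

section
/- Suppose 0 < v1 < v2 < v3 < v4 < v1 + v2 + v3. Let y1 be the unique root in (1, ∞) of the quartic c0 + c1 y + c2 y² + c3 y³ + c4 y⁴ = 0; let y2 = 1/2 + (v3 − v2) y1 / (2 (v1 + v4 y1)) − (v2 + v3 − v4) y1 / (2 v1) + √D2 / (2 v1 (v1 + v4 y1)) with D2 = [(v1 + v4 y1)² − (v3 − v2) v4 y1²]² − 4 v2 (v4 − v3) (v1 + v4 y1)² y1²; and let y3 = 1 + (v4 − v3) y1 y2 / (v2 y1 + v1 y2). Then y1 > 1, y2 > 1, y3 > 1, and the point given by pi = yi/(1 + y1 + y2 + y3) for i = 1,2,3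 and p4 = 1/(1 + y1 + y2 + y3) is the unique maximizer of f over the simplex S4. -/
/-- Newton's inequality `3 E₀ E₂ ≤ E₁²` for the real-rooted cubic `∑ wᵢ ∏_{j ≠ i} (1 + xⱼ t)` with
`∑ wᵢ = 1`, together with its equality case. -/
theorem newton_first_of_sum_eq_one {w1 w2 w3 w4 x1 x2 x3 x4 : ℝ}
    (hw1 : 0 < w1) (hw2 : 0 < w2) (hw3 : 0 < w3) (hw4 : 0 < w4) (hw : w1 + w2 + w3 + w4 = 1)
    {E1 E2 : ℝ}
    (hE1 : E1 = w1*(x2 + x3 + x4) + w2*(x1 + x3 + x4) + w3*(x1 + x2 + x4) + w4*(x1 + x2 + x3))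
    (hE2 : E2 = w1*(x2*x3 + x2*x4 + x3*x4) + w2*(x1*x3 + x1*x4 + x3*x4)
      + w3*(x1*x2 + x1*x4 + x2*x4) + w4*(x1*x2 + x1*x3 + x2*x3)) :
    3*E2 ≤ E1^2 ∧
      (3*E2 = E1^2 → x1 = E1/3 ∧ x2 = E1/3 ∧ x3 = E1/3 ∧ x4 = E1/3) := by
  obtain ⟨y1, hy1⟩ : ∃ y, y = x1 - E1/3 := ⟨_, rfl⟩
  obtain ⟨y2, hy2⟩ : ∃ y, y = x2 - E1/3 := ⟨_, rfl⟩
  obtain ⟨y3, hy3⟩ : ∃ y, y = x3 - E1/3 := ⟨_, rfl⟩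
  obtain ⟨y4, hy4⟩ : ∃ y, y = x4 - E1/3 := ⟨_, rfl⟩
  obtain ⟨m, hm⟩ : ∃ m, m = w1*y1 + w2*y2 + w3*y3 + w4*y4 := ⟨_, rfl⟩
  have key : E1^2 - 3*E2 = 3/2*(((1 - 2*w1)*y1 + w1*m)^2 + ((1 - 2*w2)*y2 + w2*m)^2
      + ((1 - 2*w3)*y3 + w3*m)^2 + ((1 - 2*w4)*y4 + w4*m)^2
      + 2*(w1*w2*(m - y1 - y2)^2 + w1*w3*(m - y1 - y3)^2 + w1*w4*(m - y1 - y4)^2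
        + w2*w3*(m - y2 - y3)^2 + w2*w4*(m - y2 - y4)^2 + w3*w4*(m - y3 - y4)^2)) := by
    obtain rfl : w4 = 1 - w1 - w2 - w3 := by linarith
    subst hy1 hy2 hy3 hy4 hm hE1 hE2
    ring
  have h12 := mul_pos hw1 hw2
  have h13 := mul_pos hw1 hw3
  have h14 := mul_pos hw1 hw4
  have h23 := mul_pos hw2 hw3
  have h24 := mul_pos hw2 hw4
  have h34 := mul_pos hw3 hw4
  have n1 := sq_nonneg ((1 - 2*w1)*y1 + w1*m)
  have n2 := sq_nonneg ((1 - 2*w2)*y2 + w2*m)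
  have n3 := sq_nonneg ((1 - 2*w3)*y3 + w3*m)
  have n4 := sq_nonneg ((1 - 2*w4)*y4 + w4*m)
  have n12 := mul_nonneg h12.le (sq_nonneg (m - y1 - y2))
  have n13 := mul_nonneg h13.le (sq_nonneg (m - y1 - y3))
  have n14 := mul_nonneg h14.le (sq_nonneg (m - y1 - y4))
  have n23 := mul_nonneg h23.le (sq_nonneg (m - y2 - y3))
  have n24 := mul_nonneg h24.le (sq_nonneg (m - y2 - y4))
  have n34 := mul_nonneg h34.le (sq_nonneg (m - y3 - y4))
  refine ⟨by linarith, fun heq => ?_⟩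
  have z1 : (1 - 2*w1)*y1 + w1*m = 0 := pow_eq_zero_iff two_ne_zero |>.1 (by linarith)
  have vanish : ∀ {c t : ℝ}, 0 < c → c*t^2 = 0 → t = 0 := fun hc h =>
    pow_eq_zero_iff two_ne_zero |>.1 ((mul_eq_zero.1 h).resolve_left hc.ne')
  have z12 := vanish h12 (by linarith : w1*w2*(m - y1 - y2)^2 = 0)
  have z13 := vanish h13 (by linarith : w1*w3*(m - y1 - y3)^2 = 0)
  have z14 := vanish h14 (by linarith : w1*w4*(m - y1 - y4)^2 = 0)
  have z23 := vanish h23 (by linarith : w2*w3*(m - y2 - y3)^2 = 0)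
  have hm1 : m = 2*y1 := by linarith
  have hy1_zero : y1 = 0 := by rw [hm1] at z1; linarith
  refine ⟨?_, ?_, ?_, ?_⟩ <;> linarith

/-- Homogeneous form of `newton_first_of_sum_eq_one`. -/
theorem newton_first {w1 w2 w3 w4 : ℝ} (x1 x2 x3 x4 : ℝ)
    (hw1 : 0 < w1) (hw2 : 0 < w2) (hw3 : 0 < w3) (hw4 : 0 < w4) :
    3*(w1 + w2 + w3 + w4)*(w1*(x2*x3 + x2*x4 + x3*x4) + w2*(x1*x3 + x1*x4 + x3*x4)
      + w3*(x1*x2 + x1*x4 + x2*x4) + w4*(x1*x2 + x1*x3 + x2*x3)) ≤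
    (w1*(x2 + x3 + x4) + w2*(x1 + x3 + x4) + w3*(x1 + x2 + x4) + w4*(x1 + x2 + x3))^2 := by
  obtain ⟨W, hW⟩ : ∃ W, W = w1 + w2 + w3 + w4 := ⟨_, rfl⟩
  have hWpos : 0 < W := by rw [hW]; positivity
  have h := (newton_first_of_sum_eq_one (x1 := x1) (x2 := x2) (x3 := x3) (x4 := x4)
    (div_pos hw1 hWpos) (div_pos hw2 hWpos) (div_pos hw3 hWpos)
    (div_pos hw4 hWpos) (by rw [← add_div, ← add_div, ← add_div, ← hW, div_self hWpos.ne'])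
    rfl rfl).1
  have h' := mul_le_mul_of_nonneg_left h (sq_nonneg W)
  rw [← hW]
  calc _ = _ := ?_
    _ ≤ _ := h'
    _ = _ := ?_
  · field_simp
  · field_simp

/-- Newton's inequality `3 E₁ E₃ ≤ E₂²` for positive nodes. -/
theorem newton_second_of_pos {w1 w2 w3 w4 x1 x2 x3 x4 : ℝ}
    (hw1 : 0 < w1) (hw2 : 0 < w2) (hw3 : 0 < w3) (hw4 : 0 < w4)
    (hx1 : 0 < x1) (hx2 : 0 < x2) (hx3 : 0 < x3) (hx4 : 0 < x4) :
    3*(w1*(x2 + x3 + x4) + w2*(x1 + x3 + x4) + w3*(x1 + x2 + x4) + w4*(x1 + x2 + x3))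
      *(w1*x2*x3*x4 + w2*x1*x3*x4 + w3*x1*x2*x4 + w4*x1*x2*x3) ≤
    (w1*(x2*x3 + x2*x4 + x3*x4) + w2*(x1*x3 + x1*x4 + x3*x4)
      + w3*(x1*x2 + x1*x4 + x2*x4) + w4*(x1*x2 + x1*x3 + x2*x3))^2 := by
  have h := newton_first (w1 := w1*x2*x3*x4) (w2 := w2*x1*x3*x4) (w3 := w3*x1*x2*x4)
    (w4 := w4*x1*x2*x3) x1⁻¹ x2⁻¹ x3⁻¹ x4⁻¹ (by positivity) (by positivity) (by positivity)
    (by positivity)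
  have e1 : w1*x2*x3*x4*(x2⁻¹*x3⁻¹ + x2⁻¹*x4⁻¹ + x3⁻¹*x4⁻¹)
      + w2*x1*x3*x4*(x1⁻¹*x3⁻¹ + x1⁻¹*x4⁻¹ + x3⁻¹*x4⁻¹)
      + w3*x1*x2*x4*(x1⁻¹*x2⁻¹ + x1⁻¹*x4⁻¹ + x2⁻¹*x4⁻¹)
      + w4*x1*x2*x3*(x1⁻¹*x2⁻¹ + x1⁻¹*x3⁻¹ + x2⁻¹*x3⁻¹)
      = w1*(x2 + x3 + x4) + w2*(x1 + x3 + x4) + w3*(x1 + x2 + x4) + w4*(x1 + x2 + x3) := by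
    field_simp
    ring
  have e2 : w1*x2*x3*x4*(x2⁻¹ + x3⁻¹ + x4⁻¹) + w2*x1*x3*x4*(x1⁻¹ + x3⁻¹ + x4⁻¹)
      + w3*x1*x2*x4*(x1⁻¹ + x2⁻¹ + x4⁻¹) + w4*x1*x2*x3*(x1⁻¹ + x2⁻¹ + x3⁻¹)
      = w1*(x2*x3 + x2*x4 + x3*x4) + w2*(x1*x3 + x1*x4 + x3*x4)
      + w3*(x1*x2 + x1*x4 + x2*x4) + w4*(x1*x2 + x1*x3 + x2*x3) := by
    field_simp
    ring
  rw [e1, e2] at h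
  linarith

/-- Newton's inequality `3 E₁ E₃ ≤ E₂²` for nonnegative nodes. -/
theorem newton_second {w1 w2 w3 w4 x1 x2 x3 x4 : ℝ}
    (hw1 : 0 < w1) (hw2 : 0 < w2) (hw3 : 0 < w3) (hw4 : 0 < w4)
    (hx1 : 0 ≤ x1) (hx2 : 0 ≤ x2) (hx3 : 0 ≤ x3) (hx4 : 0 ≤ x4) :
    3*(w1*(x2 + x3 + x4) + w2*(x1 + x3 + x4) + w3*(x1 + x2 + x4) + w4*(x1 + x2 + x3))
      *(w1*x2*x3*x4 + w2*x1*x3*x4 + w3*x1*x2*x4 + w4*x1*x2*x3) ≤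
    (w1*(x2*x3 + x2*x4 + x3*x4) + w2*(x1*x3 + x1*x4 + x3*x4)
      + w3*(x1*x2 + x1*x4 + x2*x4) + w4*(x1*x2 + x1*x3 + x2*x3))^2 := by
  have tends : ∀ g : ℝ → ℝ, Continuous g →
      Filter.Tendsto g (nhdsWithin 0 (Set.Ioi 0)) (nhds (g 0)) := fun g hg =>
    hg.continuousAt.tendsto.mono_left nhdsWithin_le_nhds
  have h := le_of_tendsto_of_tendsto
    (tends (fun ε => 3*(w1*((x2+ε) + (x3+ε) + (x4+ε)) + w2*((x1+ε) + (x3+ε) + (x4+ε))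
        + w3*((x1+ε) + (x2+ε) + (x4+ε)) + w4*((x1+ε) + (x2+ε) + (x3+ε)))
      *(w1*(x2+ε)*(x3+ε)*(x4+ε) + w2*(x1+ε)*(x3+ε)*(x4+ε) + w3*(x1+ε)*(x2+ε)*(x4+ε)
        + w4*(x1+ε)*(x2+ε)*(x3+ε))) (by fun_prop))
    (tends (fun ε => (w1*((x2+ε)*(x3+ε) + (x2+ε)*(x4+ε) + (x3+ε)*(x4+ε))
      + w2*((x1+ε)*(x3+ε) + (x1+ε)*(x4+ε) + (x3+ε)*(x4+ε))
      + w3*((x1+ε)*(x2+ε) + (x1+ε)*(x4+ε) + (x2+ε)*(x4+ε))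
      + w4*((x1+ε)*(x2+ε) + (x1+ε)*(x3+ε) + (x2+ε)*(x3+ε)))^2) (by fun_prop))
    (by
      filter_upwards [self_mem_nhdsWithin] with ε hε
      exact newton_second_of_pos hw1 hw2 hw3 hw4 (add_pos_of_nonneg_of_pos hx1 hε)
        (add_pos_of_nonneg_of_pos hx2 hε) (add_pos_of_nonneg_of_pos hx3 hε)
        (add_pos_of_nonneg_of_pos hx4 hε))
  simpa only [add_zero] using h

/-- On the plane `E₁ = 3`, the weighted cubic `E₃` is at most `1`, with equality only at
`x = (1, 1, 1, 1)`. -/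
theorem weighted_cubic_le_one {w1 w2 w3 w4 x1 x2 x3 x4 : ℝ}
    (hw1 : 0 < w1) (hw2 : 0 < w2) (hw3 : 0 < w3) (hw4 : 0 < w4) (hw : w1 + w2 + w3 + w4 = 1)
    (hx1 : 0 ≤ x1) (hx2 : 0 ≤ x2) (hx3 : 0 ≤ x3) (hx4 : 0 ≤ x4)
    (hE1 : w1*(x2 + x3 + x4) + w2*(x1 + x3 + x4) + w3*(x1 + x2 + x4) + w4*(x1 + x2 + x3) = 3) :
    w1*x2*x3*x4 + w2*x1*x3*x4 + w3*x1*x2*x4 + w4*x1*x2*x3 ≤ 1 ∧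
      (w1*x2*x3*x4 + w2*x1*x3*x4 + w3*x1*x2*x4 + w4*x1*x2*x3 = 1 →
        x1 = 1 ∧ x2 = 1 ∧ x3 = 1 ∧ x4 = 1) := by
  have h1 := newton_first_of_sum_eq_one (x1 := x1) (x2 := x2) (x3 := x3) (x4 := x4)
    hw1 hw2 hw3 hw4 hw rfl rfl
  have h2 := newton_second hw1 hw2 hw3 hw4 hx1 hx2 hx3 hx4
  rw [hE1] at h1 h2
  obtain ⟨E2, hE2⟩ : ∃ E2, E2 = w1*(x2*x3 + x2*x4 + x3*x4) + w2*(x1*x3 + x1*x4 + x3*x4)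
      + w3*(x1*x2 + x1*x4 + x2*x4) + w4*(x1*x2 + x1*x3 + x2*x3) := ⟨_, rfl⟩
  have hpos : 0 ≤ E2 := by rw [hE2]; positivity
  rw [← hE2] at h1 h2
  refine ⟨by nlinarith [h1.1], fun h => ?_⟩
  rw [h] at h2
  simpa using h1.2 (by nlinarith [h1.1])

/-- An interior critical point of `f` on the simplex is its unique maximizer. -/
theorem unique_max_of_critical {v1 v2 v3 v4 p1 p2 p3 p4 L : ℝ}
    (hv1 : 0 < v1) (hv2 : 0 < v2) (hv3 : 0 < v3) (hv4 : 0 < v4)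
    (hp1 : 0 < p1) (hp2 : 0 < p2) (hp3 : 0 < p3) (hp4 : 0 < p4) (hp : p1 + p2 + p3 + p4 = 1)
    (h1 : v2*p3*p4 + v3*p2*p4 + v4*p2*p3 = L)
    (h2 : v1*p3*p4 + v3*p1*p4 + v4*p1*p3 = L)
    (h3 : v1*p2*p4 + v2*p1*p4 + v4*p1*p2 = L)
    (h4 : v1*p2*p3 + v2*p1*p3 + v3*p1*p2 = L)
    {q1 q2 q3 q4 : ℝ} (hq1 : 0 ≤ q1) (hq2 : 0 ≤ q2) (hq3 : 0 ≤ q3) (hq4 : 0 ≤ q4)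
    (hq : q1 + q2 + q3 + q4 = 1) :
    v1*q2*q3*q4 + v2*q1*q3*q4 + v3*q1*q2*q4 + v4*q1*q2*q3 ≤
      v1*p2*p3*p4 + v2*p1*p3*p4 + v3*p1*p2*p4 + v4*p1*p2*p3 ∧
    (v1*q2*q3*q4 + v2*q1*q3*q4 + v3*q1*q2*q4 + v4*q1*q2*q3 =
      v1*p2*p3*p4 + v2*p1*p3*p4 + v3*p1*p2*p4 + v4*p1*p2*p3 →
      q1 = p1 ∧ q2 = p2 ∧ q3 = p3 ∧ q4 = p4) := by
  obtain ⟨W, hW⟩ : ∃ W, W = v1*p2*p3*p4 + v2*p1*p3*p4 + v3*p1*p2*p4 + v4*p1*p2*p3 := ⟨_, rfl⟩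
  have hWpos : 0 < W := by rw [hW]; positivity
  have hWL : 3*W = L := by
    rw [hW]
    linear_combination p1*h1 + p2*h2 + p3*h3 + p4*h4 + L*hp
  obtain ⟨x1, rfl⟩ : ∃ x, q1 = p1*x := ⟨q1/p1, by field_simp⟩
  obtain ⟨x2, rfl⟩ : ∃ x, q2 = p2*x := ⟨q2/p2, by field_simp⟩
  obtain ⟨x3, rfl⟩ : ∃ x, q3 = p3*x := ⟨q3/p3, by field_simp⟩
  obtain ⟨x4, rfl⟩ : ∃ x, q4 = p4*x := ⟨q4/p4, by field_simp⟩
  have hx1 := nonneg_of_mul_nonneg_right hq1 hp1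
  have hx2 := nonneg_of_mul_nonneg_right hq2 hp2
  have hx3 := nonneg_of_mul_nonneg_right hq3 hp3
  have hx4 := nonneg_of_mul_nonneg_right hq4 hp4
  have hsum : v1*p2*p3*p4/W + v2*p1*p3*p4/W + v3*p1*p2*p4/W + v4*p1*p2*p3/W = 1 := by
    rw [← add_div, ← add_div, ← add_div, ← hW, div_self hWpos.ne']
  have hE1 : v1*p2*p3*p4/W*(x2 + x3 + x4) + v2*p1*p3*p4/W*(x1 + x3 + x4)
      + v3*p1*p2*p4/W*(x1 + x2 + x4) + v4*p1*p2*p3/W*(x1 + x2 + x3) = 3 := by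
    field_simp
    linear_combination p1*x1*h1 + p2*x2*h2 + p3*x3*h3 + p4*x4*h4 + L*hq - hWL
  have hE3 : v1*p2*p3*p4/W*x2*x3*x4 + v2*p1*p3*p4/W*x1*x3*x4 + v3*p1*p2*p4/W*x1*x2*x4
      + v4*p1*p2*p3/W*x1*x2*x3 = (v1*(p2*x2)*(p3*x3)*(p4*x4) + v2*(p1*x1)*(p3*x3)*(p4*x4)
        + v3*(p1*x1)*(p2*x2)*(p4*x4) + v4*(p1*x1)*(p2*x2)*(p3*x3))/W := by
    ring
  have h := weighted_cubic_le_one (by positivity) (by positivity) (by positivity) (by positivity)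
    hsum hx1 hx2 hx3 hx4 hE1
  rw [hE3, div_le_one hWpos, div_eq_one_iff_eq hWpos.ne'] at h
  rw [← hW]
  refine ⟨h.1, fun heq => ?_⟩
  obtain ⟨rfl, rfl, rfl, rfl⟩ := h.2 heq
  simp

/-- If `∂₁f = ∂₂f = ∂₃f = ∂₄f` at `(y1, z, y3, 1)` with `1 < y1`, then `z` is not negative. -/
theorem not_critical_of_neg {v1 v2 v3 v4 y1 z y3 : ℝ}
    (hv2 : 0 < v2) (hv3 : 0 < v3) (hv23 : v2 < v3) (hv14 : v1 < v4)
    (hv1 : 0 < v1) (hy1 : 1 < y1) (hz : z < 0)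
    (h1 : v2*y3 + v3*z + v4*z*y3 = v1*z*y3 + v2*y1*y3 + v3*y1*z)
    (h2 : v1*y3 + v3*y1 + v4*y1*y3 = v1*z*y3 + v2*y1*y3 + v3*y1*z)
    (h3 : v1*z + v2*y1 + v4*y1*z = v1*z*y3 + v2*y1*y3 + v3*y1*z) : False := by
  have e23 : (v3 - v2)*y1 = (z - y3)*(v1 + v4*y1) := by linear_combination h2 - h3
  have hlt : 0 < z - y3 := by
    refine pos_of_mul_pos_left (b := v1 + v4*y1) ?_ (by nlinarith)
    rw [← e23]
    exact mul_pos (by linarith) (by linarith)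
  have hy3 : y3 < 0 := by linarith
  have e14 : (v4 - v1)*(z*y3) = (y1 - 1)*(v2*y3 + v3*z) := by linear_combination h1
  have hl : 0 < (v4 - v1)*(z*y3) := mul_pos (by linarith) (mul_pos_of_neg_of_neg hz hy3)
  have hr : (y1 - 1)*(v2*y3 + v3*z) < 0 := mul_neg_of_pos_of_neg (by linarith)
    (by nlinarith [mul_neg_of_pos_of_neg hv2 hy3, mul_neg_of_pos_of_neg hv3 hz])
  linarith


/-- Theorem 2.1 (case (v)): the analytic D-optimal allocation for the `2²`
main-effects model. With `y1` the unique root `> 1` of the quartic, `y2` and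
`y3` given by the explicit formulas, the allocation
`pᵢ = yᵢ/(1 + y1 + y2 + y3)` (with `y4 = 1`) is the unique maximizer of `f`
over the simplex `S4`. -/
theorem stmt_6 (v1 v2 v3 v4 : ℝ)
    (hv1 : 0 < v1) (hv12 : v1 < v2) (hv23 : v2 < v3) (hv34 : v3 < v4)
    (hv4 : v4 < v1 + v2 + v3)
    (c0 c1 c2 c3 c4 : ℝ)
    (hc0 : c0 = 2*v1^3*(-v1 + v2 + v3 + v4))
    (hc1 : c1 = v1^2*((-v1 - v2 + v3 + v4)^2 + 4*(v4 - v1)*(v2 + v4)))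
    (hc2 : c2 = 2*v1*v4*(2*(v1 - v4)^2 - (v2 - v3)^2 - (v1 + v4)*(v2 + v3)))
    (hc3 : c3 = v4^2*((v1 - v2 + v3 - v4)^2 - 4*(v4 - v1)*(v1 + v2)))
    (hc4 : c4 = 2*v4^3*(v1 + v2 + v3 - v4))
    (y1 : ℝ) (hy1 : 1 < y1)
    (hy1root : c0 + c1*y1 + c2*y1^2 + c3*y1^3 + c4*y1^4 = 0)
    (D2 : ℝ)
    (hD2 : D2 = ((v1 + v4*y1)^2 - (v3 - v2)*v4*y1^2)^2
        - 4*v2*(v4 - v3)*(v1 + v4*y1)^2*y1^2)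
    (y2 : ℝ)
    (hy2 : y2 = 1/2 + (v3 - v2)*y1/(2*(v1 + v4*y1)) - (v2 + v3 - v4)*y1/(2*v1)
        + Real.sqrt D2/(2*v1*(v1 + v4*y1)))
    (y3 : ℝ)
    (hy3 : y3 = 1 + (v4 - v3)*y1*y2/(v2*y1 + v1*y2))
    (p1 p2 p3 p4 : ℝ)
    (hp1 : p1 = y1/(1 + y1 + y2 + y3))
    (hp2 : p2 = y2/(1 + y1 + y2 + y3))
    (hp3 : p3 = y3/(1 + y1 + y2 + y3))
    (hp4 : p4 = 1/(1 + y1 + y2 + y3)) :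
    1 < y1 ∧ 1 < y2 ∧ 1 < y3 ∧
    (0 ≤ p1 ∧ 0 ≤ p2 ∧ 0 ≤ p3 ∧ 0 ≤ p4 ∧ p1 + p2 + p3 + p4 = 1) ∧
    (∀ q1 q2 q3 q4 : ℝ, 0 ≤ q1 → 0 ≤ q2 → 0 ≤ q3 → 0 ≤ q4 →
      q1 + q2 + q3 + q4 = 1 →
      v1*q2*q3*q4 + v2*q1*q3*q4 + v3*q1*q2*q4 + v4*q1*q2*q3 ≤
      v1*p2*p3*p4 + v2*p1*p3*p4 + v3*p1*p2*p4 + v4*p1*p2*p3) ∧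
    (∀ q1 q2 q3 q4 : ℝ, 0 ≤ q1 → 0 ≤ q2 → 0 ≤ q3 → 0 ≤ q4 →
      q1 + q2 + q3 + q4 = 1 →
      v1*q2*q3*q4 + v2*q1*q3*q4 + v3*q1*q2*q4 + v4*q1*q2*q3 =
      v1*p2*p3*p4 + v2*p1*p3*p4 + v3*p1*p2*p4 + v4*p1*p2*p3 →
      q1 = p1 ∧ q2 = p2 ∧ q3 = p3 ∧ q4 = p4) := by
  have hv2 : 0 < v2 := by linarith
  have hv3 : 0 < v3 := by linarith
  have hv4_pos : 0 < v4 := by linarith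
  have hy1_pos : 0 < y1 := by linarith
  have hA : 0 < v1*(v1 + v4*y1) := by positivity
  obtain ⟨A, hA_def⟩ : ∃ A, A = v1*(v1 + v4*y1) := ⟨_, rfl⟩
  obtain ⟨B, hB⟩ : ∃ B, B = v1^2 + 2*v1*v4*y1 - 2*v1*v2*y1 + v4^2*y1^2 - v2*v4*y1^2
    - v3*v4*y1^2 := ⟨_, rfl⟩
  obtain ⟨C, hC⟩ : ∃ C, C = v2*y1*(v1 + (v4 + v3 - v2)*y1) := ⟨_, rfl⟩
  rw [← hA_def] at hA
  have hC_pos : 0 < C := by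
    rw [hC]
    have : 0 < v4 + v3 - v2 := by linarith
    positivity
  have hdisc : D2 = B^2 + 4*A*C := by rw [hD2, hA_def, hB, hC]; ring
  have hD2_pos : 0 < D2 := by rw [hdisc]; positivity
  obtain ⟨s, hs⟩ : ∃ s, s = Real.sqrt D2 := ⟨_, rfl⟩
  have hs_sq : s^2 = B^2 + 4*A*C := by rw [hs, Real.sq_sqrt hD2_pos.le, hdisc]
  have hs_nonneg : 0 ≤ s := by rw [hs]; exact Real.sqrt_nonneg _
  have hy2_eq : y2 = (B + s)/(2*A) := by
    rw [hy2, ← hs, hA_def, hB]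
    field_simp
    ring
  obtain ⟨z, hz⟩ : ∃ z, z = (B - s)/(2*A) := ⟨_, rfl⟩
  have hadd : A*(y2 + z) = B := by rw [hy2_eq, hz]; field_simp; ring
  have hmul : A*(y2*z) = -C := by
    rw [hy2_eq, hz]; field_simp; linear_combination -hs_sq
  have hzy : z ≤ y2 := by
    rw [hy2_eq, hz]; exact div_le_div_of_nonneg_right (by linarith) (by linarith)
  -- the quadratic `-A z² + B z + C` has roots `y2 > 1` and `z < 0`
  have hyz : y2*z < 0 := by
    by_contra! h
    have := mul_nonneg hA.le h
    linarith
  have hz_neg : z < 0 := by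
    by_contra! h
    exact hyz.not_ge (mul_nonneg (h.trans hzy) h)
  have hQ1 : 0 < -A + B + C := by
    have : -A + B + C = (v1 + v2*y1 + (v4 - v3)*y1)*((v4 - v2)*y1) := by
      rw [hA_def, hB, hC]; ring
    rw [this]
    have h1 : 0 < v4 - v3 := by linarith
    have h2 : 0 < v4 - v2 := by linarith
    positivity
  have hy2_gt : 1 < y2 := by
    have h : 0 < A*((y2 - 1)*(1 - z)) := by linarith
    have h' := pos_of_mul_pos_right h hA.le
    linarith [pos_of_mul_pos_left h' (by linarith : 0 ≤ 1 - z)]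
  have hy2_pos : 0 < y2 := by linarith
  have hQy : -A*y2^2 + B*y2 + C = 0 := by linear_combination -y2*hadd + hmul
  have hQz : -A*z^2 + B*z + C = 0 := by linear_combination -z*hadd + hmul
  -- the quadratic `d t² + e t + g` expresses `∂₁f = ∂₄f` after eliminating the third coordinate
  obtain ⟨d, hd⟩ : ∃ d, d = (v4 - v1)*(v1 + (v4 - v3)*y1) + v1*v3*(1 - y1) := ⟨_, rfl⟩
  obtain ⟨e, he⟩ : ∃ e, e = v2*(1 - y1)*(v1 + (v4 - v3)*y1) + (v4 - v1)*v2*y1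
    + v2*v3*y1*(1 - y1) := ⟨_, rfl⟩
  obtain ⟨g, hg⟩ : ∃ g, g = v2^2*y1*(1 - y1) := ⟨_, rfl⟩
  have hres : (-A*g - C*d)^2 - (-A*e - B*d)*(B*g - C*e) = 0 := by
    subst hA_def hB hC hd he hg hc0 hc1 hc2 hc3 hc4
    linear_combination (v2^2*v3^2 - v2^2*v3*v4)*y1^3*hy1root
  have hprod : (d*y2^2 + e*y2 + g)*(d*z^2 + e*z + g) = 0 := by
    refine (mul_eq_zero.1 (?_ : A^2*_ = 0)).resolve_left (by positivity)
    have hB' := hadd.symm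
    have hC' : C = -(A*(y2*z)) := by linarith
    rw [hB', hC'] at hres
    linear_combination hres
  have hQ_eq : ∀ t, -A*t^2 + B*t + C = ((v1*t + v2*y1) + (v4 - v3)*y1*t)
      *(v1 + v4*y1 - (v1*t + v2*y1)) + v3*y1*(1 - t)*(v1*t + v2*y1) := fun t => by
    rw [hA_def, hB, hC]; ring
  have hR_eq : ∀ t, d*t^2 + e*t + g = ((v1*t + v2*y1) + (v4 - v3)*y1*t)
      *(v2*(1 - y1) + (v4 - v1)*t) + v3*t*(1 - y1)*(v1*t + v2*y1) := fun t => by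
    rw [hd, he, hg]; ring
  have critical : ∀ t u, v1*t + v2*y1 ≠ 0 → u = 1 + (v4 - v3)*y1*t/(v1*t + v2*y1) →
      -A*t^2 + B*t + C = 0 → d*t^2 + e*t + g = 0 →
      v2*u + v3*t + v4*t*u = v1*t*u + v2*y1*u + v3*y1*t ∧
      v1*u + v3*y1 + v4*y1*u = v1*t*u + v2*y1*u + v3*y1*t ∧
      v1*t + v2*y1 + v4*y1*t = v1*t*u + v2*y1*u + v3*y1*t := by
    intro t u hN hu hQ hR
    have hNu : (v1*t + v2*y1)*u = v1*t + v2*y1 + (v4 - v3)*y1*t := by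
      rw [hu]; field_simp
    rw [hQ_eq] at hQ
    rw [hR_eq] at hR
    refine ⟨?_, ?_, by linear_combination -hNu⟩
    · refine mul_left_cancel₀ hN ?_
      linear_combination hR + (v2*(1 - y1) + (v4 - v1)*t)*hNu
    · refine mul_left_cancel₀ hN ?_
      linear_combination hQ + (v1 + v4*y1 - (v1*t + v2*y1))*hNu
  have hRy : d*y2^2 + e*y2 + g = 0 := by
    refine (mul_eq_zero.1 hprod).resolve_right fun hRz => ?_
    have hNz : v1*z + v2*y1 ≠ 0 := fun h0 => by
      have hQ0 := hQz
      rw [hQ_eq, h0] at hQ0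
      have h1 : (v4 - v3)*y1*(v1 + v4*y1)*z < 0 := by
        have : 0 < v4 - v3 := by linarith
        exact mul_neg_of_pos_of_neg (by positivity) hz_neg
      linarith
    obtain ⟨e1, e2, e3⟩ := critical z _ hNz rfl hQz hRz
    exact not_critical_of_neg hv2 hv3 hv23 (by linarith) hv1 hy1 hz_neg e1 e2 e3
  have hN_pos : 0 < v1*y2 + v2*y1 := by positivity
  have hy3' : y3 = 1 + (v4 - v3)*y1*y2/(v1*y2 + v2*y1) := by rw [hy3, add_comm (v2*y1)]
  have hy3_gt : 1 < y3 := by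
    have : 0 < v4 - v3 := by linarith
    have : 0 < (v4 - v3)*y1*y2/(v1*y2 + v2*y1) := by positivity
    linarith
  have hy3_pos : 0 < y3 := by linarith
  obtain ⟨e1, e2, e3⟩ := critical y2 y3 hN_pos.ne' hy3' hQy hRy
  have hS : 0 < 1 + y1 + y2 + y3 := by positivity
  have hp1_pos : 0 < p1 := by rw [hp1]; positivity
  have hp2_pos : 0 < p2 := by rw [hp2]; positivity
  have hp3_pos : 0 < p3 := by rw [hp3]; positivity
  have hp4_pos : 0 < p4 := by rw [hp4]; positivity
  have hp : p1 + p2 + p3 + p4 = 1 := by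
    rw [hp1, hp2, hp3, hp4]; field_simp; ring
  have main := @unique_max_of_critical v1 v2 v3 v4 p1 p2 p3 p4 (v1*p2*p3 + v2*p1*p3 + v3*p1*p2)
    hv1 hv2 hv3 hv4_pos hp1_pos hp2_pos hp3_pos hp4_pos hp
    (by rw [hp1, hp2, hp3, hp4]; field_simp; linear_combination e1)
    (by rw [hp1, hp2, hp3, hp4]; field_simp; linear_combination e2)
    (by rw [hp1, hp2, hp3, hp4]; field_simp; linear_combination e3) rfl
  exact ⟨hy1, hy2_gt, hy3_gt, ⟨hp1_pos.le, hp2_pos.le, hp3_pos.le, hp4_pos.le, hp⟩,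
    fun q1 q2 q3 q4 h1 h2 h3 h4 hq => (main h1 h2 h3 h4 hq).1,
    fun q1 q2 q3 q4 h1 h2 h3 h4 hq => (main h1 h2 h3 h4 hq).2⟩
end

section
/- Suppose 0 < u2 = u3 ≤ u4 < u2 + u3 (i.e., u4 < 2 u2). Then the unique maximizer of f_u over the simplex S4 is given by p1 = 1/3, p2 = p3 = 2 u2 / (3 (4 u2 − u4)), p4 = 1/2 − (4 u2 + u4) / (6 (4 u2 − u4)). -/
/-- The gap between `4 * u ^ 2 / 27` and the scaled objective, as a sum of terms that are
nonnegative on the simplex. -/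
theorem objective_gap (u v a b c d : ℝ) (h : a + b + c + d = 1) :
    4 * u ^ 2 / 27 - (4 * u - v) * (u * a * c * d + u * a * b * d + v * a * b * c) =
      u ^ 2 * ((a - 1 / 3) ^ 2 * (4 / 3 - a)) +
      a * ((u * (1 - a) - (4 * u - v) * (b + c) / 2) ^ 2 +
        (4 * u - v) * v * (b - c) ^ 2 / 4) := by
  obtain rfl : d = 1 - a - b - c := by linarith
  ring

/-- Case (2b): for `0 < u2 = u3 ≤ u4 < u2 + u3`, the unique maximizer of
`f_u(p) = u2 p1 p3 p4 + u3 p1 p2 p4 + u4 p1 p2 p3` over the simplex `S4` is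
`p1 = 1/3`, `p2 = p3 = 2u2/(3(4u2 - u4))`, `p4 = 1/2 - (4u2 + u4)/(6(4u2 - u4))`. -/
theorem stmt_7 (u2 u3 u4 : ℝ)
    (hu2 : 0 < u2) (hu23 : u2 = u3) (hu34 : u3 ≤ u4) (hu4 : u4 < u2 + u3)
    (p1 p2 p3 p4 : ℝ)
    (hp1 : p1 = 1/3)
    (hp2 : p2 = 2*u2/(3*(4*u2 - u4)))
    (hp3 : p3 = 2*u2/(3*(4*u2 - u4)))
    (hp4 : p4 = 1/2 - (4*u2 + u4)/(6*(4*u2 - u4))) :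
    (0 ≤ p1 ∧ 0 ≤ p2 ∧ 0 ≤ p3 ∧ 0 ≤ p4 ∧ p1 + p2 + p3 + p4 = 1) ∧
    (∀ q1 q2 q3 q4 : ℝ, 0 ≤ q1 → 0 ≤ q2 → 0 ≤ q3 → 0 ≤ q4 →
      q1 + q2 + q3 + q4 = 1 →
      u2*q1*q3*q4 + u3*q1*q2*q4 + u4*q1*q2*q3 ≤
      u2*p1*p3*p4 + u3*p1*p2*p4 + u4*p1*p2*p3) ∧
    (∀ q1 q2 q3 q4 : ℝ, 0 ≤ q1 → 0 ≤ q2 → 0 ≤ q3 → 0 ≤ q4 →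
      q1 + q2 + q3 + q4 = 1 →
      u2*q1*q3*q4 + u3*q1*q2*q4 + u4*q1*q2*q3 =
      u2*p1*p3*p4 + u3*p1*p2*p4 + u4*p1*p2*p3 →
      q1 = p1 ∧ q2 = p2 ∧ q3 = p3 ∧ q4 = p4) := by
  subst hu23
  have hv : 0 < u4 := hu2.trans_le hu34
  have hD : 0 < 4 * u2 - u4 := by linarith
  have hp4' : p4 = (4 * u2 - 2 * u4) / (3 * (4 * u2 - u4)) := by
    rw [hp4]; field_simp; ring
  have hsum : p1 + p2 + p3 + p4 = 1 := by
    have : p2 + p3 + p4 = 2 / 3 := by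
      rw [hp2, hp3, hp4', ← add_div, ← add_div, div_eq_iff (by positivity)]; ring
    linarith
  have hval : (4 * u2 - u4) * (u2*p1*p3*p4 + u2*p1*p2*p4 + u4*p1*p2*p3) = 4 * u2 ^ 2 / 27 := by
    rw [hp1, hp2, hp3, hp4']; field_simp; ring
  refine ⟨⟨?_, ?_, ?_, ?_, hsum⟩, ?_, ?_⟩
  · rw [hp1]; norm_num
  · rw [hp2]; positivity
  · rw [hp3]; positivity
  · rw [hp4']; exact div_nonneg (by linarith) (by positivity)
  · intro q1 q2 q3 q4 h1 h2 h3 h4 hs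
    refine le_of_mul_le_mul_left ?_ hD
    rw [hval, ← sub_nonneg, objective_gap _ _ _ _ _ _ hs]
    have : 0 ≤ 4 / 3 - q1 := by linarith
    positivity
  · intro q1 q2 q3 q4 h1 h2 h3 h4 hs heq
    have hgap := objective_gap u2 u4 q1 q2 q3 q4 hs
    rw [heq, hval, sub_self] at hgap
    have hpos : 0 < 4 / 3 - q1 := by linarith
    obtain ⟨hA, hB⟩ := (add_eq_zero_iff_of_nonneg (by positivity) (by positivity)).1 hgap.symm
    have hq1 : q1 = 1 / 3 := by
      simpa [hu2.ne', hpos.ne', sub_eq_zero] using hA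
    subst hq1
    have hB' := (mul_eq_zero.1 hB).resolve_left (by norm_num)
    obtain ⟨ht, hd⟩ := (add_eq_zero_iff_of_nonneg (by positivity) (by positivity)).1 hB'
    have h23 : q2 = q3 := by
      simpa [hD.ne', hv.ne', sub_eq_zero] using hd
    subst h23
    have ht' := pow_eq_zero_iff two_ne_zero |>.1 ht
    have hq2 : q2 = p2 := by
      rw [hp2, eq_div_iff (by positivity)]; linarith
    exact ⟨hp1.symm, hq2, by rw [hq2, hp2, hp3], by linarith⟩
end

section
/- Suppose 0 < u2 ≤ u3 = u4. Then the unique maximizer of f_u over the simplex S4 is given by p1 = 1/3, p2 = 1/2 − (u2 + 4 u3) / (6 (4 u3 − u2)), p3 = p4 = 2 u3 / (3 (4 u3 − u2)). -/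
/-- Sum-of-squares certificate: on the hyperplane `x + y + z + w = 1`, the gap between the optimal
value `4 b ^ 2 / (27 (4 b - a))` and the objective. -/
theorem gap_eq_sum_of_squares (a b x y z w : ℝ) (hd : 4 * b - a ≠ 0) (hsum : x + y + z + w = 1) :
    4 * b ^ 2 / (27 * (4 * b - a)) - (a * x * z * w + b * x * y * w + b * x * y * z) =
      b ^ 2 / (4 * b - a) * (4 / 3 - x) * (x - 1 / 3) ^ 2
        + x * ((4 * b - a) / 4) * (z + w - 2 * b * (1 - x) / (4 * b - a)) ^ 2
        + x * (a / 4) * (z - w) ^ 2 := by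
  obtain rfl : y = 1 - x - z - w := by linarith
  field_simp
  ring

/-- Case (2c): for `0 < u2 ≤ u3 = u4`, the unique maximizer of
`f_u(p) = u2 p1 p3 p4 + u3 p1 p2 p4 + u4 p1 p2 p3` over the simplex `S4` is
`p1 = 1/3`, `p2 = 1/2 - (u2 + 4u3)/(6(4u3 - u2))`, `p3 = p4 = 2u3/(3(4u3 - u2))`. -/
theorem stmt_8 (u2 u3 u4 : ℝ)
    (hu2 : 0 < u2) (hu23 : u2 ≤ u3) (hu34 : u3 = u4)
    (p1 p2 p3 p4 : ℝ)
    (hp1 : p1 = 1/3)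
    (hp2 : p2 = 1/2 - (u2 + 4*u3)/(6*(4*u3 - u2)))
    (hp3 : p3 = 2*u3/(3*(4*u3 - u2)))
    (hp4 : p4 = 2*u3/(3*(4*u3 - u2))) :
    (0 ≤ p1 ∧ 0 ≤ p2 ∧ 0 ≤ p3 ∧ 0 ≤ p4 ∧ p1 + p2 + p3 + p4 = 1) ∧
    (∀ q1 q2 q3 q4 : ℝ, 0 ≤ q1 → 0 ≤ q2 → 0 ≤ q3 → 0 ≤ q4 →
      q1 + q2 + q3 + q4 = 1 →
      u2*q1*q3*q4 + u3*q1*q2*q4 + u4*q1*q2*q3 ≤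
      u2*p1*p3*p4 + u3*p1*p2*p4 + u4*p1*p2*p3) ∧
    (∀ q1 q2 q3 q4 : ℝ, 0 ≤ q1 → 0 ≤ q2 → 0 ≤ q3 → 0 ≤ q4 →
      q1 + q2 + q3 + q4 = 1 →
      u2*q1*q3*q4 + u3*q1*q2*q4 + u4*q1*q2*q3 =
      u2*p1*p3*p4 + u3*p1*p2*p4 + u4*p1*p2*p3 →
      q1 = p1 ∧ q2 = p2 ∧ q3 = p3 ∧ q4 = p4) := by
  subst hu34
  have hu3 : 0 < u3 := hu2.trans_le hu23
  have hd : 0 < 4 * u3 - u2 := by linarith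
  have hd0 : 4 * u3 - u2 ≠ 0 := hd.ne'
  have hp2' : p2 = 2 * (2 * u3 - u2) / (3 * (4 * u3 - u2)) := by
    rw [hp2]
    field_simp
    ring
  have hval : u2*p1*p3*p4 + u3*p1*p2*p4 + u3*p1*p2*p3 = 4 * u3 ^ 2 / (27 * (4 * u3 - u2)) := by
    rw [hp1, hp2', hp3, hp4]
    generalize hd_eq : 4 * u3 - u2 = d at hd0
    obtain rfl : u2 = 4 * u3 - d := by linarith
    field_simp
    ring
  have hsum : p1 + p2 + p3 + p4 = 1 := by
    rw [hp1, hp2', hp3, hp4]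
    generalize hd_eq : 4 * u3 - u2 = d at hd0
    obtain rfl : u2 = 4 * u3 - d := by linarith
    field_simp
    ring
  have hterms : ∀ q1 q2 q3 q4 : ℝ, 0 ≤ q1 → 0 ≤ q2 → 0 ≤ q3 → 0 ≤ q4 → q1 + q2 + q3 + q4 = 1 →
      0 ≤ u3 ^ 2 / (4 * u3 - u2) * (4 / 3 - q1) * (q1 - 1 / 3) ^ 2 ∧
      0 ≤ q1 * ((4 * u3 - u2) / 4) * (q3 + q4 - 2 * u3 * (1 - q1) / (4 * u3 - u2)) ^ 2 ∧
      0 ≤ q1 * (u2 / 4) * (q3 - q4) ^ 2 := by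
    intro q1 q2 q3 q4 h1 h2 h3 h4 h
    have hq : 0 ≤ 4 / 3 - q1 := by linarith
    refine ⟨?_, ?_, ?_⟩ <;> positivity
  refine ⟨⟨?_, ?_, ?_, ?_, hsum⟩, ?_, ?_⟩
  · rw [hp1]; norm_num
  · rw [hp2']
    have : 0 ≤ 2 * u3 - u2 := by linarith
    positivity
  · rw [hp3]; positivity
  · rw [hp4]; positivity
  · intro q1 q2 q3 q4 h1 h2 h3 h4 h
    obtain ⟨t1, t2, t3⟩ := hterms q1 q2 q3 q4 h1 h2 h3 h4 h
    linarith [gap_eq_sum_of_squares u2 u3 q1 q2 q3 q4 hd0 h]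
  · intro q1 q2 q3 q4 h1 h2 h3 h4 h heq
    obtain ⟨t1, t2, t3⟩ := hterms q1 q2 q3 q4 h1 h2 h3 h4 h
    have hgap := gap_eq_sum_of_squares u2 u3 q1 q2 q3 q4 hd0 h
    have hpos : 0 < u3 ^ 2 / (4 * u3 - u2) * (4 / 3 - q1) :=
      mul_pos (by positivity) (by linarith)
    have e1 : q1 = 1 / 3 := by
      have hz := le_antisymm (by linarith) t1
      exact sub_eq_zero.mp (pow_eq_zero_iff two_ne_zero |>.mp
        ((mul_eq_zero.mp hz).resolve_left hpos.ne'))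
    have hq1 : 0 < q1 := by rw [e1]; norm_num
    have e2 : q3 + q4 = 2 * u3 * (1 - q1) / (4 * u3 - u2) := by
      have hz := le_antisymm (by linarith) t2
      exact sub_eq_zero.mp (pow_eq_zero_iff two_ne_zero |>.mp
        ((mul_eq_zero.mp hz).resolve_left (by positivity)))
    have e3 : q3 = q4 := by
      have hz := le_antisymm (by linarith) t3
      exact sub_eq_zero.mp (pow_eq_zero_iff two_ne_zero |>.mp
        ((mul_eq_zero.mp hz).resolve_left (by positivity)))
    have e4 : 2 * u3 * (1 - q1) / (4 * u3 - u2) = p3 + p4 := by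
      rw [e1, hp3, hp4]
      field_simp
      ring
    have hp34 : p3 = p4 := hp3.trans hp4.symm
    refine ⟨?_, ?_, ?_, ?_⟩ <;> linarith
end

section
/- Suppose 0 < u2 < u3 < u4 < u2 + u3, and let Δ = 2 u2 u3 + 2 u2 u4 + 2 u3 u4 − u2² − u3² − u4². Then Δ = (√u2 + √u3 + √u4)(√u2 + √u3 − √u4)(√u2 + √u4 − √u3)(√u3 + √u4 − √u2) > 0, and the unique maximizer of f_u over the simplex S4 is p1 = 1/3, p2 = 2 u2 (u3 + u4 − u2)/(3Δ), p3 = 2 u3 (u2 + u4 − u3)/(3Δ), p4 = 2 u4 (u2 + u3 − u4)/(3Δ). -/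
/-- The gap between `4 u2 u3 u4 / 27` and `Δ f_u(q)` is, after scaling by `u2 u3 u4`, a combination
of squares with coefficients that are nonnegative on the simplex. -/
lemma simplex_gap_eq {u2 u3 u4 Δ q1 q2 q3 q4 : ℝ}
    (hΔ : Δ = 2*u2*u3 + 2*u2*u4 + 2*u3*u4 - u2^2 - u3^2 - u4^2)
    (hq : q1 + q2 + q3 + q4 = 1) :
    u2*u3*u4 * (4*(u2*u3*u4)/27 - Δ*(u2*q1*q3*q4 + u3*q1*q2*q4 + u4*q1*q2*q3)) =
      (u2*u3*u4)^2 * ((q1 - 1/3)^2 * (4/3 - q1)) +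
      q1 * ((u2*u3*u4 * (q2 + q3 + q4) - Δ/2*(u4*q3 + u3*q4))^2 +
        Δ/4 * (u4*(u2 + u3 - u4)*q3 - u3*(u2 + u4 - u3)*q4)^2) := by
  obtain rfl : q1 = 1 - q2 - q3 - q4 := by linarith
  subst hΔ
  ring

/-- Case (2d): for `0 < u2 < u3 < u4 < u2 + u3`, with
`Δ = 2u2u3 + 2u2u4 + 2u3u4 - u2² - u3² - u4²`, we have the factorization of `Δ`
into square-root factors (hence `Δ > 0`), and the unique maximizer of `f_u`
over the simplex `S4` is `p1 = 1/3`, `p2 = 2u2(u3 + u4 - u2)/(3Δ)`,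
`p3 = 2u3(u2 + u4 - u3)/(3Δ)`, `p4 = 2u4(u2 + u3 - u4)/(3Δ)`. -/
theorem stmt_9 (u2 u3 u4 : ℝ)
    (hu2 : 0 < u2) (hu23 : u2 < u3) (hu34 : u3 < u4) (hu4 : u4 < u2 + u3)
    (Δ : ℝ)
    (hΔ : Δ = 2*u2*u3 + 2*u2*u4 + 2*u3*u4 - u2^2 - u3^2 - u4^2)
    (p1 p2 p3 p4 : ℝ)
    (hp1 : p1 = 1/3)
    (hp2 : p2 = 2*u2*(u3 + u4 - u2)/(3*Δ))
    (hp3 : p3 = 2*u3*(u2 + u4 - u3)/(3*Δ))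
    (hp4 : p4 = 2*u4*(u2 + u3 - u4)/(3*Δ)) :
    (Δ = (Real.sqrt u2 + Real.sqrt u3 + Real.sqrt u4)
        * (Real.sqrt u2 + Real.sqrt u3 - Real.sqrt u4)
        * (Real.sqrt u2 + Real.sqrt u4 - Real.sqrt u3)
        * (Real.sqrt u3 + Real.sqrt u4 - Real.sqrt u2) ∧ 0 < Δ) ∧
    (0 ≤ p1 ∧ 0 ≤ p2 ∧ 0 ≤ p3 ∧ 0 ≤ p4 ∧ p1 + p2 + p3 + p4 = 1) ∧
    (∀ q1 q2 q3 q4 : ℝ, 0 ≤ q1 → 0 ≤ q2 → 0 ≤ q3 → 0 ≤ q4 →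
      q1 + q2 + q3 + q4 = 1 →
      u2*q1*q3*q4 + u3*q1*q2*q4 + u4*q1*q2*q3 ≤
      u2*p1*p3*p4 + u3*p1*p2*p4 + u4*p1*p2*p3) ∧
    (∀ q1 q2 q3 q4 : ℝ, 0 ≤ q1 → 0 ≤ q2 → 0 ≤ q3 → 0 ≤ q4 →
      q1 + q2 + q3 + q4 = 1 →
      u2*q1*q3*q4 + u3*q1*q2*q4 + u4*q1*q2*q3 =
      u2*p1*p3*p4 + u3*p1*p2*p4 + u4*p1*p2*p3 →
      q1 = p1 ∧ q2 = p2 ∧ q3 = p3 ∧ q4 = p4) := by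
  have hu3 : 0 < u3 := hu2.trans hu23
  have hu4' : 0 < u4 := hu3.trans hu34
  have hA : 0 < u2*u3*u4 := by positivity
  have hΔpos : 0 < Δ := by
    nlinarith [mul_pos (sub_pos.2 hu4) (sub_pos.2 hu34), mul_pos (sub_pos.2 hu4) hu2,
      mul_pos hu2 (sub_pos.2 hu23), mul_pos (sub_pos.2 hu23) (sub_pos.2 hu34)]
  have hw2 : 0 < u3 + u4 - u2 := by linarith
  have hw3 : 0 < u2 + u4 - u3 := by linarith
  have hw4 : 0 < u2 + u3 - u4 := by linarith
  have hsum : p1 + p2 + p3 + p4 = 1 := by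
    rw [hp1, hp2, hp3, hp4]
    field_simp
    rw [hΔ]
    ring
  have hmax : Δ*(u2*p1*p3*p4 + u3*p1*p2*p4 + u4*p1*p2*p3) = 4*(u2*u3*u4)/27 := by
    have hL : u2*u3*u4 * (p2 + p3 + p4) - Δ/2*(u4*p3 + u3*p4) = 0 := by
      have h : p2 + p3 + p4 = 2/3 := by linarith
      rw [h, hp3, hp4]
      field_simp
      ring
    have hR : u4*(u2 + u3 - u4)*p3 - u3*(u2 + u4 - u3)*p4 = 0 := by
      rw [hp3, hp4]
      ring
    have h := simplex_gap_eq hΔ hsum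
    rw [hL, hR, hp1] at h
    have h0 : u2*u3*u4 * (4*(u2*u3*u4)/27 -
        Δ*(u2*(1/3)*p3*p4 + u3*(1/3)*p2*p4 + u4*(1/3)*p2*p3)) = 0 := by
      rw [h]
      ring
    rw [hp1]
    linarith [(mul_eq_zero.1 h0).resolve_left hA.ne']
  refine ⟨⟨?_, hΔpos⟩, ⟨?_, ?_, ?_, ?_, hsum⟩, ?_, ?_⟩
  · have h2 := Real.sq_sqrt hu2.le
    have h3 := Real.sq_sqrt hu3.le
    have h4 := Real.sq_sqrt hu4'.le
    generalize √u2 = a at *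
    generalize √u3 = b at *
    generalize √u4 = c at *
    rw [hΔ, ← h2, ← h3, ← h4]
    ring
  · rw [hp1]; norm_num
  · rw [hp2]; positivity
  · rw [hp3]; positivity
  · rw [hp4]; positivity
  · intro q1 q2 q3 q4 h1 h2 h3 h4 hq
    have hgap := simplex_gap_eq hΔ hq
    have hq1 : 0 ≤ 4/3 - q1 := by linarith
    have hnn : 0 ≤ 4*(u2*u3*u4)/27 - Δ*(u2*q1*q3*q4 + u3*q1*q2*q4 + u4*q1*q2*q3) := by
      refine nonneg_of_mul_nonneg_right ?_ hA
      rw [hgap]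
      positivity
    refine le_of_mul_le_mul_left ?_ hΔpos
    linarith
  · intro q1 q2 q3 q4 h1 h2 h3 h4 hq heq
    have hgap := simplex_gap_eq hΔ hq
    rw [heq, hmax, sub_self, mul_zero] at hgap
    have hq1 : 0 < 4/3 - q1 := by linarith
    obtain ⟨hfst, hsnd⟩ := (add_eq_zero_iff_of_nonneg (by positivity) (by positivity)).1 hgap.symm
    have hq1' : q1 = 1/3 := by
      have h := (mul_eq_zero.1 hfst).resolve_left (by positivity)
      have h := (mul_eq_zero.1 h).resolve_right hq1.ne'
      linarith [pow_eq_zero_iff two_ne_zero |>.1 h]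
    have hsq := (mul_eq_zero.1 hsnd).resolve_left (by rw [hq1']; norm_num)
    obtain ⟨hL, hR⟩ := (add_eq_zero_iff_of_nonneg (by positivity) (by positivity)).1 hsq
    replace hL := (pow_eq_zero_iff two_ne_zero).1 hL
    replace hR := (pow_eq_zero_iff two_ne_zero).1
      ((mul_eq_zero.1 hR).resolve_left (by positivity))
    have hs : q2 + q3 + q4 = 2/3 := by linarith
    rw [hs] at hL
    have hq3 : q3 = p3 := by
      rw [hp3, eq_div_iff (by positivity)]
      refine mul_left_cancel₀ (mul_pos hu2 hu4').ne' ?_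
      linear_combination (-3*(u2 + u4 - u3))*hL + (3*Δ/2)*hR
    have hq4 : q4 = p4 := by
      rw [hp4, eq_div_iff (by positivity)]
      refine mul_left_cancel₀ (mul_pos hu2 hu3).ne' ?_
      linear_combination (-3*(u2 + u3 - u4))*hL - (3*Δ/2)*hR
    exact ⟨by linarith, by linarith, hq3, hq4⟩
end

section
/- Let n ≥ 3 and 0 ≤ v1 ≤ v2 ≤ ⋯ ≤ vn with v_{n−2} > 0. If vn ≥ v1 + v2 + ⋯ + v_{n−1}, then f(p) ≤ vn/(n−1)^{n−1} for every p in the simplex S_n, with equality if and only if p1 = ⋯ = p_{n−1} = 1/(n−1) and p_n = 0. -/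
open Finset

lemma prod_le_one_of_sum_le_card {ι : Type*} (s : Finset ι) (q : ι → ℝ)
    (hq : ∀ i ∈ s, 0 ≤ q i) (hsum : ∑ i ∈ s, q i ≤ #s) : ∏ i ∈ s, q i ≤ 1 := by
  have hexp : ∏ i ∈ s, Real.exp (q i - 1) ≤ 1 := by
    rw [← Real.exp_sum, Real.exp_le_one_iff, sum_sub_distrib]
    simpa using hsum
  refine (prod_le_prod hq fun i _ => ?_).trans hexp
  linarith [Real.add_one_le_exp (q i - 1)]

lemma eq_one_of_prod_eq_one_of_sum_le_card {ι : Type*} (s : Finset ι) (q : ι → ℝ)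
    (hq : ∀ i ∈ s, 0 ≤ q i) (hsum : ∑ i ∈ s, q i ≤ #s) (hprod : ∏ i ∈ s, q i = 1) :
    ∀ i ∈ s, q i = 1 := by
  have hexp : ∏ i ∈ s, Real.exp (q i - 1) ≤ 1 := by
    rw [← Real.exp_sum, Real.exp_le_one_iff, sum_sub_distrib]
    simpa using hsum
  by_contra! ⟨i, hi, hne⟩
  have hpos : ∀ j ∈ s, 0 < q j := fun j hj =>
    (hq j hj).lt_of_ne' fun h0 => by simp [prod_eq_zero hj h0] at hprod
  have hlt : ∏ j ∈ s, q j < ∏ j ∈ s, Real.exp (q j - 1) := by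
    refine prod_lt_prod hpos (fun j _ => ?_) ⟨i, hi, ?_⟩
    · linarith [Real.add_one_le_exp (q j - 1)]
    · linarith [Real.add_one_lt_exp (sub_ne_zero.mpr hne)]
  linarith

/-- AM-GM for nonnegative reals whose sum is at most one. -/
lemma prod_le_one_div_card_pow {ι : Type*} (s : Finset ι) (hs : s.Nonempty) (q : ι → ℝ)
    (hq : ∀ i ∈ s, 0 ≤ q i) (hsum : ∑ i ∈ s, q i ≤ 1) :
    ∏ i ∈ s, q i ≤ 1 / (#s : ℝ) ^ #s ∧
      (∏ i ∈ s, q i = 1 / (#s : ℝ) ^ #s → ∀ i ∈ s, q i = 1 / (#s : ℝ)) := by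
  have hc : (0 : ℝ) < #s := by exact_mod_cast hs.card_pos
  have hq' : ∀ i ∈ s, 0 ≤ #s * q i := fun i hi => mul_nonneg hc.le (hq i hi)
  have hsum' : ∑ i ∈ s, #s * q i ≤ (#s : ℝ) := by
    rw [← mul_sum]
    exact mul_le_of_le_one_right hc.le hsum
  have hprod : ∏ i ∈ s, #s * q i = (#s : ℝ) ^ #s * ∏ i ∈ s, q i := by
    rw [prod_mul_distrib, prod_const]
  refine ⟨?_, fun h i hi => ?_⟩
  · rw [le_div_iff₀' (by positivity), ← hprod]
    exact prod_le_one_of_sum_le_card s _ hq' hsum'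
  · rw [eq_div_iff hc.ne', mul_comm]
    refine eq_one_of_prod_eq_one_of_sum_le_card s _ hq' hsum' ?_ i hi
    rw [hprod, h]
    field_simp

section Merge

variable {ι : Type*} [Fintype ι] [DecidableEq ι]

lemma sum_mul_prod_erase_eq (v p : ι → ℝ) (l : ι) :
    ∑ j, v j * ∏ i ∈ univ.erase j, p i =
      ∑ j ∈ univ.erase l, v j * ((p j + p l) * ∏ i ∈ (univ.erase l).erase j, p i) +
        (v l - ∑ j ∈ univ.erase l, v j) * ∏ i ∈ univ.erase l, p i := by
  rw [← add_sum_erase _ _ (mem_univ l), sub_mul, sum_mul, add_sub_left_comm, ← sum_sub_distrib]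
  congr 1
  refine sum_congr rfl fun j hj => ?_
  rw [← mul_prod_erase _ p hj, erase_right_comm,
    ← mul_prod_erase _ p (mem_erase.mpr ⟨(ne_of_mem_erase hj).symm, mem_univ l⟩)]
  ring

/-- AM-GM after merging the weight of `l` into that of `j`. -/
lemma add_mul_prod_erase_le {p : ι → ℝ} (hp0 : ∀ i, 0 ≤ p i) (hp1 : ∑ i, p i = 1) {l j : ι}
    (hj : j ∈ univ.erase l) :
    (p j + p l) * ∏ i ∈ (univ.erase l).erase j, p i ≤
        1 / (#(univ.erase l) : ℝ) ^ #(univ.erase l) ∧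
      ((p j + p l) * ∏ i ∈ (univ.erase l).erase j, p i =
          1 / (#(univ.erase l) : ℝ) ^ #(univ.erase l) →
        p j + p l = 1 / (#(univ.erase l) : ℝ) ∧
          ∀ i ∈ (univ.erase l).erase j, p i = 1 / (#(univ.erase l) : ℝ)) := by
  have hupd : ∀ i ∈ (univ.erase l).erase j, Function.update p j (p j + p l) i = p i :=
    fun i hi => Function.update_of_ne (ne_of_mem_erase hi) _ _
  have hprod : ∏ i ∈ univ.erase l, Function.update p j (p j + p l) i =
      (p j + p l) * ∏ i ∈ (univ.erase l).erase j, p i := by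
    rw [← mul_prod_erase _ _ hj, Function.update_self, prod_congr rfl hupd]
  have hsum : ∑ i ∈ univ.erase l, Function.update p j (p j + p l) i = 1 := by
    rw [← add_sum_erase _ _ hj, Function.update_self, sum_congr rfl hupd, ← hp1,
      ← add_sum_erase _ p (mem_univ l), ← add_sum_erase _ p hj]
    ring
  have hnonneg : ∀ i ∈ univ.erase l, 0 ≤ Function.update p j (p j + p l) i := by
    intro i _
    by_cases h : i = j
    · subst h
      simpa using add_nonneg (hp0 i) (hp0 l)
    · simpa [h] using hp0 i
  obtain ⟨hle, heq⟩ := prod_le_one_div_card_pow _ ⟨j, hj⟩ _ hnonneg hsum.le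
  rw [hprod] at hle heq
  refine ⟨hle, fun h => ⟨?_, fun i hi => ?_⟩⟩
  · simpa using heq h j hj
  · rw [← hupd i hi, heq h i (mem_of_mem_erase hi)]

lemma sum_mul_prod_erase_le {v p : ι → ℝ} (hv0 : ∀ i, 0 ≤ v i) {l a b : ι}
    (ha : a ≠ l) (hb : b ≠ l) (hab : a ≠ b) (hva : 0 < v a) (hvb : 0 < v b)
    (hsum : ∑ i ∈ univ.erase l, v i ≤ v l) (hp0 : ∀ i, 0 ≤ p i) (hp1 : ∑ i, p i = 1) :
    (∑ j, v j * ∏ i ∈ univ.erase j, p i) ≤ v l / (#(univ.erase l) : ℝ) ^ #(univ.erase l) ∧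
    ((∑ j, v j * ∏ i ∈ univ.erase j, p i) = v l / (#(univ.erase l) : ℝ) ^ #(univ.erase l) ↔
      (∀ i, i ≠ l → p i = 1 / (#(univ.erase l) : ℝ)) ∧ p l = 0) := by
  have hmem : ∀ {i}, i ≠ l → i ∈ univ.erase l := fun h => mem_erase.mpr ⟨h, mem_univ _⟩
  have hsplit := sum_mul_prod_erase_eq v p l
  set c : ℝ := 1 / (#(univ.erase l) : ℝ) ^ #(univ.erase l) with hc
  have hvc : v l / (#(univ.erase l) : ℝ) ^ #(univ.erase l) =
      ∑ j ∈ univ.erase l, v j * c + (v l - ∑ j ∈ univ.erase l, v j) * c := by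
    rw [← sum_mul, hc]
    ring
  have hterm : ∀ j ∈ univ.erase l,
      v j * ((p j + p l) * ∏ i ∈ (univ.erase l).erase j, p i) ≤ v j * c := fun j hj =>
    mul_le_mul_of_nonneg_left (add_mul_prod_erase_le hp0 hp1 hj).1 (hv0 j)
  have hrest : (v l - ∑ j ∈ univ.erase l, v j) * ∏ i ∈ univ.erase l, p i ≤
      (v l - ∑ j ∈ univ.erase l, v j) * c := by
    refine mul_le_mul_of_nonneg_left
      (prod_le_one_div_card_pow _ ⟨a, hmem ha⟩ p (fun i _ => hp0 i) ?_).1 (sub_nonneg.mpr hsum)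
    linarith [add_sum_erase _ p (mem_univ l), hp0 l]
  have hmain := sum_le_sum hterm
  refine ⟨by linarith, fun h => ?_, fun ⟨hp, hl⟩ => ?_⟩
  · have heq := (sum_eq_sum_iff_of_le hterm).mp (by linarith)
    obtain ⟨ha1, ha2⟩ := (add_mul_prod_erase_le hp0 hp1 (hmem ha)).2
      (mul_left_cancel₀ hva.ne' (heq a (hmem ha)))
    obtain ⟨-, hb2⟩ := (add_mul_prod_erase_le hp0 hp1 (hmem hb)).2
      (mul_left_cancel₀ hvb.ne' (heq b (hmem hb)))
    have hpa := hb2 a (mem_erase.mpr ⟨hab, hmem ha⟩)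
    refine ⟨fun i hi => ?_, by linarith⟩
    by_cases hia : i = a
    · rw [hia, hpa]
    · exact ha2 i (mem_erase.mpr ⟨hia, hmem hi⟩)
  · have hzero : ∀ j ∈ univ.erase l, v j * ∏ i ∈ univ.erase j, p i = 0 := fun j hj => by
      rw [prod_eq_zero (mem_erase.mpr ⟨(ne_of_mem_erase hj).symm, mem_univ l⟩) hl, mul_zero]
    rw [← add_sum_erase _ _ (mem_univ l), sum_eq_zero hzero,
      prod_congr rfl fun i hi => hp i (ne_of_mem_erase hi), prod_const, add_zero, one_div_pow,
      mul_one_div]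

end Merge

/-- Lemma 4.1: if `vn ≥ v1 + ⋯ + v_{n-1}`, then `f` attains its maximum
`vn/(n-1)^{n-1}` over the simplex only at
`p1 = ⋯ = p_{n-1} = 1/(n-1)`, `pn = 0`. -/
theorem stmt_10 (n : ℕ) (hn : 3 ≤ n) (v : Fin n → ℝ)
    (hv0 : ∀ i, 0 ≤ v i) (hmono : Monotone v)
    (hvpos : 0 < v ⟨n - 3, by omega⟩)
    (hsum : ∑ i ∈ univ.erase (⟨n - 1, by omega⟩ : Fin n), v i ≤ v ⟨n - 1, by omega⟩)
    (p : Fin n → ℝ) (hp0 : ∀ i, 0 ≤ p i) (hp1 : ∑ i, p i = 1) :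
    (∑ j, v j * ∏ i ∈ univ.erase j, p i) ≤ v ⟨n - 1, by omega⟩ / ((n : ℝ) - 1)^(n - 1) ∧
    ((∑ j, v j * ∏ i ∈ univ.erase j, p i) = v ⟨n - 1, by omega⟩ / ((n : ℝ) - 1)^(n - 1) ↔
      (∀ i : Fin n, i ≠ ⟨n - 1, by omega⟩ → p i = 1 / ((n : ℝ) - 1)) ∧
        p ⟨n - 1, by omega⟩ = 0) := by
  have hcard : #(univ.erase (⟨n - 1, by omega⟩ : Fin n)) = n - 1 := by simp
  have hcast : ((n - 1 : ℕ) : ℝ) = (n : ℝ) - 1 := by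
    push_cast [show 1 ≤ n by omega]
    ring
  have hlt : (⟨n - 3, by omega⟩ : Fin n) < ⟨n - 2, by omega⟩ := by
    simp only [Fin.mk_lt_mk]
    omega
  have h := sum_mul_prod_erase_le hv0 (l := ⟨n - 1, by omega⟩) (a := ⟨n - 3, by omega⟩)
    (b := ⟨n - 2, by omega⟩) (by simp only [ne_eq, Fin.mk.injEq]; omega)
    (by simp only [ne_eq, Fin.mk.injEq]; omega) hlt.ne hvpos
    (hvpos.trans_le (hmono hlt.le)) hsum hp0 hp1
  rwa [hcard, hcast] at h
end

section
/- Let n ≥ 3 and 0 ≤ v1 ≤ v2 ≤ ⋯ ≤ vn with v_{n−2} > 0. If vn < v1 + v2 + ⋯ + v_{n−1}, then any p in the simplex S_n that maximizes f over S_n satisfies p_i > 0 for all i = 1,…,n. -/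
open Finset

theorem prod_le_arith_mean_pow {ι : Type*} (s : Finset ι) (hs : s.Nonempty) (x : ι → ℝ)
    (hx : ∀ i ∈ s, 0 ≤ x i) : ∏ i ∈ s, x i ≤ ((∑ i ∈ s, x i) / #s) ^ #s := by
  have hc : 0 < #s := hs.card_pos
  have h := Real.geom_mean_le_arith_mean s (fun _ => 1) x (fun _ _ => zero_le_one)
    (by simpa using hc) hx
  simp only [Real.rpow_one, sum_const, nsmul_eq_mul, mul_one, one_mul] at h
  have hP : 0 ≤ ∏ i ∈ s, x i := prod_nonneg hx
  calc ∏ i ∈ s, x i = ((∏ i ∈ s, x i) ^ ((#s : ℝ)⁻¹)) ^ #s :=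
        (Real.rpow_inv_natCast_pow hP hc.ne').symm
    _ ≤ _ := by gcongr

theorem sum_mul_prod_erase_of_eq_zero {ι : Type*} [Fintype ι] [DecidableEq ι] (v p : ι → ℝ)
    (k : ι) (hk : p k = 0) :
    ∑ j, v j * ∏ i ∈ univ.erase j, p i = v k * ∏ i ∈ univ.erase k, p i := by
  refine sum_eq_single k (fun j _ hj => ?_) (by simp)
  rw [prod_eq_zero (mem_erase.2 ⟨hj.symm, mem_univ k⟩) hk, mul_zero]

theorem sum_mul_prod_erase_update {ι : Type*} [Fintype ι] [DecidableEq ι] (v : ι → ℝ) (k : ι)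
    (a e : ℝ) {m : ℕ} (hm : Fintype.card ι = m + 2) :
    ∑ j, v j * ∏ i ∈ univ.erase j, Function.update (fun _ => a) k e i =
      v k * a ^ (m + 1) + (∑ j ∈ univ.erase k, v j) * (e * a ^ m) := by
  rw [← add_sum_erase univ _ (mem_univ k), sum_mul]
  congr 1
  · rw [prod_congr rfl fun i hi => Function.update_of_ne (ne_of_mem_erase hi) _ _]
    simp [card_erase_of_mem, hm]
  · refine sum_congr rfl fun j hj => ?_
    have hkj : k ∈ univ.erase j := mem_erase.2 ⟨(ne_of_mem_erase hj).symm, mem_univ k⟩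
    rw [← mul_prod_erase _ _ hkj,
      prod_congr rfl fun i hi => Function.update_of_ne (ne_of_mem_erase hi) _ _]
    simp [card_erase_of_mem, hkj, hm]

/-- If `w < S`, moving a suitable mass `e` from `m + 1` equal coordinates to the vanishing one
increases the objective. -/
theorem exists_lt_mul_pow_add {w S : ℝ} (hw : 0 ≤ w) (hS : w < S) (m : ℕ) :
    ∃ e : ℝ, 0 ≤ e ∧ e ≤ 1 ∧
      w * (1 / (m + 1 : ℝ)) ^ (m + 1) <
        w * ((1 - e) / (m + 1)) ^ (m + 1) + S * (e * ((1 - e) / (m + 1)) ^ m) := by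
  have hS0 : 0 < S := hw.trans_lt hS
  have hm : (0 : ℝ) < m + 1 := by positivity
  have hm0 : (0 : ℝ) ≤ m := by positivity
  obtain ⟨e, he⟩ : ∃ e, e = (S - w) / ((m + 1) * S) := ⟨_, rfl⟩
  have heS : e * ((m + 1) * S) = S - w := by rw [he]; field_simp
  have he0 : 0 < e := by rw [he]; exact div_pos (by linarith) (by positivity)
  have he1 : e ≤ 1 := by
    rw [he, div_le_one (by positivity)]
    nlinarith
  refine ⟨e, he0.le, he1, ?_⟩
  have hB : 1 - m * e ≤ (1 - e) ^ m := by
    have := one_add_mul_le_pow (a := -e) (by linarith) m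
    simpa [sub_eq_add_neg] using this
  have hnn : 0 ≤ w * (1 - e) + (m + 1) * S * e := by
    have : 0 ≤ 1 - e := by linarith
    positivity
  have key : w < (1 - e) ^ m * (w * (1 - e) + (m + 1) * S * e) := by
    refine lt_of_lt_of_le ?_ (mul_le_mul_of_nonneg_right hB hnn)
    have h2 : (1 - m * e) * (w * (1 - e) + (m + 1) * S * e) - w
        = e * ((S - w) + m * e * w) := by
      linear_combination (-m * e) * heS
    have : 0 < e * ((S - w) + m * e * w) :=
      mul_pos he0 (add_pos_of_pos_of_nonneg (by linarith) (by positivity))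
    linarith
  have hrw : w * ((1 - e) / (m + 1)) ^ (m + 1) + S * (e * ((1 - e) / (m + 1)) ^ m)
      = ((1 - e) ^ m * (w * (1 - e) + (m + 1) * S * e)) * (1 / (m + 1 : ℝ)) ^ (m + 1) := by
    simp only [div_pow, pow_succ, one_pow]
    field_simp
  rw [hrw]
  gcongr

/-- Lemma 4.2: if `vn < v1 + ⋯ + v_{n-1}`, then any maximizer of `f` over the
simplex `S_n` has all coordinates strictly positive. -/
theorem stmt_11 (n : ℕ) (hn : 3 ≤ n) (v : Fin n → ℝ)
    (hv0 : ∀ i, 0 ≤ v i) (hmono : Monotone v)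
    (hvpos : 0 < v ⟨n - 3, by omega⟩)
    (hsum : v ⟨n - 1, by omega⟩ < ∑ i ∈ univ.erase (⟨n - 1, by omega⟩ : Fin n), v i)
    (p : Fin n → ℝ) (hp0 : ∀ i, 0 ≤ p i) (hp1 : ∑ i, p i = 1)
    (hmax : ∀ q : Fin n → ℝ, (∀ i, 0 ≤ q i) → ∑ i, q i = 1 →
      (∑ j, v j * ∏ i ∈ univ.erase j, q i) ≤ ∑ j, v j * ∏ i ∈ univ.erase j, p i) :
    ∀ i, 0 < p i := by
  intro k
  by_contra hk
  have hk0 : p k = 0 := le_antisymm (not_lt.1 hk) (hp0 k)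
  obtain ⟨m, rfl⟩ : ∃ m, n = m + 2 := ⟨n - 2, by omega⟩
  have hcard : #(univ.erase k) = m + 1 := by simp [card_erase_of_mem]
  have hS : v k < ∑ j ∈ univ.erase k, v j := by
    have h1 := add_sum_erase univ v (mem_univ k)
    have h2 := add_sum_erase univ v (mem_univ (⟨m + 2 - 1, by omega⟩ : Fin (m + 2)))
    have h3 : v k ≤ v ⟨m + 2 - 1, by omega⟩ := hmono (Fin.le_def.2 (by simp; omega))
    linarith
  obtain ⟨e, he0, he1, hlt⟩ := exists_lt_mul_pow_add (hv0 k) hS m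
  have hq := hmax (Function.update (fun _ => (1 - e) / (m + 1)) k e)
    (fun i => by
      rcases eq_or_ne i k with rfl | hi
      · simpa using he0
      · rw [Function.update_of_ne hi]
        exact div_nonneg (by linarith) (by positivity))
    (by
      rw [← add_sum_erase univ _ (mem_univ k),
        sum_congr rfl fun i hi => Function.update_of_ne (ne_of_mem_erase hi) _ _]
      rw [sum_const, hcard, Function.update_self]
      have : (m + 1 : ℝ) ≠ 0 := by positivity
      simp only [nsmul_eq_mul, Nat.cast_add, Nat.cast_one]
      field_simp
      ring)
  rw [sum_mul_prod_erase_update v k _ e (by simp : Fintype.card (Fin (m + 2)) = m + 2),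
    sum_mul_prod_erase_of_eq_zero v p k hk0] at hq
  have hamgm := prod_le_arith_mean_pow (univ.erase k) (card_pos.1 (by omega)) p
    (fun i _ => hp0 i)
  have hps : ∑ i ∈ univ.erase k, p i = 1 := by
    rw [← hp1, ← add_sum_erase univ p (mem_univ k), hk0, zero_add]
  rw [hps, hcard] at hamgm
  push_cast at hamgm
  linarith [mul_le_mul_of_nonneg_left hamgm (hv0 k)]
end

section
/- Let n ≥ 3 and 0 < v1 ≤ v2 ≤ ⋯ ≤ vn < v1 + ⋯ + v_{n−1}, and suppose p maximizes f over the simplex S_n. Then 0 < p_i < 1/(n−1) for all i, there exists μ > 0 with μ ≤ 1/vn such that p_i (1/(n−1) − p_i)/v_i = μ/(4 (n−1)²) for all i = 1,…,n, and p1 ≥ p2 ≥ ⋯ ≥ p_n > 0; moreover either p_i = (1 + √(1 − μ v_i))/(2(n−1)) for all i = 1,…,n, or p_i = (1 + √(1 − μ v_i))/(2(n−1)) for i = 1,…,n−1 and p_n = (1 − √(1 − μ v_n))/(2(n−1)). -/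
open Finset

/-- A linear term bounded by a quadratic one on `[0, a]` has nonpositive slope. -/
lemma nonpos_of_forall_mul_le_mul_sq {d r a : ℝ} (ha : 0 < a)
    (h : ∀ t, 0 ≤ t → t ≤ a → t * d ≤ r * t ^ 2) : d ≤ 0 := by
  by_contra! hd
  have hr : 0 < |r| + 1 := by positivity
  set t := min a (d / (2 * (|r| + 1)))
  have ht : 0 < t := lt_min ha (by positivity)
  have h1 := h t ht.le (min_le_left _ _)
  have h2 : t * (2 * (|r| + 1)) ≤ d := (le_div_iff₀ (by positivity)).1 (min_le_right _ _)
  have h3 : d ≤ r * t := by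
    refine le_of_mul_le_mul_left (a := t) ?_ ht
    linarith [show t * (r * t) = r * t ^ 2 by ring]
  nlinarith [le_abs_self r]

section WeightedProducts

variable {ι : Type*} [Fintype ι] [DecidableEq ι]

/-- The weighted sum of the products of all but one coordinate. -/
def weightedProd (v p : ι → ℝ) : ℝ := ∑ j, v j * ∏ i ∈ univ.erase j, p i

/-- The dependence of `weightedProd` on two of the coordinates. -/
lemma weightedProd_eq_of_agree {v p q : ι → ℝ} {i k : ι} (hik : i ≠ k)
    (h : ∀ j, j ≠ i → j ≠ k → q j = p j) :
    weightedProd v q =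
      (∑ j ∈ (univ.erase i).erase k, v j * ∏ l ∈ ((univ.erase i).erase k).erase j, p l)
        * (q i * q k)
      + (∏ l ∈ (univ.erase i).erase k, p l) * (v i * q k + v k * q i) := by
  have hki : k ∈ univ.erase i := by simp [hik.symm]
  have hprod : ∏ l ∈ (univ.erase i).erase k, q l = ∏ l ∈ (univ.erase i).erase k, p l :=
    prod_congr rfl fun l hl => h l (by simp at hl; tauto) (by simp at hl; tauto)
  have hi : ∏ l ∈ univ.erase i, q l = q k * ∏ l ∈ (univ.erase i).erase k, p l := by
    rw [← mul_prod_erase _ _ hki, hprod]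
  have hk : ∏ l ∈ univ.erase k, q l = q i * ∏ l ∈ (univ.erase i).erase k, p l := by
    rw [← mul_prod_erase _ _ (show i ∈ univ.erase k by simp [hik]), erase_right_comm, hprod]
  have hj : ∀ j ∈ (univ.erase i).erase k, v j * ∏ l ∈ univ.erase j, q l =
      (v j * ∏ l ∈ ((univ.erase i).erase k).erase j, p l) * (q i * q k) := by
    intro j hj
    simp only [mem_erase, mem_univ, and_true] at hj
    rw [← mul_prod_erase (univ.erase j) q (show i ∈ univ.erase j by simp [hj.2.symm]),
      ← mul_prod_erase ((univ.erase j).erase i) q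
        (show k ∈ (univ.erase j).erase i by simp [hj.1.symm, hik.symm])]
    have hset : ((univ.erase j).erase i).erase k = ((univ.erase i).erase k).erase j := by
      ext l; simp; tauto
    rw [hset, prod_congr rfl fun l hl => h l (by simp at hl; tauto) (by simp at hl; tauto)]
    ring
  rw [weightedProd, ← add_sum_erase _ _ (mem_univ i), ← add_sum_erase _ _ hki,
    sum_congr rfl hj, ← sum_mul, hi, hk]
  ring

/-- First-order condition for moving mass from coordinate `i` to coordinate `k`. -/
lemma pairwise_condition_of_isMax {v p : ι → ℝ} (hp0 : ∀ i, 0 ≤ p i) (hp1 : ∑ i, p i = 1)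
    (hmax : ∀ q : ι → ℝ, (∀ i, 0 ≤ q i) → ∑ i, q i = 1 → weightedProd v q ≤ weightedProd v p)
    {i k : ι} (hik : i ≠ k) (hi : 0 < p i)
    (hpos : ∀ j, j ≠ i → j ≠ k → 0 < p j) :
    (∑ j ∈ (univ.erase i).erase k, v j / p j) * (p i - p k) + (v i - v k) ≤ 0 := by
  set s := (univ.erase i).erase k with hs
  have hsp : ∀ j ∈ s, 0 < p j := fun j hj => hpos j (by simp [hs] at hj; tauto)
    (by simp [hs] at hj; tauto)
  have hQ : 0 < ∏ l ∈ s, p l := prod_pos hsp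
  have hR : (∑ j ∈ s, v j * ∏ l ∈ s.erase j, p l) = (∏ l ∈ s, p l) * ∑ j ∈ s, v j / p j := by
    rw [mul_sum]
    refine sum_congr rfl fun j hj => ?_
    have := (hsp j hj).ne'
    rw [← mul_prod_erase s p hj]
    field_simp
  refine nonpos_of_forall_mul_le_mul_sq (r := ∑ j ∈ s, v j / p j) hi fun t ht0 hta => ?_
  set q : ι → ℝ := Function.update (Function.update p i (p i - t)) k (p k + t) with hq
  have hqi : q i = p i - t := by simp [hq, hik]
  have hqk : q k = p k + t := by simp [hq]
  have hqj : ∀ j, j ≠ i → j ≠ k → q j = p j := fun j h1 h2 => by simp [hq, h1, h2]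
  have hki : k ∈ univ.erase i := by simp [hik.symm]
  have hsum : ∑ j, q j = 1 := by
    rw [← hp1, ← add_sum_erase _ q (mem_univ i), ← add_sum_erase _ q hki,
      ← add_sum_erase _ p (mem_univ i), ← add_sum_erase _ p hki, hqi, hqk,
      sum_congr rfl fun j hj => hqj j (by simp at hj; tauto) (by simp at hj; tauto)]
    ring
  have hq0 : ∀ j, 0 ≤ q j := by
    intro j
    by_cases h1 : j = i
    · rw [h1, hqi]; linarith
    by_cases h2 : j = k
    · rw [h2, hqk]; linarith [hp0 k]
    rw [hqj j h1 h2]; exact hp0 j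
  have key := hmax q hq0 hsum
  rw [weightedProd_eq_of_agree hik hqj, weightedProd_eq_of_agree hik fun _ _ _ => rfl, ← hs,
    hqi, hqk, hR] at key
  refine le_of_mul_le_mul_left ?_ hQ
  linarith

/-- A maximizer has no zero coordinate, provided no weight dominates the sum of the others. -/
lemma pos_of_isMax {v p : ι → ℝ} (hv : ∀ i, 0 < v i) (hp0 : ∀ i, 0 ≤ p i)
    (hp1 : ∑ i, p i = 1)
    (hmax : ∀ q : ι → ℝ, (∀ i, 0 ≤ q i) → ∑ i, q i = 1 → weightedProd v q ≤ weightedProd v p)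
    (hdom : ∀ k, v k < ∑ i ∈ univ.erase k, v i) (k : ι) : 0 < p k := by
  by_contra! hk
  have hk : p k = 0 := le_antisymm hk (hp0 k)
  have hne : Nonempty ι := ⟨k⟩
  have hcard : 0 < (Fintype.card ι : ℝ) := by exact_mod_cast Fintype.card_pos
  have hfpos : 0 < weightedProd v p := by
    refine lt_of_lt_of_le ?_ (hmax (fun _ => 1 / (Fintype.card ι : ℝ)) (fun _ => by positivity)
      (by simp [hcard.ne']))
    exact sum_pos (fun j _ => mul_pos (hv j) (prod_pos fun _ _ => by positivity)) univ_nonempty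
  have hpos : ∀ j, j ≠ k → 0 < p j := by
    intro j hjk
    refine lt_of_le_of_ne (hp0 j) fun hj => hfpos.ne' ?_
    refine sum_eq_zero fun l _ => mul_eq_zero_of_right _ ?_
    by_cases hl : l = k
    · exact prod_eq_zero (i := j) (by simp [hl, hjk]) hj.symm
    · exact prod_eq_zero (i := k) (by simp [Ne.symm hl]) hk
  have hnon : (univ.erase k).Nonempty := by
    by_contra! h
    have := hdom k
    rw [h, sum_empty] at this
    exact absurd this (hv k).not_gt
  obtain ⟨i, hi, himax⟩ := exists_max_image (univ.erase k) p hnon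
  have hik : i ≠ k := by simpa using hi
  have hpi := hpos i hik
  have key := pairwise_condition_of_isMax hp0 hp1 hmax hik hpi fun j _ h => hpos j h
  have hle : ∑ j ∈ (univ.erase i).erase k, v j ≤
      (∑ j ∈ (univ.erase i).erase k, v j / p j) * p i := by
    rw [sum_mul]
    refine sum_le_sum fun j hj => ?_
    have hjk : j ≠ k := by simp at hj; tauto
    have := hpos j hjk
    rw [div_mul_eq_mul_div, le_div_iff₀ this]
    exact mul_le_mul_of_nonneg_left (himax j (by simp [hjk])) (hv j).le
  have hd := hdom k
  rw [← add_sum_erase _ _ hi, erase_right_comm] at hd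
  rw [hk, sub_zero] at key
  linarith

/-- The stationarity equations at a maximizer with positive coordinates. -/
lemma stationarity_of_isMax {v p : ι → ℝ} (hp1 : ∑ i, p i = 1) (hp : ∀ i, 0 < p i)
    (hmax : ∀ q : ι → ℝ, (∀ i, 0 ≤ q i) → ∑ i, q i = 1 → weightedProd v q ≤ weightedProd v p)
    (i : ι) :
    v i = (∑ j, v j / p j) * (p i * (1 - ((Fintype.card ι : ℝ) - 1) * p i)) := by
  set S := ∑ j, v j / p j with hS
  have hpair : ∀ k, p k * (S - v i / p i) = p i * (S - v k / p k) := by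
    intro k
    by_cases hik : i = k
    · rw [hik]
    have h1 := pairwise_condition_of_isMax (fun j => (hp j).le) hp1 hmax hik (hp i)
      fun j _ _ => hp j
    have h2 := pairwise_condition_of_isMax (fun j => (hp j).le) hp1 hmax (Ne.symm hik) (hp k)
      fun j _ _ => hp j
    rw [erase_right_comm] at h2
    have hsplit : S = v i / p i + (v k / p k + ∑ j ∈ (univ.erase i).erase k, v j / p j) := by
      rw [add_sum_erase _ (fun j => v j / p j) (show k ∈ univ.erase i by simp [Ne.symm hik]),
        add_sum_erase _ (fun j => v j / p j) (mem_univ i)]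
    have hi := div_mul_cancel₀ (v i) (hp i).ne'
    have hk := div_mul_cancel₀ (v k) (hp k).ne'
    rw [hsplit]
    nlinarith
  have htot : S - v i / p i = p i * ((Fintype.card ι : ℝ) * S - S) := by
    have := sum_congr rfl fun k (_ : k ∈ univ) => hpair k
    rw [← sum_mul, ← mul_sum, hp1, one_mul, sum_sub_distrib, sum_const, card_univ,
      nsmul_eq_mul] at this
    exact this
  have hi := div_mul_cancel₀ (v i) (hp i).ne'
  linear_combination -hi + (-p i) * htot

end WeightedProducts

/-- Characterization of the maximizer for the saturated design problem:
all coordinates lie in `(0, 1/(n-1))`, there is a common constant `μ ∈ (0, 1/vn]`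
with `pᵢ(1/(n-1) - pᵢ)/vᵢ = μ/(4(n-1)²)` for all `i`, the coordinates are
decreasing, and each `pᵢ` takes one of the two explicit square-root values,
with at most the last one taking the smaller value. -/
theorem stmt_12 (n : ℕ) (hn : 3 ≤ n) (v : Fin n → ℝ)
    (hv0 : 0 < v ⟨0, by omega⟩) (hmono : Monotone v)
    (hsum : v ⟨n - 1, by omega⟩ < ∑ i ∈ univ.erase (⟨n - 1, by omega⟩ : Fin n), v i)
    (p : Fin n → ℝ) (hp0 : ∀ i, 0 ≤ p i) (hp1 : ∑ i, p i = 1)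
    (hmax : ∀ q : Fin n → ℝ, (∀ i, 0 ≤ q i) → ∑ i, q i = 1 →
      (∑ j, v j * ∏ i ∈ univ.erase j, q i) ≤ ∑ j, v j * ∏ i ∈ univ.erase j, p i) :
    (∀ i, 0 < p i ∧ p i < 1 / ((n : ℝ) - 1)) ∧
    (∃ μ : ℝ, 0 < μ ∧ μ ≤ 1 / v ⟨n - 1, by omega⟩ ∧
      (∀ i, p i * (1 / ((n : ℝ) - 1) - p i) / v i = μ / (4 * ((n : ℝ) - 1)^2)) ∧
      ((∀ i, p i = (1 + Real.sqrt (1 - μ * v i)) / (2 * ((n : ℝ) - 1))) ∨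
        ((∀ i : Fin n, i ≠ ⟨n - 1, by omega⟩ →
            p i = (1 + Real.sqrt (1 - μ * v i)) / (2 * ((n : ℝ) - 1))) ∧
          p ⟨n - 1, by omega⟩ =
            (1 - Real.sqrt (1 - μ * v ⟨n - 1, by omega⟩)) / (2 * ((n : ℝ) - 1))))) ∧
    Antitone p := by
  set z : Fin n := ⟨n - 1, by omega⟩ with hz
  have hlast : ∀ i, i ≤ z := fun i => by
    rw [Fin.le_def]; simp only [hz]; omega
  have hv : ∀ i, 0 < v i := fun i => hv0.trans_le (hmono (by simp [Fin.le_def]))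
  have hdom : ∀ k, v k < ∑ i ∈ univ.erase k, v i := by
    intro k
    have h1 := add_sum_erase univ v (mem_univ k)
    have h2 := add_sum_erase univ v (mem_univ z)
    have h3 := hmono (hlast k)
    linarith
  have hp : ∀ i, 0 < p i := pos_of_isMax hv hp0 hp1 hmax hdom
  have hstat := stationarity_of_isMax hp1 hp hmax
  rw [Fintype.card_fin] at hstat
  set S := ∑ j, v j / p j with hS
  have hSpos : 0 < S := sum_pos (fun j _ => div_pos (hv j) (hp j)) ⟨z, mem_univ z⟩
  have hn' : (3 : ℝ) ≤ n := by exact_mod_cast hn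
  set m : ℝ := (n : ℝ) - 1 with hm
  have hmpos : 0 < m := by linarith
  have hlt : ∀ i, 0 < 1 - m * p i := by
    intro i
    have h := hv i
    rw [hstat i] at h
    exact pos_of_mul_pos_right (pos_of_mul_pos_right h hSpos.le) (hp i).le
  have hsum1 : ∑ i, (1 - m * p i) = 1 := by
    rw [sum_sub_distrib, ← mul_sum, hp1]
    simp [hm]
  have htwo : ∀ i j, i ≠ j → 1 < m * p i + m * p j := by
    intro i j hij
    have hj : j ∈ univ.erase i := by simp [hij.symm]
    have hcard : 0 < ((univ.erase i).erase j).card := by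
      rw [card_erase_of_mem hj, card_erase_of_mem (mem_univ i), card_univ, Fintype.card_fin]
      omega
    have hrest := sum_pos (fun l (_ : l ∈ (univ.erase i).erase j) => hlt l) (card_pos.1 hcard)
    rw [← add_sum_erase _ _ (mem_univ i), ← add_sum_erase _ _ hj] at hsum1
    linarith
  have hanti : Antitone p := by
    intro i j hij
    rcases eq_or_ne i j with rfl | hne
    · exact le_rfl
    by_contra! hlt'
    have h1 := hmono hij
    rw [hstat i, hstat j] at h1
    have h2 := le_of_mul_le_mul_left h1 hSpos
    nlinarith [mul_pos (sub_pos.2 hlt') (sub_pos.2 (htwo i j hne))]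
  have hμv : ∀ i, 1 - 4 * m / S * v i = (2 * m * p i - 1) ^ 2 := by
    intro i
    rw [hstat i]
    field_simp
    ring
  have hplus : ∀ i, 1 / 2 ≤ m * p i →
      p i = (1 + Real.sqrt (1 - 4 * m / S * v i)) / (2 * m) := by
    intro i hi
    rw [hμv, Real.sqrt_sq (by linarith)]
    field_simp
    ring
  have hhalf : ∀ i, i ≠ z → 1 / 2 ≤ m * p i := by
    intro i hi
    have h1 := htwo i z hi
    have h2 := mul_le_mul_of_nonneg_left (hanti (hlast i)) hmpos.le
    linarith
  refine ⟨fun i => ⟨hp i, ?_⟩, ⟨4 * m / S, by positivity, ?_, fun i => ?_, ?_⟩, hanti⟩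
  · rw [lt_div_iff₀ hmpos]
    linarith [hlt i]
  · rw [le_div_iff₀ (hv z)]
    nlinarith [hμv z, sq_nonneg (2 * m * p z - 1)]
  · have h := hlt i
    have hpi := hp i
    rw [div_eq_iff (hv i).ne', hstat i]
    field_simp
  · rcases le_total (1 / 2) (m * p z) with h | h
    · left
      intro i
      rcases eq_or_ne i z with rfl | hi
      · exact hplus _ h
      · exact hplus i (hhalf i hi)
    · refine Or.inr ⟨fun i hi => hplus i (hhalf i hi), ?_⟩
      rw [hμv, show (2 * m * p z - 1) ^ 2 = (1 - 2 * m * p z) ^ 2 by ring,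
        Real.sqrt_sq (by linarith)]
      field_simp
      ring
end

section
/- Let n ≥ 3 and 0 < v1 ≤ v2 ≤ ⋯ ≤ vn < v1 + ⋯ + v_{n−1}, and suppose Σ_{j=1}^{n−1} √(1 − v_j/v_n) ≤ n − 2. Then there is a unique μ ∈ (0, 1/vn] such that Σ_{j=1}^n √(1 − μ v_j) = n − 2, and the point p with p_i = (1 + √(1 − μ v_i))/(2(n−1)) for i = 1,…,n lies in the simplex S_n and maximizes f over S_n; the maximum value satisfies f(p) = p1 ⋯ pn [v_i/p_i + 4 (n−1)² p_i/μ] for every i = 1,…,n. -/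
open Finset

/-- AM-GM along the rows of a doubly stochastic matrix with one row `w` and `M` rows
`(1 - w) / M`. -/
theorem prod_le_wsum_mul_pow {ι : Type*} (s : Finset ι) (M : ℕ) (hM : s.card = M + 1)
    (w t : ι → ℝ) (hw : ∀ i ∈ s, 0 ≤ w i) (hw1 : ∑ i ∈ s, w i = 1) (ht : ∀ i ∈ s, 0 ≤ t i) :
    ∏ i ∈ s, t i ≤ (∑ i ∈ s, w i * t i) * ((∑ i ∈ s, (1 - w i) * t i) / M) ^ M := by
  obtain rfl | hM0 := Nat.eq_zero_or_pos M
  · obtain ⟨a, rfl⟩ := Finset.card_eq_one.mp hM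
    simp_all
  have hMr : (0 : ℝ) < M := by exact_mod_cast hM0
  have hle : ∀ i ∈ s, 0 ≤ 1 - w i := fun i hi => by
    have := Finset.single_le_sum hw hi
    linarith
  have h1 := Real.geom_mean_le_arith_mean_weighted s w t hw hw1 ht
  have h2 := Real.geom_mean_le_arith_mean_weighted s (fun i => (1 - w i) / M) t
    (fun i hi => div_nonneg (hle i hi) hMr.le)
    (by
      rw [← Finset.sum_div, Finset.sum_sub_distrib, hw1]
      simp [hM, hMr.ne']) ht
  have h3 : ∑ i ∈ s, (1 - w i) / M * t i = (∑ i ∈ s, (1 - w i) * t i) / M := by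
    rw [Finset.sum_div]
    exact Finset.sum_congr rfl fun i _ => by ring
  rw [h3] at h2
  have hnn2 : 0 ≤ ∏ i ∈ s, t i ^ ((1 - w i) / M) :=
    Finset.prod_nonneg fun i hi => Real.rpow_nonneg (ht i hi) _
  calc ∏ i ∈ s, t i = (∏ i ∈ s, t i ^ w i) * (∏ i ∈ s, t i ^ ((1 - w i) / M)) ^ M := by
        rw [← Finset.prod_pow, ← Finset.prod_mul_distrib]
        refine Finset.prod_congr rfl fun i hi => ?_
        rw [← Real.rpow_mul_natCast (ht i hi), div_mul_cancel₀ _ hMr.ne',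
          ← Real.rpow_add_of_nonneg (ht i hi) (hw i hi) (hle i hi)]
        simp
    _ ≤ _ := mul_le_mul h1 (pow_le_pow_left₀ hnn2 h2 M) (pow_nonneg hnn2 M)
        (Finset.sum_nonneg fun i hi => mul_nonneg (hw i hi) (ht i hi))

/-- The tangent line inequality for `x ^ (M + 1)`. -/
theorem tangent_le_pow (M : ℕ) {x b : ℝ} (hx : 0 ≤ x) (hb : 0 ≤ b) :
    b ^ (M + 1) + (M + 1) * b ^ M * (x - b) ≤ x ^ (M + 1) := by
  induction M with
  | zero => simp
  | succ k ih =>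
    have h1 := mul_le_mul_of_nonneg_left ih hx
    have h2 : 0 ≤ ((k : ℝ) + 1) * b ^ k * (x - b) ^ 2 := by positivity
    push_cast
    calc _ = x * (b ^ (k + 1) + (k + 1) * b ^ k * (x - b)) - (k + 1) * b ^ k * (x - b) ^ 2 := by
          ring
      _ ≤ _ := by
          rw [pow_succ' x (k + 1)]
          linarith

/-- A weighted form of Maclaurin's inequality between `e_M` and `e_1` in `M + 1` variables. -/
theorem wsum_prod_erase_le_pow {ι : Type*} [DecidableEq ι] (t : ι → ℝ) (s : Finset ι) :
    ∀ (M : ℕ) (w : ι → ℝ), s.card = M + 1 → (∀ i ∈ s, 0 ≤ w i) → ∑ i ∈ s, w i = 1 →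
      (∀ i ∈ s, 0 ≤ t i) →
      ∑ j ∈ s, w j * ∏ i ∈ s.erase j, t i ≤ ((∑ i ∈ s, (1 - w i) * t i) / M) ^ M := by
  induction s using Finset.induction_on with
  | empty => intro M w h; simp at h
  | insert a s ha ih =>
    intro N w hN hw hw1 ht
    rw [Finset.card_insert_of_notMem ha, add_left_inj] at hN
    rw [Finset.sum_insert ha] at hw1
    have hws : ∀ i ∈ s, 0 ≤ w i := fun i hi => hw i (Finset.mem_insert_of_mem hi)
    have hts : ∀ i ∈ s, 0 ≤ t i := fun i hi => ht i (Finset.mem_insert_of_mem hi)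
    have hwa := hw a (Finset.mem_insert_self a s)
    have hta := ht a (Finset.mem_insert_self a s)
    have hsplit : ∑ j ∈ insert a s, w j * ∏ i ∈ (insert a s).erase j, t i =
        w a * ∏ i ∈ s, t i + t a * ∑ j ∈ s, w j * ∏ i ∈ s.erase j, t i := by
      rw [Finset.sum_insert ha, Finset.erase_insert ha, Finset.mul_sum]
      congr 1
      refine Finset.sum_congr rfl fun j hj => ?_
      have hja : a ≠ j := fun h => ha (h ▸ hj)
      rw [Finset.erase_insert_of_ne hja,
        Finset.prod_insert fun h => ha (Finset.mem_of_mem_erase h)]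
      ring
    rw [hsplit, Finset.sum_insert ha]
    set W := ∑ i ∈ s, w i with hW
    obtain hW0 | hWpos := (Finset.sum_nonneg hws).eq_or_lt'
    · have hz := (Finset.sum_eq_zero_iff_of_nonneg hws).mp hW0
      have hwa1 : w a = 1 := by linarith
      have e1 : ∑ j ∈ s, w j * ∏ i ∈ s.erase j, t i = 0 :=
        Finset.sum_eq_zero fun j hj => by rw [hz j hj, zero_mul]
      have e2 : ∑ i ∈ s, (1 - w i) * t i = ∑ i ∈ s, t i :=
        Finset.sum_congr rfl fun j hj => by rw [hz j hj, sub_zero, one_mul]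
      rw [e1, e2, hwa1]
      obtain rfl | hN0 := Nat.eq_zero_or_pos N
      · simp [Finset.card_eq_zero.mp hN]
      have hNr : (0 : ℝ) < N := by exact_mod_cast hN0
      have h := Real.geom_mean_le_arith_mean_weighted s (fun _ => 1 / (N : ℝ)) t
        (fun _ _ => by positivity) (by simp [hN, hNr.ne']) hts
      have hnn : 0 ≤ ∏ i ∈ s, t i ^ (1 / (N : ℝ)) :=
        Finset.prod_nonneg fun i hi => Real.rpow_nonneg (hts i hi) _
      have h' := pow_le_pow_left₀ hnn h N
      rw [← Finset.prod_pow, ← Finset.mul_sum, one_div_mul_eq_div,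
        Finset.prod_congr rfl fun i hi => by
          rw [one_div, Real.rpow_inv_natCast_pow (hts i hi) hN0.ne']] at h'
      simpa using h'
    · have hne : W ≠ 0 := hWpos.ne'
      have hsne : s.Nonempty := by
        by_contra h
        rw [Finset.not_nonempty_iff_eq_empty] at h
        simp [h] at hW
        exact hne hW
      obtain ⟨M, rfl⟩ : ∃ M, N = M + 1 :=
        Nat.exists_eq_succ_of_ne_zero (hN ▸ hsne.card_pos.ne')
      set w' : ι → ℝ := fun i => w i / W with hw'
      have hw'0 : ∀ i ∈ s, 0 ≤ w' i := fun i hi => div_nonneg (hws i hi) hWpos.le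
      have hw'1 : ∑ i ∈ s, w' i = 1 := by
        rw [hw', ← Finset.sum_div, ← hW, div_self hne]
      have hle : ∀ i ∈ s, 0 ≤ 1 - w' i := fun i hi => by
        have := Finset.single_le_sum hw'0 hi
        linarith
      set B := (∑ i ∈ s, (1 - w' i) * t i) / M with hB
      have hB0 : 0 ≤ B := div_nonneg
        (Finset.sum_nonneg fun i hi => mul_nonneg (hle i hi) (hts i hi)) (Nat.cast_nonneg M)
      have hMB : (M : ℝ) * B = ∑ i ∈ s, (1 - w' i) * t i := by
        obtain rfl | hM0 := Nat.eq_zero_or_pos M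
        · obtain ⟨b, rfl⟩ := Finset.card_eq_one.mp hN
          rw [Finset.sum_singleton] at hw'1
          simp [hw'1]
        · rw [hB, mul_div_cancel₀]
          exact_mod_cast hM0.ne'
      have hIH := ih M w' hN hw'0 hw'1 hts
      have hAG := prod_le_wsum_mul_pow s M hN w' t hw'0 hw'1 hts
      rw [← hB] at hIH hAG
      have hIH' : ∑ j ∈ s, w j * ∏ i ∈ s.erase j, t i ≤ W * B ^ M := by
        refine le_trans (le_of_eq ?_) (mul_le_mul_of_nonneg_left hIH hWpos.le)
        rw [Finset.mul_sum]
        refine Finset.sum_congr rfl fun j _ => ?_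
        rw [hw', ← mul_assoc, mul_div_cancel₀ _ hne]
      have hR : ∑ i ∈ s, (1 - w i) * t i = w a * (∑ i ∈ s, w' i * t i) + M * B := by
        rw [hMB, Finset.mul_sum, ← Finset.sum_add_distrib]
        refine Finset.sum_congr rfl fun j _ => ?_
        have : w j = w' j * W := (div_mul_cancel₀ _ hne).symm
        rw [this, show w a = 1 - W by linarith]
        ring
      have hS0 : 0 ≤ ∑ i ∈ s, w' i * t i :=
        Finset.sum_nonneg fun i hi => mul_nonneg (hw'0 i hi) (hts i hi)
      have hM1 : (0 : ℝ) < (M : ℝ) + 1 := by positivity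
      rw [hR, show 1 - w a = W by linarith]
      push_cast
      have hx : 0 ≤ (W * t a + (w a * (∑ i ∈ s, w' i * t i) + M * B)) / ((M : ℝ) + 1) := by
        positivity
      refine le_trans ?_ (tangent_le_pow M hx hB0)
      have e : B ^ (M + 1) + ((M : ℝ) + 1) * B ^ M *
          ((W * t a + (w a * (∑ i ∈ s, w' i * t i) + M * B)) / ((M : ℝ) + 1) - B) =
          w a * ((∑ i ∈ s, w' i * t i) * B ^ M) + t a * (W * B ^ M) := by
        field_simp
        ring
      rw [e]
      exact add_le_add (mul_le_mul_of_nonneg_left hAG hwa) (mul_le_mul_of_nonneg_left hIH' hta)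

/-- `f` in the coordinates `q i / p i`, when `v i` is `c * p i * w i`. -/
theorem sum_mul_prod_erase_eq_s13 {ι : Type*} [Fintype ι] [DecidableEq ι] (c : ℝ) (v p w q : ι → ℝ)
    (hp : ∀ i, p i ≠ 0) (hv : ∀ i, v i = c * p i * w i) :
    ∑ j, v j * ∏ i ∈ univ.erase j, q i =
      c * (∏ i, p i) * ∑ j, w j * ∏ i ∈ univ.erase j, q i / p i := by
  rw [Finset.mul_sum]
  refine Finset.sum_congr rfl fun j _ => ?_
  have h : ∏ i ∈ univ.erase j, p i ≠ 0 := Finset.prod_ne_zero_iff.mpr fun i _ => hp i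
  rw [hv j, ← Finset.mul_prod_erase univ p (mem_univ j), Finset.prod_div_distrib]
  field_simp

/-- The sum `∑ √(1 - μ vⱼ)` is strictly decreasing in `μ` as long as all radicands are
nonnegative. -/
theorem sum_sqrt_one_sub_mul_lt {ι : Type*} [Fintype ι] [Nonempty ι] (v : ι → ℝ)
    (hv : ∀ i, 0 < v i) {a b : ℝ} (hab : a < b) (hb : ∀ i, 0 ≤ 1 - b * v i) :
    ∑ j, √(1 - b * v j) < ∑ j, √(1 - a * v j) :=
  Finset.sum_lt_sum_of_nonempty univ_nonempty fun i _ =>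
    Real.sqrt_lt_sqrt (hb i) (by nlinarith [mul_lt_mul_of_pos_right hab (hv i)])

/-- Theorem 4.1, first case: if `∑_{j<n} √(1 - vⱼ/vn) ≤ n - 2`, there is a
unique `μ ∈ (0, 1/vn]` with `∑ⱼ √(1 - μ vⱼ) = n - 2`, and the allocation
`pᵢ = (1 + √(1 - μ vᵢ))/(2(n-1))` lies in the simplex and maximizes `f`, with
`f(p) = p1⋯pn [vᵢ/pᵢ + 4(n-1)² pᵢ/μ]` for every `i`. -/
theorem stmt_13 (n : ℕ) (hn : 3 ≤ n) (v : Fin n → ℝ)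
    (hv0 : 0 < v ⟨0, by omega⟩) (hmono : Monotone v)
    (hsum : v ⟨n - 1, by omega⟩ < ∑ i ∈ univ.erase (⟨n - 1, by omega⟩ : Fin n), v i)
    (hcond : ∑ j ∈ univ.erase (⟨n - 1, by omega⟩ : Fin n),
        Real.sqrt (1 - v j / v ⟨n - 1, by omega⟩) ≤ (n : ℝ) - 2) :
    ∃ μ : ℝ, ∃ p : Fin n → ℝ,
      p = (fun i => (1 + Real.sqrt (1 - μ * v i)) / (2 * ((n : ℝ) - 1))) ∧
      (0 < μ ∧ μ ≤ 1 / v ⟨n - 1, by omega⟩ ∧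
        ∑ j, Real.sqrt (1 - μ * v j) = (n : ℝ) - 2) ∧
      (∀ μ' : ℝ, 0 < μ' → μ' ≤ 1 / v ⟨n - 1, by omega⟩ →
        ∑ j, Real.sqrt (1 - μ' * v j) = (n : ℝ) - 2 → μ' = μ) ∧
      ((∀ i, 0 ≤ p i) ∧ ∑ i, p i = 1) ∧
      (∀ q : Fin n → ℝ, (∀ i, 0 ≤ q i) → ∑ i, q i = 1 →
        (∑ j, v j * ∏ i ∈ univ.erase j, q i) ≤ ∑ j, v j * ∏ i ∈ univ.erase j, p i) ∧
      (∀ i, (∑ j, v j * ∏ k ∈ univ.erase j, p k) =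
        (∏ k, p k) * (v i / p i + 4 * ((n : ℝ) - 1)^2 * p i / μ)) := by
  set l : Fin n := ⟨n - 1, by omega⟩ with hl
  have hvpos : ∀ i, 0 < v i := fun i => hv0.trans_le (hmono (Fin.mk_le_of_le_val (Nat.zero_le _)))
  have hvl : ∀ i, v i ≤ v l := fun i => hmono (Fin.le_def.mpr (by simp only [hl]; omega))
  have : Nonempty (Fin n) := ⟨l⟩
  have hrad : ∀ μ : ℝ, μ ≤ 1 / v l → ∀ i, 0 ≤ 1 - μ * v i := fun μ hμ i => by
    have h1 : μ * v i ≤ 1 / v l * v i := mul_le_mul_of_nonneg_right hμ (hvpos i).le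
    have h2 : 1 / v l * v i ≤ 1 := by
      rw [one_div_mul_eq_div]
      exact (div_le_one (hvpos l)).mpr (hvl i)
    linarith
  obtain ⟨μ, ⟨hμ0, hμ1⟩, hμ⟩ : ∃ μ ∈ Set.Icc 0 (1 / v l),
      ∑ j, √(1 - μ * v j) = (n : ℝ) - 2 := by
    have hcont : ContinuousOn (fun μ : ℝ => ∑ j, √(1 - μ * v j)) (Set.Icc 0 (1 / v l)) := by
      fun_prop
    refine intermediate_value_Icc' (one_div_pos.mpr (hvpos l)).le hcont ⟨?_, ?_⟩
    · rw [← Finset.add_sum_erase univ _ (mem_univ l), one_div_mul_cancel (hvpos l).ne']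
      simpa [div_eq_inv_mul] using hcond
    · simp
  have hμpos : 0 < μ := hμ0.lt_of_ne fun h => by
    simp only [← h, zero_mul, sub_zero, Real.sqrt_one, sum_const, card_univ, Fintype.card_fin,
      nsmul_eq_mul, mul_one] at hμ
    linarith
  have hnr : (3 : ℝ) ≤ n := by exact_mod_cast hn
  set m : ℝ := (n : ℝ) - 1 with hm
  have hm0 : 0 < m := by linarith
  set p : Fin n → ℝ := fun i => (1 + √(1 - μ * v i)) / (2 * m) with hp
  set w : Fin n → ℝ := fun i => (1 - √(1 - μ * v i)) / 2 with hw
  have hppos : ∀ i, 0 < p i := fun i => by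
    simp only [hp]
    positivity
  have hwp : ∀ i, 1 - w i = m * p i := fun i => by
    simp only [hp, hw]
    field_simp
    ring
  have hw0 : ∀ i, 0 ≤ w i := fun i => by
    have : √(1 - μ * v i) ≤ 1 :=
      Real.sqrt_le_one.mpr (by nlinarith [mul_pos hμpos (hvpos i)])
    simp only [hw]
    linarith
  have hw1 : ∑ i, w i = 1 := by
    rw [hw, ← Finset.sum_div, Finset.sum_sub_distrib, hμ]
    simp
  have hp1 : ∑ i, p i = 1 := by
    rw [hp, ← Finset.sum_div, Finset.sum_add_distrib, hμ, div_eq_one_iff_eq (by positivity)]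
    simp [hm]
    ring
  have hv : ∀ i, v i = 4 * m / μ * p i * w i := fun i => by
    have := Real.sq_sqrt (hrad μ hμ1 i)
    simp only [hp, hw]
    generalize √(1 - μ * v i) = r at this
    field_simp
    linarith
  have hf := fun q => sum_mul_prod_erase_eq_s13 (4 * m / μ) v p w q (fun i => (hppos i).ne') hv
  have hP : 0 < 4 * m / μ * ∏ i, p i :=
    mul_pos (by positivity) (Finset.prod_pos fun i _ => hppos i)
  have hfp : ∑ j, v j * ∏ i ∈ univ.erase j, p i = 4 * m / μ * ∏ i, p i := by
    rw [hf p]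
    simp [div_self (hppos _).ne', hw1]
  refine ⟨μ, p, rfl, ⟨hμpos, hμ1, hμ⟩, fun μ' _ hμ'1 hμ' => ?_,
    ⟨fun i => (hppos i).le, hp1⟩, fun q hq0 hq1 => ?_, fun i => ?_⟩
  · rcases lt_trichotomy μ' μ with h | h | h
    · linarith [sum_sqrt_one_sub_mul_lt v hvpos h (hrad μ hμ1)]
    · exact h
    · linarith [sum_sqrt_one_sub_mul_lt v hvpos h (hrad μ' hμ'1)]
  · have key := wsum_prod_erase_le_pow (fun i => q i / p i) univ (n - 1) w
      (by simp; omega) (fun i _ => hw0 i) hw1 (fun i _ => div_nonneg (hq0 i) (hppos i).le)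
    have hcast : ((n - 1 : ℕ) : ℝ) = m := by
      rw [Nat.cast_sub (by omega), Nat.cast_one]
    have hsum1 : ∑ i, (1 - w i) * (q i / p i) = m := by
      refine Eq.trans ?_ (show m * ∑ i, q i = m by rw [hq1, mul_one])
      rw [Finset.mul_sum]
      refine Finset.sum_congr rfl fun i _ => ?_
      rw [hwp i, mul_assoc, mul_div_cancel₀ _ (hppos i).ne']
    rw [hsum1, hcast, div_self hm0.ne', one_pow] at key
    rw [hfp, hf q]
    exact mul_le_of_le_one_right hP.le key
  · have hpi := (hppos i).ne'
    have : v i / p i + 4 * m ^ 2 * p i / μ = 4 * m / μ := by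
      rw [hv i, show w i = 1 - m * p i by linarith [hwp i]]
      field_simp
      ring
    rw [hfp, this, mul_comm]
end

section
/- Let n ≥ 3 and 0 < v1 ≤ v2 ≤ ⋯ ≤ vn < v1 + ⋯ + v_{n−1}, and suppose Σ_{j=1}^{n−1} √(1 − v_j/v_n) > n − 2. Then there is a unique μ ∈ (0, 1/vn) such that Σ_{j=1}^{n−1} √(1 − μ v_j) − √(1 − μ v_n) = n − 2, and the point p with p_i = (1 + √(1 − μ v_i))/(2(n−1)) for i = 1,…,n−1 and p_n = (1 − √(1 − μ v_n))/(2(n−1)) lies in the simplex S_n and maximizes f over S_n; the maximum value satisfies f(p) = p1 ⋯ pn [v_i/p_i + 4 (n−1)² p_i/μ] for every i = 1,…,n. -/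
open Finset

section LeaveOneOut

variable {ι : Type*} [DecidableEq ι]

/-- The weighted sum of the products of all but one of the `q i`, for `i ∈ s`. -/
def leaveOneOutSum (s : Finset ι) (v q : ι → ℝ) : ℝ :=
  ∑ j ∈ s, v j * ∏ i ∈ s.erase j, q i

theorem leaveOneOutSum_insert {s : Finset ι} {i : ι} (hi : i ∉ s) (v q : ι → ℝ) :
    leaveOneOutSum (insert i s) v q = v i * ∏ k ∈ s, q k + q i * leaveOneOutSum s v q := by
  unfold leaveOneOutSum
  rw [sum_insert hi, erase_insert hi, mul_sum]
  congr 1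
  refine sum_congr rfl fun j hj => ?_
  have hne : i ≠ j := by rintro rfl; exact hi hj
  rw [erase_insert_of_ne hne, prod_insert (by simp [hi])]
  ring

theorem leaveOneOutSum_congr {s : Finset ι} {v q q' : ι → ℝ} (h : ∀ i ∈ s, q i = q' i) :
    leaveOneOutSum s v q = leaveOneOutSum s v q' := by
  refine sum_congr rfl fun j _ => ?_
  rw [prod_congr rfl fun i hi => h i (mem_of_mem_erase hi)]

theorem leaveOneOutSum_nonneg {s : Finset ι} {v q : ι → ℝ} (hv : ∀ i, 0 ≤ v i)
    (hq : ∀ i, 0 ≤ q i) : 0 ≤ leaveOneOutSum s v q :=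
  sum_nonneg fun j _ => mul_nonneg (hv j) (prod_nonneg fun i _ => hq i)

theorem leaveOneOutSum_eq_prod_mul {s : Finset ι} (v : ι → ℝ) {q : ι → ℝ}
    (hq : ∀ i ∈ s, q i ≠ 0) :
    leaveOneOutSum s v q = (∏ i ∈ s, q i) * ∑ i ∈ s, v i / q i := by
  unfold leaveOneOutSum
  rw [mul_sum]
  refine sum_congr rfl fun j hj => ?_
  rw [← mul_prod_erase s q hj]
  have := hq j hj
  field_simp

theorem continuous_leaveOneOutSum (s : Finset ι) (v : ι → ℝ) :
    Continuous (leaveOneOutSum s v) := by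
  unfold leaveOneOutSum
  fun_prop

variable [Fintype ι]

theorem leaveOneOutSum_univ {i j : ι} (hij : i ≠ j) (v q : ι → ℝ) :
    leaveOneOutSum univ v q =
      leaveOneOutSum ((univ.erase i).erase j) v q * (q i * q j) +
        (∏ k ∈ (univ.erase i).erase j, q k) * (v i * q j + v j * q i) := by
  have hj : j ∈ univ.erase i := by simp [hij.symm]
  rw [← insert_erase (mem_univ i), leaveOneOutSum_insert (notMem_erase i univ),
    ← insert_erase hj, leaveOneOutSum_insert (notMem_erase j _), prod_insert (notMem_erase j _)]
  simp only [insert_erase hj, insert_erase (mem_univ i)]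
  ring

/-- Effect of moving the mass `t` from coordinate `j` to coordinate `i`. -/
theorem leaveOneOutSum_transfer {i j : ι} (hij : i ≠ j) (v q : ι → ℝ) (t : ℝ) :
    leaveOneOutSum univ v (q + Pi.single i t - Pi.single j t) =
      leaveOneOutSum univ v q +
        t * (leaveOneOutSum ((univ.erase i).erase j) v q * (q j - q i) +
          (∏ k ∈ (univ.erase i).erase j, q k) * (v j - v i)) -
        leaveOneOutSum ((univ.erase i).erase j) v q * t ^ 2 := by
  have h : ∀ k ∈ (univ.erase i).erase j, (q + Pi.single i t - Pi.single j t : ι → ℝ) k = q k := by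
    intro k hk
    simp only [mem_erase, mem_univ, and_true] at hk
    simp [hk.1, hk.2]
  rw [leaveOneOutSum_univ hij, leaveOneOutSum_univ hij v q, leaveOneOutSum_congr h,
    prod_congr rfl h]
  simp [hij, hij.symm]
  ring

theorem transfer_mem_stdSimplex {q : ι → ℝ} (hq : q ∈ stdSimplex ℝ ι) {i j : ι} (hij : i ≠ j)
    {t : ℝ} (ht : -q i ≤ t) (htj : t ≤ q j) :
    q + Pi.single i t - Pi.single j t ∈ stdSimplex ℝ ι := by
  refine ⟨fun k => ?_, ?_⟩
  · rcases eq_or_ne k i with rfl | hki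
    · simp [hij]; linarith
    · rcases eq_or_ne k j with rfl | hkj
      · simp [hij.symm, htj]
      · simpa [hki, hkj] using hq.1 k
  · simp [sum_add_distrib, hq.2]

variable {v q : ι → ℝ}

/-- First-order condition for a maximizer over the simplex. -/
theorem IsMaxOn.transfer_nonpos (hv : ∀ i, 0 < v i) (hq : q ∈ stdSimplex ℝ ι)
    (hmax : IsMaxOn (leaveOneOutSum univ v) (stdSimplex ℝ ι) q) {i j : ι} (hij : i ≠ j)
    (hj : 0 < q j) :
    leaveOneOutSum ((univ.erase i).erase j) v q * (q j - q i) +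
      (∏ k ∈ (univ.erase i).erase j, q k) * (v j - v i) ≤ 0 := by
  set A := leaveOneOutSum ((univ.erase i).erase j) v q with hA
  set D := A * (q j - q i) + (∏ k ∈ (univ.erase i).erase j, q k) * (v j - v i) with hD
  have hA0 : 0 ≤ A := leaveOneOutSum_nonneg (fun i => (hv i).le) hq.1
  by_contra! hpos
  set t := q j ⊓ D / (A + 1) with ht
  have ht0 : 0 < t := lt_min hj (by positivity)
  have h1 : t * (A + 1) ≤ D := by
    rw [← le_div_iff₀ (by positivity)]; exact min_le_right _ _
  have := isMaxOn_iff.1 hmax _ (transfer_mem_stdSimplex hq hij (by linarith [hq.1 i]) (min_le_left (q j) _))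
  rw [leaveOneOutSum_transfer hij, ← ht, ← hA, ← hD] at this
  nlinarith

theorem exists_pos_leaveOneOutSum [Nonempty ι] (hv : ∀ i, 0 < v i) :
    ∃ q ∈ stdSimplex ℝ ι, 0 < leaveOneOutSum univ v q := by
  have hc : (0 : ℝ) < Fintype.card ι := by exact_mod_cast Fintype.card_pos
  refine ⟨fun _ => 1 / Fintype.card ι, ⟨fun _ => by positivity, by simp [hc.ne']⟩, ?_⟩
  exact sum_pos (fun j _ => mul_pos (hv j) (prod_pos fun _ _ => by positivity)) univ_nonempty

theorem IsMaxOn.pos_of_lt_sum_erase [Nontrivial ι] (hv : ∀ i, 0 < v i)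
    (hsum : ∀ i, v i < ∑ j ∈ univ.erase i, v j) (hq : q ∈ stdSimplex ℝ ι)
    (hmax : IsMaxOn (leaveOneOutSum univ v) (stdSimplex ℝ ι) q) (i : ι) : 0 < q i := by
  by_contra! hi
  have hi0 : q i = 0 := le_antisymm hi (hq.1 i)
  have hf : 0 < leaveOneOutSum univ v q := by
    obtain ⟨q', hq', h⟩ := exists_pos_leaveOneOutSum hv
    exact h.trans_le (hmax hq')
  have hpos : ∀ j, j ≠ i → 0 < q j := by
    intro j hj
    refine (hq.1 j).lt_of_ne fun h0 => hf.ne' ?_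
    rw [leaveOneOutSum_univ hj, hi0, ← h0]
    ring
  have hle : ∀ j k, j ≠ i → k ≠ i → q k ≤ q j := by
    intro j k hj hk
    rcases eq_or_ne j k with rfl | hjk
    · rfl
    have hmem : i ∈ (univ.erase j).erase k := by simp [hj.symm, hk.symm]
    have h := hmax.transfer_nonpos hv hq hjk (hpos k hk)
    rw [prod_eq_zero hmem hi0, zero_mul, add_zero] at h
    have hA : 0 < leaveOneOutSum ((univ.erase j).erase k) v q := by
      refine sum_pos' (fun l _ => mul_nonneg (hv l).le (prod_nonneg fun m _ => hq.1 m))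
        ⟨i, hmem, mul_pos (hv i) (prod_pos fun l hl => hpos l (ne_of_mem_erase hl))⟩
    nlinarith
  obtain ⟨j, hj⟩ := exists_ne i
  have h := hmax.transfer_nonpos hv hq hj.symm (hpos j hj)
  set B := ∏ k ∈ (univ.erase i).erase j, q k with hB
  have hB0 : 0 < B := prod_pos fun k hk => hpos k (ne_of_mem_erase (mem_of_mem_erase hk))
  have hA : leaveOneOutSum ((univ.erase i).erase j) v q * q j =
      (∑ k ∈ (univ.erase i).erase j, v k) * B := by
    rw [leaveOneOutSum, sum_mul, sum_mul]
    refine sum_congr rfl fun k hk => ?_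
    have hki : k ≠ i := ne_of_mem_erase (mem_of_mem_erase hk)
    rw [hB, ← mul_prod_erase _ q hk, le_antisymm (hle k j hki hj) (hle j k hj hki)]
    ring
  have hs := add_sum_erase (univ.erase i) v (a := j) (by simp [hj])
  have hsi := hsum i
  rw [← hs] at hsi
  rw [hi0, sub_zero, hA] at h
  nlinarith

/-- The stationarity equation at an interior maximizer. -/
theorem IsMaxOn.quadratic_eq (hv : ∀ i, 0 < v i) (hq : q ∈ stdSimplex ℝ ι)
    (hmax : IsMaxOn (leaveOneOutSum univ v) (stdSimplex ℝ ι) q) (hpos : ∀ i, 0 < q i) (i : ι) :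
    ((Fintype.card ι : ℝ) - 1) * (∑ k, v k / q k) * q i ^ 2 - (∑ k, v k / q k) * q i + v i = 0 := by
  set S := ∑ k, v k / q k with hS
  have hD : ∀ i j, (S - v i / q i) / q i = (S - v j / q j) / q j := by
    intro i j
    rcases eq_or_ne i j with rfl | hij
    · rfl
    have h1 := hmax.transfer_nonpos hv hq hij (hpos j)
    have h2 := hmax.transfer_nonpos hv hq hij.symm (hpos i)
    rw [erase_right_comm] at h2
    have hF := leaveOneOutSum_univ hij v q
    rw [leaveOneOutSum_eq_prod_mul v fun k _ => (hpos k).ne', ← hS,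
      ← mul_prod_erase univ q (mem_univ i),
      ← mul_prod_erase (univ.erase i) q (a := j) (by simp [hij.symm])] at hF
    set B := ∏ k ∈ (univ.erase i).erase j, q k
    set A := leaveOneOutSum ((univ.erase i).erase j) v q
    have hB : 0 < B := prod_pos fun k _ => hpos k
    have hi := hpos i
    have hj := hpos j
    have h3 : A * (q j - q i) + B * (v j - v i) = 0 := by linarith
    field_simp
    have : B * ((S * q i - v i) * q j ^ 2) = B * (q i ^ 2 * (S * q j - v j)) := by
      linear_combination (q j - q i) * hF + (q i * q j) * h3
    have := mul_left_cancel₀ hB.ne' this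
    linarith
  have hk : ∀ k, S - v k / q k = (S - v i / q i) / q i * q k := by
    intro k
    rw [hD i k, div_mul_cancel₀ _ (hpos k).ne']
  have h := sum_congr rfl fun k (_ : k ∈ univ) => hk k
  rw [← mul_sum, hq.2, sum_sub_distrib, ← hS, mul_one] at h
  simp only [sum_const, card_univ, nsmul_eq_mul] at h
  have hi := hpos i
  field_simp at h
  linarith

/-- There is a maximizer whose smallest coordinate is the one of largest weight. -/
theorem exists_isMaxOn_min_coord {N : ι} (hN : ∀ i, v i ≤ v N) :
    ∃ q ∈ stdSimplex ℝ ι, IsMaxOn (leaveOneOutSum univ v) (stdSimplex ℝ ι) q ∧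
      ∀ i, q N ≤ q i := by
  obtain ⟨q, hq, hmax⟩ := (isCompact_stdSimplex ℝ ι).exists_isMaxOn
    ⟨_, single_mem_stdSimplex ℝ N⟩ (continuous_leaveOneOutSum univ v).continuousOn
  obtain ⟨k, -, hk⟩ := exists_min_image univ q ⟨N, mem_univ N⟩
  rcases eq_or_ne k N with rfl | hkN
  · exact ⟨q, hq, hmax, fun i => hk i (mem_univ i)⟩
  have ht : 0 ≤ q N - q k := sub_nonneg.2 (hk N (mem_univ N))
  refine ⟨_, transfer_mem_stdSimplex hq hkN (t := q N - q k) (by linarith [hq.1 N])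
    (by linarith [hq.1 k]), isMaxOn_iff.2 fun q' hq' => (isMaxOn_iff.1 hmax q' hq').trans ?_, fun i => ?_⟩
  · rw [leaveOneOutSum_transfer hkN]
    have hB : 0 ≤ ∏ l ∈ (univ.erase k).erase N, q l := prod_nonneg fun l _ => hq.1 l
    nlinarith [mul_nonneg (mul_nonneg ht hB) (sub_nonneg.2 (hN k))]
  · have hi := hk i (mem_univ i)
    rcases eq_or_ne i k with rfl | hik
    · simp [hkN, hkN.symm]; linarith
    · rcases eq_or_ne i N with rfl | hiN
      · rfl
      · simpa [hkN.symm, hik, hiN] using hi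

end LeaveOneOut

/-- Along `t ↦ 1 - (1 - t ^ 2) * r`, the square root lies below its chord ending at `t = 1`. -/
theorem sqrt_le_chord {r s α β : ℝ} (hr0 : 0 ≤ r) (hr1 : r ≤ 1)
    (hα : 0 ≤ α) (hβ : 0 ≤ β) (hαβ : α + β = 1) :
    √(1 - (1 - (α * s + β) ^ 2) * r) ≤ α * √(1 - (1 - s ^ 2) * r) + β := by
  have h1 : 0 ≤ 1 - (1 - s ^ 2) * r := by nlinarith [mul_nonneg hr0 (sq_nonneg s)]
  have hφ : r * s + 1 - r ≤ √(1 - (1 - s ^ 2) * r) := by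
    apply Real.le_sqrt_of_sq_le
    nlinarith [mul_nonneg (mul_nonneg (sub_nonneg.2 hr1) hr0) (sq_nonneg (1 - s))]
  have hsq := Real.sq_sqrt h1
  set φ := √(1 - (1 - s ^ 2) * r)
  apply Real.sqrt_le_iff.2 ⟨by positivity, ?_⟩
  obtain rfl : β = 1 - α := by linarith
  have hdiff : (α * φ + (1 - α)) ^ 2 - (1 - (1 - (α * s + (1 - α)) ^ 2) * r) =
      2 * (α * (1 - α) * (φ - (r * s + 1 - r))) := by
    linear_combination α ^ 2 * hsq
  linarith [mul_nonneg (mul_nonneg hα hβ) (sub_nonneg.2 hφ)]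

theorem sqrt_lt_chord {r s α β : ℝ} (hr0 : 0 < r) (hr1 : r < 1) (hs1 : s < 1)
    (hα : 0 < α) (hβ : 0 < β) (hαβ : α + β = 1) :
    √(1 - (1 - (α * s + β) ^ 2) * r) < α * √(1 - (1 - s ^ 2) * r) + β := by
  have h1 : 0 ≤ 1 - (1 - s ^ 2) * r := by nlinarith [mul_nonneg hr0.le (sq_nonneg s)]
  have hφ : r * s + 1 - r < √(1 - (1 - s ^ 2) * r) := by
    apply Real.lt_sqrt_of_sq_lt
    nlinarith [mul_pos (mul_pos (sub_pos.2 hr1) hr0) (pow_pos (sub_pos.2 hs1) 2)]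
  have hsq := Real.sq_sqrt h1
  set φ := √(1 - (1 - s ^ 2) * r)
  rw [Real.sqrt_lt' (by positivity)]
  obtain rfl : β = 1 - α := by linarith
  have hdiff : (α * φ + (1 - α)) ^ 2 - (1 - (1 - (α * s + (1 - α)) ^ 2) * r) =
      2 * (α * (1 - α) * (φ - (r * s + 1 - r))) := by
    linear_combination α ^ 2 * hsq
  linarith [mul_pos (mul_pos hα hβ) (sub_pos.2 hφ)]

section Multiplier

variable {ι : Type*} [DecidableEq ι] [Fintype ι] {v : ι → ℝ} {N : ι}

theorem multiplier_not_lt (hv : ∀ i, 0 < v i) (hN : ∀ i, v i ≤ v N) (hlt : ∃ i, v i < v N)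
    {μ ν : ℝ} (hν : 0 < ν) (hμ : μ < 1 / v N)
    (hμeq : ∑ j ∈ univ.erase N, √(1 - μ * v j) - √(1 - μ * v N) = (Fintype.card ι : ℝ) - 2)
    (hνeq : ∑ j ∈ univ.erase N, √(1 - ν * v j) - √(1 - ν * v N) = (Fintype.card ι : ℝ) - 2) :
    ¬ ν < μ := by
  intro hνμ
  have hvN := hv N
  have hμ' : μ * v N < 1 := by rwa [lt_div_iff₀ hvN] at hμ
  have hνN : ν * v N < μ * v N := mul_lt_mul_of_pos_right hνμ hvN
  have hνN0 : 0 < ν * v N := mul_pos hν hvN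
  set s := √(1 - μ * v N) with hs
  set t := √(1 - ν * v N) with ht
  have hst : s < t := Real.sqrt_lt_sqrt (by linarith) (by linarith)
  have hs0 : 0 ≤ s := Real.sqrt_nonneg _
  have ht1 : t < 1 := by rw [ht, Real.sqrt_lt' one_pos]; linarith
  have hs2 : s ^ 2 = 1 - μ * v N := Real.sq_sqrt (by linarith)
  have ht2 : t ^ 2 = 1 - ν * v N := Real.sq_sqrt (by linarith)
  have hs1 : 0 < 1 - s := by linarith
  obtain ⟨α, β, hα, hβ, hαβ, htαβ⟩ : ∃ α β : ℝ, 0 < α ∧ 0 < β ∧ α + β = 1 ∧ α * s + β = t :=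
    ⟨(1 - t) / (1 - s), (t - s) / (1 - s), div_pos (by linarith) hs1,
      div_pos (by linarith) hs1, by field_simp; ring, by field_simp; ring⟩
  have hμj : ∀ j, μ * v j = (1 - s ^ 2) * (v j / v N) := by
    intro j; rw [hs2]; field_simp; ring
  have hνj : ∀ j, ν * v j = (1 - (α * s + β) ^ 2) * (v j / v N) := by
    intro j; rw [htαβ, ht2]; field_simp; ring
  obtain ⟨i, hi⟩ := hlt
  have hiN : i ∈ univ.erase N := by
    rw [mem_erase]; exact ⟨by rintro rfl; exact lt_irrefl _ hi, mem_univ _⟩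
  have hsum : ∑ j ∈ univ.erase N, √(1 - ν * v j) <
      ∑ j ∈ univ.erase N, (α * √(1 - μ * v j) + β) := by
    refine sum_lt_sum (fun j _ => ?_) ⟨i, hiN, ?_⟩
    · rw [hνj, hμj]
      exact sqrt_le_chord (div_pos (hv j) hvN).le ((div_le_one hvN).2 (hN j)) hα.le hβ.le hαβ
    · rw [hνj, hμj]
      exact sqrt_lt_chord (div_pos (hv i) hvN) ((div_lt_one hvN).2 hi) (by linarith)
        hα hβ hαβ
  rw [sum_add_distrib, ← mul_sum, sum_const, card_erase_of_mem (mem_univ N), card_univ,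
    nsmul_eq_mul, Nat.cast_pred (Fintype.card_pos_iff.2 ⟨N⟩)] at hsum
  obtain rfl : β = 1 - α := by linarith
  rw [eq_add_of_sub_eq hμeq, eq_add_of_sub_eq hνeq] at hsum
  nlinarith

theorem multiplier_unique (hv : ∀ i, 0 < v i) (hN : ∀ i, v i ≤ v N) (hlt : ∃ i, v i < v N)
    {μ ν : ℝ} (hμ0 : 0 < μ) (hμ : μ < 1 / v N) (hν0 : 0 < ν) (hν : ν < 1 / v N)
    (hμeq : ∑ j ∈ univ.erase N, √(1 - μ * v j) - √(1 - μ * v N) = (Fintype.card ι : ℝ) - 2)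
    (hνeq : ∑ j ∈ univ.erase N, √(1 - ν * v j) - √(1 - ν * v N) = (Fintype.card ι : ℝ) - 2) :
    ν = μ :=
  le_antisymm (not_lt.1 (multiplier_not_lt hv hN hlt hμ0 hν hνeq hμeq))
    (not_lt.1 (multiplier_not_lt hv hN hlt hν0 hμ hμeq hνeq))

theorem exists_isMaxOn_multiplier (hcard : 3 ≤ Fintype.card ι) (hv : ∀ i, 0 < v i)
    (hN : ∀ i, v i ≤ v N) (hsum : v N < ∑ j ∈ univ.erase N, v j)
    (hcond : (Fintype.card ι : ℝ) - 2 < ∑ j ∈ univ.erase N, √(1 - v j / v N)) :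
    ∃ μ, ∃ q ∈ stdSimplex ℝ ι, IsMaxOn (leaveOneOutSum univ v) (stdSimplex ℝ ι) q ∧
      0 < μ ∧ μ < 1 / v N ∧
      ∑ j ∈ univ.erase N, √(1 - μ * v j) - √(1 - μ * v N) = (Fintype.card ι : ℝ) - 2 ∧
      (∀ i, q i = if i = N then (1 - √(1 - μ * v i)) / (2 * ((Fintype.card ι : ℝ) - 1))
        else (1 + √(1 - μ * v i)) / (2 * ((Fintype.card ι : ℝ) - 1))) ∧
      ∀ i, leaveOneOutSum univ v q =
        (∏ k, q k) * (v i / q i + 4 * ((Fintype.card ι : ℝ) - 1) ^ 2 * q i / μ) := by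
  obtain ⟨q, hq, hmax, hmin⟩ := exists_isMaxOn_min_coord hN
  have : Nontrivial ι := Fintype.one_lt_card_iff_nontrivial.1 (by omega)
  have hsum' : ∀ i, v i < ∑ j ∈ univ.erase i, v j := by
    intro i
    have h1 := add_sum_erase univ v (mem_univ i)
    have h2 := add_sum_erase univ v (mem_univ N)
    linarith [hN i]
  have hpos := hmax.pos_of_lt_sum_erase hv hsum' hq
  have hquad := hmax.quadratic_eq hv hq hpos
  have hprod := leaveOneOutSum_eq_prod_mul (s := univ) v fun k _ => (hpos k).ne'
  set S := ∑ k, v k / q k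
  have hS : 0 < S := sum_pos (fun k _ => div_pos (hv k) (hpos k)) univ_nonempty
  have hc : (3 : ℝ) ≤ Fintype.card ι := by exact_mod_cast hcard
  set c : ℝ := (Fintype.card ι : ℝ) with hcdef
  have hc1 : 0 < c - 1 := by linarith
  set μ := 4 * (c - 1) / S with hμ
  have hμ0 : 0 < μ := by positivity
  have hvN := hv N
  set x : ι → ℝ := fun i => 2 * (c - 1) * q i - 1 with hx
  have hx2 : ∀ i, 1 - μ * v i = x i ^ 2 := by
    intro i
    have h := hquad i
    simp only [hμ, hx]
    field_simp
    linear_combination (-4 * (c - 1)) * h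
  have hqx : ∀ i, q i = (1 + x i) / (2 * (c - 1)) := by
    intro i
    simp only [hx]
    field_simp
    ring
  have hx1 : ∀ i, x i < 1 := by
    intro i
    nlinarith [hx2 i, mul_pos hμ0 (hv i)]
  have hxsum : ∑ i, x i = c - 2 := by
    simp only [hx, sum_sub_distrib, ← mul_sum, hq.2, sum_const, card_univ, nsmul_eq_mul]
    ring
  have hxsum' := add_sum_erase univ x (mem_univ N)
  have hμle : μ ≤ 1 / v N := by
    rw [le_div_iff₀ hvN]
    nlinarith [hx2 N, sq_nonneg (x N)]
  have hsqrt : c - 2 < ∑ j ∈ univ.erase N, √(1 - μ * v j) := by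
    refine hcond.trans_le (sum_le_sum fun j _ => Real.sqrt_le_sqrt ?_)
    have := mul_le_mul_of_nonneg_right hμle (hv j).le
    rw [one_div_mul_eq_div] at this
    linarith
  have hxpos : ∀ i, i ≠ N → 0 < x i := by
    intro i hi
    by_contra! hxi
    have hxN : x N ≤ 0 := by
      refine le_trans ?_ hxi
      simp only [hx]
      nlinarith [hmin i]
    have hi' : i ∈ univ.erase N := by simp [hi]
    have h1 := add_sum_erase (univ.erase N) x hi'
    have hcardE : ((((univ.erase N).erase i).card : ℕ) : ℝ) = c - 2 := by
      rw [card_erase_of_mem hi', card_erase_of_mem (mem_univ N), card_univ]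
      rw [show Fintype.card ι - 1 - 1 = Fintype.card ι - 2 by omega,
        Nat.cast_sub (by omega)]
      norm_num [hcdef]
    have hne : ((univ.erase N).erase i).Nonempty := by
      rw [← card_pos, ← Nat.cast_pos (α := ℝ), hcardE]
      linarith
    have h2 := sum_lt_sum_of_nonempty hne fun k _ => hx1 k
    rw [sum_const, nsmul_eq_mul, hcardE] at h2
    linarith
  have hxs : ∀ i, i ≠ N → √(1 - μ * v i) = x i := fun i hi => by
    rw [hx2, Real.sqrt_sq (hxpos i hi).le]
  have hsx : ∑ j ∈ univ.erase N, √(1 - μ * v j) = ∑ j ∈ univ.erase N, x j :=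
    sum_congr rfl fun j hj => hxs j (ne_of_mem_erase hj)
  have hxN : x N < 0 := by linarith
  have hxNs : √(1 - μ * v N) = -x N := by
    rw [hx2, ← neg_sq, Real.sqrt_sq (by linarith)]
  refine ⟨μ, q, hq, hmax, hμ0, ?_, ?_, fun i => ?_, fun i => ?_⟩
  · rw [lt_div_iff₀ hvN]
    nlinarith [hx2 N, pow_pos (neg_pos.2 hxN) 2]
  · rw [hsx, hxNs]
    linarith
  · split_ifs with hi
    · rw [hi, hxNs, hqx N, sub_neg_eq_add]
    · rw [hxs i hi, hqx i]
  · rw [hprod]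
    congr 1
    have h := hquad i
    have hi := hpos i
    simp only [hμ]
    field_simp
    linarith

end Multiplier

/-- Theorem 4.1, second case: if `∑_{j<n} √(1 - vⱼ/vn) > n - 2`, there is a
unique `μ ∈ (0, 1/vn)` with `∑_{j<n} √(1 - μ vⱼ) - √(1 - μ vn) = n - 2`, and
the allocation with `pᵢ = (1 + √(1 - μ vᵢ))/(2(n-1))` for `i < n` and
`pn = (1 - √(1 - μ vn))/(2(n-1))` lies in the simplex and maximizes `f`, with
`f(p) = p1⋯pn [vᵢ/pᵢ + 4(n-1)² pᵢ/μ]` for every `i`. -/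
theorem stmt_14 (n : ℕ) (hn : 3 ≤ n) (v : Fin n → ℝ)
    (hv0 : 0 < v ⟨0, by omega⟩) (hmono : Monotone v)
    (hsum : v ⟨n - 1, by omega⟩ < ∑ i ∈ univ.erase (⟨n - 1, by omega⟩ : Fin n), v i)
    (hcond : (n : ℝ) - 2 < ∑ j ∈ univ.erase (⟨n - 1, by omega⟩ : Fin n),
        Real.sqrt (1 - v j / v ⟨n - 1, by omega⟩)) :
    ∃ μ : ℝ, ∃ p : Fin n → ℝ,
      p = (fun i => if i = (⟨n - 1, by omega⟩ : Fin n) then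
          (1 - Real.sqrt (1 - μ * v i)) / (2 * ((n : ℝ) - 1))
        else (1 + Real.sqrt (1 - μ * v i)) / (2 * ((n : ℝ) - 1))) ∧
      (0 < μ ∧ μ < 1 / v ⟨n - 1, by omega⟩ ∧
        (∑ j ∈ univ.erase (⟨n - 1, by omega⟩ : Fin n), Real.sqrt (1 - μ * v j))
          - Real.sqrt (1 - μ * v ⟨n - 1, by omega⟩) = (n : ℝ) - 2) ∧
      (∀ μ' : ℝ, 0 < μ' → μ' < 1 / v ⟨n - 1, by omega⟩ →
        (∑ j ∈ univ.erase (⟨n - 1, by omega⟩ : Fin n), Real.sqrt (1 - μ' * v j))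
          - Real.sqrt (1 - μ' * v ⟨n - 1, by omega⟩) = (n : ℝ) - 2 → μ' = μ) ∧
      ((∀ i, 0 ≤ p i) ∧ ∑ i, p i = 1) ∧
      (∀ q : Fin n → ℝ, (∀ i, 0 ≤ q i) → ∑ i, q i = 1 →
        (∑ j, v j * ∏ i ∈ univ.erase j, q i) ≤ ∑ j, v j * ∏ i ∈ univ.erase j, p i) ∧
      (∀ i, (∑ j, v j * ∏ k ∈ univ.erase j, p k) =
        (∏ k, p k) * (v i / p i + 4 * ((n : ℝ) - 1)^2 * p i / μ)) := by
  set N : Fin n := ⟨n - 1, by omega⟩ with hNdef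
  have hv : ∀ i, 0 < v i := fun i => hv0.trans_le (hmono (Nat.zero_le i.1))
  have hN : ∀ i, v i ≤ v N := fun i => hmono (Nat.le_sub_one_of_lt i.2)
  have hn3 : (3 : ℝ) ≤ n := by exact_mod_cast hn
  have hlt : ∃ i, v i < v N := by
    by_contra! h
    have h0 : ∑ j ∈ univ.erase N, √(1 - v j / v N) = 0 :=
      sum_eq_zero fun j _ => by rw [le_antisymm (hN j) (h j), div_self (hv N).ne']; simp
    linarith
  obtain ⟨μ, q, hq, hmax, hμ0, hμ1, hμeq, hqp, hval⟩ :=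
    exists_isMaxOn_multiplier (by simpa using hn) hv hN hsum (by simpa using hcond)
  have huniq := fun ν => multiplier_unique (ν := ν) hv hN hlt hμ0 hμ1
  simp only [Fintype.card_fin] at hμeq hqp hval huniq
  exact ⟨μ, q, funext hqp, ⟨hμ0, hμ1, hμeq⟩, fun ν h0 h1 h => huniq ν h0 h1 hμeq h, hq,
    fun q' h0 h1 => hmax ⟨h0, h1⟩, hval⟩
end

section
/- Let X be a real n × (n−1) matrix with rows x_1,…,x_n that are pairwise distinct, with rank(X) = n − 1. Suppose there exists l with 1 ≤ l ≤ n − 3 and nonzero reals c_{l+2},…,c_n such that x_{l+1} = c_{l+2} x_{l+2} + ⋯ + c_n x_n. For each i, let d_i denote the determinant of the (n−1) × (n−1) submatrix of X obtained by deleting the i-th row. Then d_i = 0 for i = 1,…,l, and d_i ≠ 0 for i = l+1,…,n. -/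
open Finset

open scoped Matrix

theorem Matrix.mulVec_injective_of_rank_eq_card {p q K : Type*} [Fintype q] [Field K]
    (X : Matrix p q K) (h : X.rank = Fintype.card q) :
    Function.Injective X.mulVec := by
  rw [Matrix.mulVec_injective_iff, linearIndependent_iff_card_eq_finrank_span, ← h]
  exact X.rank_eq_finrank_span_cols

/-- A maximal minor of a full-rank `(m + 1) × m` matrix vanishes exactly when the coefficient of
the deleted row in a nontrivial linear relation between the rows vanishes. -/
theorem Matrix.det_submatrix_succAbove_eq_zero_iff {K : Type*} [Field K] {m : ℕ}
    (X : Matrix (Fin (m + 1)) (Fin m) K) (hrank : X.rank = m) {a : Fin (m + 1) → K}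
    (ha : a ≠ 0) (haX : a ᵥ* X = 0) (i : Fin (m + 1)) :
    (X.submatrix i.succAbove id).det = 0 ↔ a i = 0 := by
  constructor
  · intro hdet
    by_contra hai
    obtain ⟨u, hu, hXu⟩ := Matrix.exists_mulVec_eq_zero_iff.mpr hdet
    have hrow : ∀ j, (X *ᵥ u) (i.succAbove j) = 0 := fun j => congrFun hXu j
    have hdot : a ⬝ᵥ X *ᵥ u = 0 := by rw [Matrix.dotProduct_mulVec, haX, zero_dotProduct]
    rw [dotProduct, Fin.sum_univ_succAbove _ i] at hdot
    simp only [hrow, mul_zero, Finset.sum_const_zero, add_zero, mul_eq_zero, hai,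
      false_or] at hdot
    refine hu (X.mulVec_injective_of_rank_eq_card (by simpa using hrank) ?_)
    rw [Matrix.mulVec_zero]
    exact funext ((Fin.forall_iff_succAbove i).mpr ⟨hdot, hrow⟩)
  · intro hai
    refine Matrix.exists_vecMul_eq_zero_iff.mp ⟨a ∘ i.succAbove, fun h => ha ?_, ?_⟩
    · exact funext ((Fin.forall_iff_succAbove i).mpr ⟨hai, congrFun h⟩)
    · ext k
      have hk := congrFun haX k
      rw [Matrix.vecMul, dotProduct, Fin.sum_univ_succAbove _ i, hai, zero_mul, zero_add] at hk
      exact hk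

/-- Lemma 4.3: let `X` be an `n × (n-1)` real matrix (here `n = m + 1`) with
pairwise distinct rows and rank `n - 1`, whose `(l+1)`-st row (1-based) is a
linear combination with nonzero coefficients of the rows below it. Then the
minors obtained by deleting one of the first `l` rows vanish, while the minors
obtained by deleting any later row are nonzero. -/
theorem stmt_15 (m : ℕ) (hm : 3 ≤ m) (X : Matrix (Fin (m + 1)) (Fin m) ℝ)
    (hrows : ∀ i j : Fin (m + 1), X i = X j → i = j)
    (hrank : X.rank = m)
    (l : ℕ) (hl1 : 1 ≤ l) (hl2 : l ≤ m - 2)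
    (c : Fin (m + 1) → ℝ)
    (hc : ∀ j : Fin (m + 1), l + 1 ≤ (j : ℕ) → c j ≠ 0)
    (hlin : X ⟨l, by omega⟩ =
      ∑ j ∈ univ.filter (fun j : Fin (m + 1) => l + 1 ≤ (j : ℕ)), c j • X j) :
    ∀ i : Fin (m + 1),
      ((i : ℕ) < l → (X.submatrix i.succAbove id).det = 0) ∧
      (l ≤ (i : ℕ) → (X.submatrix i.succAbove id).det ≠ 0) := by
  intro i
  let a : Fin (m + 1) → ℝ := fun j => if (j : ℕ) < l then 0 else if (j : ℕ) = l then -1 else c j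
  have ha : a ≠ 0 := fun h => by
    simpa [a] using congrFun h ⟨l, by omega⟩
  have haX : a ᵥ* X = 0 := by
    have hterm : ∀ j, a j • X j = (if l + 1 ≤ (j : ℕ) then c j • X j else 0) -
        if j = ⟨l, by omega⟩ then X j else 0 := by
      intro j
      rcases lt_trichotomy (j : ℕ) l with h | h | h
      · simp [a, h, Fin.ext_iff, h.ne, show ¬ l + 1 ≤ (j : ℕ) by omega]
      · simp [a, h, Fin.ext_iff]
      · simp [a, Fin.ext_iff, h.ne', h.not_gt, Nat.succ_le_of_lt h]
    rw [Matrix.vecMul_eq_sum, Finset.sum_congr rfl fun j _ => hterm j, Finset.sum_sub_distrib,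
      ← Finset.sum_filter, ← hlin, Finset.sum_ite_eq' univ _ (fun j => X j), if_pos (mem_univ _)]
    exact sub_self _
  rw [ne_eq, X.det_submatrix_succAbove_eq_zero_iff hrank ha haX]
  refine ⟨fun h => by simp [a, h], fun h => ?_⟩
  rcases h.eq_or_lt with h | h
  · simp [a, ← h]
  · simpa [a, h.ne', h.not_gt] using hc i h
end

section
/- Let n ≥ 4, 1 ≤ l ≤ n − 3, and 0 = v1 = ⋯ = vl < v_{l+1} ≤ ⋯ ≤ vn < v1 + ⋯ + v_{n−1}. If Σ_{j=1}^{n−1} √(1 − v_j/v_n) ≤ n − 2, then there is a unique μ ∈ (0, 1/vn] with Σ_{j=1}^n √(1 − μ v_j) = n − 2, and the point p with p_1 = ⋯ = p_l = 1/(n−1) and p_i = (1 + √(1 − μ v_i))/(2(n−1)) for i = l+1,…,n maximizes f over the simplex S_n. If instead Σ_{j=1}^{n−1} √(1 − v_j/v_n) > n − 2, then there is a unique μ ∈ (0, 1/vn) with Σ_{j=1}^{n−1} √(1 − μ v_j) − √(1 − μ v_n) = n − 2, and the point p with p_1 = ⋯ = p_l = 1/(n−1), p_i = (1 + √(1 −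 μ v_i))/(2(n−1)) for i = l+1,…,n−1, and p_n = (1 − √(1 − μ v_n))/(2(n−1)) maximizes f over S_n. In both cases the maximum value of f equals 4 (n−1) p1 ⋯ pn / μ. -/
open Finset

lemma prod_le_exp_sum_sub_one {ι : Type*} (s : Finset ι) (y : ι → ℝ) (hy : ∀ i, 0 ≤ y i) :
    ∏ i ∈ s, y i ≤ Real.exp (∑ i ∈ s, (y i - 1)) := by
  rw [Real.exp_sum]
  refine prod_le_prod (fun i _ => hy i) fun i _ => ?_
  linarith [Real.add_one_le_exp (y i - 1)]

/-- A generalisation of the AM-GM inequality: the `w`-average of the products of all but one of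
the `y i` is at most `1` when the `w`-average of the corresponding means is at most `1`. -/
lemma sum_mul_prod_erase_le_one {ι : Type*} [Fintype ι] [DecidableEq ι]
    (hcard : 2 ≤ Fintype.card ι) (w y : ι → ℝ) (hw : ∀ i, 0 ≤ w i) (hw1 : ∑ i, w i = 1)
    (hy : ∀ i, 0 ≤ y i) (hwy : ∑ i, (1 - w i) * y i ≤ (Fintype.card ι : ℝ) - 1) :
    ∑ j, w j * ∏ i ∈ univ.erase j, y i ≤ 1 := by
  have hne : (univ : Finset ι).Nonempty := by
    rw [← card_pos, card_univ]; omega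
  obtain ⟨a, -, ha⟩ := exists_min_image univ y hne
  have hne' : (univ.erase a : Finset ι).Nonempty := by
    rw [← card_pos, card_erase_of_mem (mem_univ a), card_univ]; omega
  obtain ⟨b, hb, hbmax⟩ := exists_max_image (univ.erase a) y hne'
  have hba : b ≠ a := ne_of_mem_erase hb
  have hmin : ∀ j, y a ≤ y j := fun j => ha j (mem_univ j)
  have hmax : ∀ j, y j ≤ y b := fun j => by
    by_cases h : j = a
    · rw [h]; exact hmin b
    · exact hbmax j (by simp [h])
  set s : Finset ι := (univ.erase a).erase b with hs
  have ha_prod : y b * ∏ i ∈ s, y i = ∏ i ∈ univ.erase a, y i := mul_prod_erase _ _ hb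
  have hb_prod : y a * ∏ i ∈ s, y i = ∏ i ∈ univ.erase b, y i := by
    rw [hs, erase_right_comm]
    exact mul_prod_erase _ _ (by simp [hba.symm])
  have h_prod : y a * y b * ∏ i ∈ s, y i = ∏ i, y i := by
    rw [mul_assoc, ha_prod]; exact mul_prod_erase _ _ (mem_univ a)
  have hsum : ∑ i, y i = y a + y b + ∑ i ∈ s, y i := by
    rw [← add_sum_erase _ y (mem_univ a), ← add_sum_erase _ y hb]; ring
  have hscard : (s.card : ℝ) = (Fintype.card ι : ℝ) - 2 := by
    rw [hs, card_erase_of_mem hb, card_erase_of_mem (mem_univ a), card_univ, Nat.sub_sub,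
      Nat.cast_sub (by omega)]
    norm_num
  have key : ∀ j, ∃ t : ℝ, 0 ≤ t ∧ t ≤ y a + y b - y j ∧
      ∏ i ∈ univ.erase j, y i = t * ∏ i ∈ s, y i := by
    intro j
    by_cases hja : j = a
    · exact ⟨y b, hy b, by rw [hja]; linarith, by rw [hja, ha_prod]⟩
    by_cases hjb : j = b
    · exact ⟨y a, hy a, by rw [hjb]; linarith, by rw [hjb, hb_prod]⟩
    rcases (hy j).eq_or_lt with h0 | hpos
    · refine ⟨0, le_rfl, by linarith [hy a, hy b], ?_⟩
      rw [zero_mul]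
      exact prod_eq_zero (i := a) (by simp [Ne.symm hja]) (le_antisymm (h0 ▸ hmin j) (hy a))
    · refine ⟨y a * y b / y j, div_nonneg (mul_nonneg (hy a) (hy b)) (hy j), ?_, ?_⟩
      · rw [div_le_iff₀ hpos]
        nlinarith [mul_nonneg (sub_nonneg.2 (hmin j)) (sub_nonneg.2 (hmax j))]
      · rw [div_mul_eq_mul_div, h_prod, eq_div_iff hpos.ne', mul_comm]
        exact mul_prod_erase _ _ (mem_univ j)
  choose t ht0 ht htprod using key
  have hF : ∑ j, w j * ∏ i ∈ univ.erase j, y i = (∏ i ∈ s, y i) * ∑ j, w j * t j := by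
    rw [mul_sum]
    exact sum_congr rfl fun j _ => by rw [htprod j]; ring
  have hT0 : 0 ≤ ∑ j, w j * t j := sum_nonneg fun j _ => mul_nonneg (hw j) (ht0 j)
  have hT : ∑ j, w j * t j ≤ y a + y b - ∑ j, w j * y j := by
    calc ∑ j, w j * t j ≤ ∑ j, w j * (y a + y b - y j) :=
          sum_le_sum fun j _ => mul_le_mul_of_nonneg_left (ht j) (hw j)
      _ = (∑ j, w j) * (y a + y b) - ∑ j, w j * y j := by
          rw [sum_mul, ← sum_sub_distrib]
          exact sum_congr rfl fun j _ => by ring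
      _ = _ := by rw [hw1, one_mul]
  have hwy' : ∑ i, y i - ∑ i, w i * y i ≤ (Fintype.card ι : ℝ) - 1 := by
    rw [← sum_sub_distrib]
    simpa only [sub_mul, one_mul] using hwy
  rw [hF]
  calc (∏ i ∈ s, y i) * ∑ j, w j * t j
      ≤ Real.exp (∑ i ∈ s, (y i - 1)) * Real.exp ((∑ j, w j * t j) - 1) :=
        mul_le_mul (prod_le_exp_sum_sub_one s y hy)
          (by linarith [Real.add_one_le_exp ((∑ j, w j * t j) - 1)]) hT0 (Real.exp_nonneg _)
    _ = Real.exp (∑ i ∈ s, y i - s.card + (∑ j, w j * t j) - 1) := by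
        rw [← Real.exp_add, sum_sub_distrib, sum_const, nsmul_one]
        ring_nf
    _ ≤ 1 := Real.exp_le_one_iff.2 (by linarith)

/-- A point `p` of the open simplex satisfying the Lagrange equations
`v j = C p j (1 - (n - 1) p j)` maximizes `∑ j, v j ∏_{i ≠ j} q i` on the simplex. -/
lemma isMax_of_lagrange {n : ℕ} (hn : 2 ≤ n) (v p : Fin n → ℝ) (C : ℝ) (hC : 0 ≤ C)
    (hp : ∀ i, 0 < p i) (hp' : ∀ i, ((n : ℝ) - 1) * p i ≤ 1) (hp1 : ∑ i, p i = 1)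
    (hv : ∀ i, v i = C * p i * (1 - ((n : ℝ) - 1) * p i)) :
    (∀ q : Fin n → ℝ, (∀ i, 0 ≤ q i) → ∑ i, q i = 1 →
      (∑ j, v j * ∏ i ∈ univ.erase j, q i) ≤ ∑ j, v j * ∏ i ∈ univ.erase j, p i) ∧
    (∑ j, v j * ∏ k ∈ univ.erase j, p k) = C * ∏ k, p k := by
  have hw1 : ∑ i, (1 - ((n : ℝ) - 1) * p i) = 1 := by
    rw [sum_sub_distrib, ← mul_sum, hp1]; simp
  have hval : (∑ j, v j * ∏ k ∈ univ.erase j, p k) = C * ∏ k, p k := by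
    calc (∑ j, v j * ∏ k ∈ univ.erase j, p k)
        = ∑ j, (1 - ((n : ℝ) - 1) * p j) * (C * ∏ k, p k) :=
          sum_congr rfl fun j _ => by
            rw [hv j, ← mul_prod_erase univ p (mem_univ j)]; ring
      _ = C * ∏ k, p k := by rw [← sum_mul, hw1, one_mul]
  refine ⟨fun q hq hq1 => ?_, hval⟩
  have hineq := sum_mul_prod_erase_le_one (by simpa using hn)
    (fun i => 1 - ((n : ℝ) - 1) * p i) (fun i => q i / p i)
    (fun i => sub_nonneg.2 (hp' i)) hw1 (fun i => div_nonneg (hq i) (hp i).le) (by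
      refine le_of_eq ?_
      calc ∑ i, (1 - (1 - ((n : ℝ) - 1) * p i)) * (q i / p i)
          = ∑ i, ((n : ℝ) - 1) * q i :=
            sum_congr rfl fun i _ => by have := (hp i).ne'; field_simp; ring
        _ = _ := by rw [← mul_sum, hq1]; simp)
  rw [hval]
  calc (∑ j, v j * ∏ i ∈ univ.erase j, q i)
      = (C * ∏ k, p k) *
          ∑ j, (1 - ((n : ℝ) - 1) * p j) * ∏ i ∈ univ.erase j, q i / p i := by
        rw [mul_sum]
        refine sum_congr rfl fun j _ => ?_
        have hne : ∏ i ∈ univ.erase j, p i ≠ 0 := prod_ne_zero_iff.2 fun i _ => (hp i).ne'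
        rw [hv j, ← mul_prod_erase univ p (mem_univ j), prod_div_distrib]
        field_simp
    _ ≤ (C * ∏ k, p k) * 1 :=
        mul_le_mul_of_nonneg_left hineq (mul_nonneg hC (prod_nonneg fun i _ => (hp i).le))
    _ = _ := mul_one _

/-- The point with coordinates `(1 + s i) / (2 (n - 1))`, where `s i ^ 2 = 1 - μ v i`. -/
lemma isMax_of_sq_eq {n : ℕ} (hn : 2 ≤ n) (v p s : Fin n → ℝ) (μ : ℝ) (hμ : 0 < μ)
    (hps : ∀ i, p i = (1 + s i) / (2 * ((n : ℝ) - 1))) (hs : ∀ i, s i ^ 2 = 1 - μ * v i)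
    (hs_gt : ∀ i, -1 < s i) (hs_le : ∀ i, s i ≤ 1) (hsum : ∑ i, s i = (n : ℝ) - 2) :
    ((∀ i, 0 ≤ p i) ∧ ∑ i, p i = 1) ∧
    (∀ q : Fin n → ℝ, (∀ i, 0 ≤ q i) → ∑ i, q i = 1 →
      (∑ j, v j * ∏ i ∈ univ.erase j, q i) ≤ ∑ j, v j * ∏ i ∈ univ.erase j, p i) ∧
    (∑ j, v j * ∏ k ∈ univ.erase j, p k) = 4 * ((n : ℝ) - 1) * (∏ k, p k) / μ := by
  have hn' : (0 : ℝ) < (n : ℝ) - 1 := by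
    have : (2 : ℝ) ≤ n := by exact_mod_cast hn
    linarith
  have hp : ∀ i, 0 < p i := fun i => by
    rw [hps i]; exact div_pos (by linarith [hs_gt i]) (by linarith)
  have hnp : ∀ i, ((n : ℝ) - 1) * p i = (1 + s i) / 2 := fun i => by
    rw [hps i]; field_simp
  have hp1 : ∑ i, p i = 1 := by
    simp_rw [hps]
    rw [← sum_div, sum_add_distrib, hsum]
    simp only [sum_const, card_univ, Fintype.card_fin, nsmul_eq_mul, mul_one]
    rw [div_eq_one_iff_eq (by linarith)]; ring
  obtain ⟨h1, h2⟩ := isMax_of_lagrange hn v p (4 * ((n : ℝ) - 1) / μ) (by positivity) hp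
    (fun i => by rw [hnp i]; linarith [hs_le i]) hp1 (fun i => by
      rw [hnp i, hps i]
      field_simp
      nlinarith [hs i])
  refine ⟨⟨fun i => (hp i).le, hp1⟩, h1, ?_⟩
  rw [h2]; ring

lemma one_sub_sqrt_eq_div {x : ℝ} (hx : 0 ≤ 1 - x) :
    1 - Real.sqrt (1 - x) = x / (1 + Real.sqrt (1 - x)) := by
  rw [eq_div_iff (by positivity)]
  nlinarith [Real.sq_sqrt hx]

lemma sqrt_ratio_lt {a b μ μ' : ℝ} (ha : 0 ≤ a) (hab : a < b) (hμ : 0 ≤ μ) (h : μ < μ')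
    (hb : μ' * b ≤ 1) :
    (1 + Real.sqrt (1 - μ' * b)) / (1 + Real.sqrt (1 - μ' * a)) <
      (1 + Real.sqrt (1 - μ * b)) / (1 + Real.sqrt (1 - μ * a)) := by
  have hμb : μ * b < μ' * b := mul_lt_mul_of_pos_right h (ha.trans_lt hab)
  have hμa : μ * a ≤ μ' * a := mul_le_mul_of_nonneg_right h.le ha
  have hμab : μ * a ≤ μ * b := mul_le_mul_of_nonneg_left hab.le hμ
  have hμab' : μ' * a ≤ μ' * b := mul_le_mul_of_nonneg_left hab.le (hμ.trans h.le)
  have hB'0 := Real.sqrt_nonneg (1 - μ' * b)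
  have hA'0 := Real.sqrt_nonneg (1 - μ' * a)
  have hA0 := Real.sqrt_nonneg (1 - μ * a)
  have hBpos : 0 < Real.sqrt (1 - μ * b) := Real.sqrt_pos.2 (by linarith)
  have hBA : Real.sqrt (1 - μ * b) ≤ Real.sqrt (1 - μ * a) := Real.sqrt_le_sqrt (by linarith)
  have hBA' : Real.sqrt (1 - μ' * b) ≤ Real.sqrt (1 - μ' * a) := Real.sqrt_le_sqrt (by linarith)
  have hAsq := Real.sq_sqrt (show 0 ≤ 1 - μ * a by linarith)
  have hAsq' := Real.sq_sqrt (show 0 ≤ 1 - μ' * a by linarith)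
  have hBsq := Real.sq_sqrt (show 0 ≤ 1 - μ * b by linarith)
  have hBsq' := Real.sq_sqrt (show 0 ≤ 1 - μ' * b by linarith)
  have hgap : (μ' - μ) * a < (μ' - μ) * b := mul_lt_mul_of_pos_left hab (by linarith)
  rw [div_lt_div_iff₀ (by linarith) (by linarith)]
  generalize Real.sqrt (1 - μ * a) = A at *
  generalize Real.sqrt (1 - μ' * a) = A' at *
  generalize Real.sqrt (1 - μ * b) = B at *
  generalize Real.sqrt (1 - μ' * b) = B' at *
  have hprod : A * B' < A' * B := by
    refine lt_of_pow_lt_pow_left₀ 2 (by positivity) ?_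
    rw [mul_pow, mul_pow, hAsq, hAsq', hBsq, hBsq']
    nlinarith
  have hdiff : A - A' ≤ B - B' := by
    by_contra! hlt
    have hBB' : B' ≤ B := by nlinarith
    nlinarith [mul_le_mul_of_nonneg_left (add_le_add hBA hBA') (sub_nonneg.2 hBB'),
      mul_lt_mul_of_pos_right hlt (show 0 < A + A' by linarith)]
  nlinarith

lemma sqrt_ratio_le {a b μ μ' : ℝ} (ha : 0 ≤ a) (hab : a ≤ b) (hμ : 0 ≤ μ) (h : μ < μ')
    (hb : μ' * b ≤ 1) :
    (1 + Real.sqrt (1 - μ' * b)) / (1 + Real.sqrt (1 - μ' * a)) ≤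
      (1 + Real.sqrt (1 - μ * b)) / (1 + Real.sqrt (1 - μ * a)) := by
  rcases hab.eq_or_lt with rfl | hlt
  · rw [div_self (by positivity), div_self (by positivity)]
  · exact (sqrt_ratio_lt ha hlt hμ h hb).le

section Multiplier

variable {ι : Type*} [Fintype ι]

/-- Existence and uniqueness of the root of `∑ j, √(1 - μ v j) = c`. -/
lemma existsUnique_sum_sqrt (v : ι → ℝ) (m : ι) (c : ℝ) (hv : ∀ i, 0 ≤ v i)
    (hpos : 0 < v m) (hc : c < Fintype.card ι)
    (hend : ∑ j, Real.sqrt (1 - v j / v m) ≤ c) :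
    ∃ μ : ℝ, (0 < μ ∧ μ ≤ 1 / v m ∧ ∑ j, Real.sqrt (1 - μ * v j) = c) ∧
      ∀ μ' : ℝ, 0 < μ' → μ' ≤ 1 / v m → ∑ j, Real.sqrt (1 - μ' * v j) = c → μ' = μ := by
  have hcont : ContinuousOn (fun μ : ℝ => ∑ j, Real.sqrt (1 - μ * v j)) (Set.Icc 0 (1 / v m)) := by
    fun_prop
  obtain ⟨μ, ⟨hμ0, hμ1⟩, hμ⟩ := intermediate_value_Icc' (one_div_pos.2 hpos).le hcont
    (show c ∈ _ from ⟨by simpa [div_eq_inv_mul] using hend, by simpa using hc.le⟩)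
  have hμ : ∑ j, Real.sqrt (1 - μ * v j) = c := hμ
  have hμpos : 0 < μ := by
    refine lt_of_le_of_ne hμ0 ?_
    rintro rfl
    simp at hμ
    linarith
  have hanti : ∀ μ₁ μ₂ : ℝ, μ₁ < μ₂ → μ₁ ≤ 1 / v m →
      ∑ j, Real.sqrt (1 - μ₂ * v j) = ∑ j, Real.sqrt (1 - μ₁ * v j) → μ₁ = 1 / v m := by
    intro μ₁ μ₂ hlt hle heq
    by_contra hne
    have hlt' : μ₁ * v m < 1 := (lt_div_iff₀ hpos).1 (lt_of_le_of_ne hle hne)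
    refine heq.not_lt (sum_lt_sum (fun j _ => Real.sqrt_le_sqrt ?_) ⟨m, mem_univ m, ?_⟩)
    · nlinarith [hv j]
    · exact (Real.sqrt_lt_sqrt_iff_of_pos (by linarith)).2 (by nlinarith)
  refine ⟨μ, ⟨hμpos, hμ1, hμ⟩, fun μ' hμ'0 hμ'1 hμ' => ?_⟩
  rcases lt_trichotomy μ' μ with h | h | h
  · linarith [hanti μ' μ h hμ'1 (hμ.trans hμ'.symm)]
  · exact h
  · linarith [hanti μ μ' h hμ1 (hμ'.trans hμ.symm)]

variable [DecidableEq ι]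

/-- Existence and uniqueness of the root of `∑ j ≠ m, √(1 - μ v j) - √(1 - μ v m) = card - 2`. -/
lemma existsUnique_sum_sqrt_sub (v : ι → ℝ) (m k : ι) (hv : ∀ i, 0 ≤ v i) (hvm : ∀ i, v i ≤ v m)
    (hk : 0 < v k) (hsum : v m < ∑ i ∈ univ.erase m, v i) (hkm : k ≠ m)
    (hend : (Fintype.card ι : ℝ) - 2 < ∑ j ∈ univ.erase m, Real.sqrt (1 - v j / v m)) :
    ∃ μ : ℝ, (0 < μ ∧ μ < 1 / v m ∧ (∑ j ∈ univ.erase m, Real.sqrt (1 - μ * v j))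
        - Real.sqrt (1 - μ * v m) = (Fintype.card ι : ℝ) - 2) ∧
      ∀ μ' : ℝ, 0 < μ' → μ' < 1 / v m → (∑ j ∈ univ.erase m, Real.sqrt (1 - μ' * v j))
        - Real.sqrt (1 - μ' * v m) = (Fintype.card ι : ℝ) - 2 → μ' = μ := by
  have hpos : 0 < v m := hk.trans_le (hvm k)
  have hcard : ((univ.erase m).card : ℝ) = (Fintype.card ι : ℝ) - 1 := by
    rw [card_erase_of_mem (mem_univ m), card_univ,
      Nat.cast_sub (Fintype.card_pos_iff.2 ⟨m⟩), Nat.cast_one]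
  have hmemk : k ∈ univ.erase m := by simp [hkm]
  have hkm_lt : v k < v m := by
    refine lt_of_le_of_ne (hvm k) fun heq => hend.not_ge ?_
    have hcard' : (((univ.erase m).erase k).card : ℝ) = (Fintype.card ι : ℝ) - 2 := by
      rw [card_erase_of_mem hmemk, Nat.cast_sub (card_pos.2 ⟨k, hmemk⟩), hcard]
      push_cast; ring
    rw [← add_sum_erase _ _ hmemk, heq, div_self hpos.ne', sub_self, Real.sqrt_zero, zero_add,
      ← hcard', ← nsmul_one, ← sum_const]
    refine sum_le_sum fun j _ => Real.sqrt_le_one.2 ?_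
    linarith [div_nonneg (hv j) hpos.le]
  set R : ℝ → ℝ := fun μ => ∑ j ∈ univ.erase m,
    v j * ((1 + Real.sqrt (1 - μ * v m)) / (1 + Real.sqrt (1 - μ * v j))) with hR
  have hcont : ContinuousOn R (Set.Icc 0 (1 / v m)) := by
    refine Continuous.continuousOn (continuous_finsetSum _ fun j _ => ?_)
    refine continuous_const.mul (Continuous.div (by fun_prop) (by fun_prop) fun μ => ?_)
    positivity
  have hsub : ∀ μ, 0 ≤ μ → μ ≤ 1 / v m → (1 + Real.sqrt (1 - μ * v m)) *
      ((Fintype.card ι : ℝ) - 1 - ∑ j ∈ univ.erase m, Real.sqrt (1 - μ * v j)) = μ * R μ := by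
    intro μ hμ0 hμ1
    rw [hR, ← hcard, ← nsmul_one, ← sum_const, ← sum_sub_distrib, mul_sum, mul_sum]
    refine sum_congr rfl fun j _ => ?_
    have h1 : μ * v m ≤ 1 := (le_div_iff₀ hpos).1 hμ1
    rw [one_sub_sqrt_eq_div (by nlinarith [hvm j])]
    ring
  have hiff : ∀ μ, 0 < μ → μ ≤ 1 / v m → ((∑ j ∈ univ.erase m, Real.sqrt (1 - μ * v j))
        - Real.sqrt (1 - μ * v m) = (Fintype.card ι : ℝ) - 2 ↔ R μ = v m) := by
    intro μ hμ0 hμ1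
    have hS := hsub μ hμ0.le hμ1
    have h1 : μ * v m ≤ 1 := (le_div_iff₀ hpos).1 hμ1
    have hsq := Real.sq_sqrt (show 0 ≤ 1 - μ * v m by linarith)
    have hnn := Real.sqrt_nonneg (1 - μ * v m)
    constructor
    · intro h
      refine mul_left_cancel₀ hμ0.ne' ?_
      rw [← hS, sub_eq_iff_eq_add.1 h]
      linear_combination -hsq
    · intro h
      rw [h] at hS
      have : (1 + Real.sqrt (1 - μ * v m)) *
          ((Fintype.card ι : ℝ) - 1 - ∑ j ∈ univ.erase m, Real.sqrt (1 - μ * v j)) =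
          (1 + Real.sqrt (1 - μ * v m)) * (1 - Real.sqrt (1 - μ * v m)) := by
        rw [hS]; linear_combination hsq
      linarith [mul_left_cancel₀ (by positivity) this]
  have hR0 : R 0 = ∑ i ∈ univ.erase m, v i := by
    simp only [hR, zero_mul, sub_zero]
    exact sum_congr rfl fun j _ => by rw [div_self (by positivity), mul_one]
  have hR1 : R (1 / v m) < v m := by
    have hS := hsub (1 / v m) (one_div_pos.2 hpos).le le_rfl
    have hcongr : ∑ j ∈ univ.erase m, Real.sqrt (1 - 1 / v m * v j) =
        ∑ j ∈ univ.erase m, Real.sqrt (1 - v j / v m) :=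
      sum_congr rfl fun j _ => by rw [one_div_mul_eq_div]
    rw [one_div_mul_cancel hpos.ne', sub_self, Real.sqrt_zero, add_zero, one_mul, hcongr,
      one_div_mul_eq_div, eq_div_iff hpos.ne'] at hS
    rw [← hS]
    nlinarith
  have hanti : ∀ μ₁ μ₂ : ℝ, 0 ≤ μ₁ → μ₁ < μ₂ → μ₂ ≤ 1 / v m → R μ₂ < R μ₁ := by
    intro μ₁ μ₂ h0 hlt hle
    have h1 : μ₂ * v m ≤ 1 := (le_div_iff₀ hpos).1 hle
    exact sum_lt_sum
      (fun j _ => mul_le_mul_of_nonneg_left (sqrt_ratio_le (hv j) (hvm j) h0 hlt h1) (hv j))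
      ⟨k, hmemk, mul_lt_mul_of_pos_left (sqrt_ratio_lt (hv k) hkm_lt h0 hlt h1) hk⟩
  obtain ⟨μ, ⟨hμ0, hμ1⟩, hμ⟩ := intermediate_value_Ioo' (one_div_pos.2 hpos).le hcont
    (show v m ∈ _ from ⟨hR1, hR0 ▸ hsum⟩)
  refine ⟨μ, ⟨hμ0, hμ1, (hiff μ hμ0 hμ1.le).2 hμ⟩, fun μ' hμ'0 hμ'1 hμ' => ?_⟩
  rw [hiff μ' hμ'0 hμ'1.le] at hμ'
  rcases lt_trichotomy μ' μ with h | h | h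
  · linarith [hanti μ' μ hμ'0.le h hμ1.le]
  · exact h
  · linarith [hanti μ μ' hμ0.le h hμ'1.le]

end Multiplier

/-- Theorem 4.2: the D-optimal allocation when `0 = v1 = ⋯ = vl < v_{l+1} ≤ ⋯
≤ vn < v1 + ⋯ + v_{n-1}`. The first `l` coordinates equal `1/(n-1)` and the
remaining ones are given by the square-root formulas, with `μ` determined
uniquely by `h1(μ) = n - 2` or `h2(μ) = n - 2` according to whether
`∑_{j<n} √(1 - vⱼ/vn) ≤ n - 2` or not; in both cases the maximum of `f`
equals `4(n-1) p1⋯pn/μ`. -/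
theorem stmt_16 (n : ℕ) (hn : 4 ≤ n) (l : ℕ) (hl1 : 1 ≤ l) (hl2 : l ≤ n - 3)
    (v : Fin n → ℝ)
    (hvzero : ∀ i : Fin n, (i : ℕ) < l → v i = 0)
    (hvl : 0 < v ⟨l, by omega⟩) (hmono : Monotone v)
    (hsum : v ⟨n - 1, by omega⟩ < ∑ i ∈ univ.erase (⟨n - 1, by omega⟩ : Fin n), v i) :
    ((∑ j ∈ univ.erase (⟨n - 1, by omega⟩ : Fin n),
        Real.sqrt (1 - v j / v ⟨n - 1, by omega⟩) ≤ (n : ℝ) - 2) →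
      ∃ μ : ℝ, ∃ p : Fin n → ℝ,
        p = (fun i : Fin n => if (i : ℕ) < l then 1 / ((n : ℝ) - 1)
          else (1 + Real.sqrt (1 - μ * v i)) / (2 * ((n : ℝ) - 1))) ∧
        (0 < μ ∧ μ ≤ 1 / v ⟨n - 1, by omega⟩ ∧
          ∑ j, Real.sqrt (1 - μ * v j) = (n : ℝ) - 2) ∧
        (∀ μ' : ℝ, 0 < μ' → μ' ≤ 1 / v ⟨n - 1, by omega⟩ →
          ∑ j, Real.sqrt (1 - μ' * v j) = (n : ℝ) - 2 → μ' = μ) ∧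
        ((∀ i, 0 ≤ p i) ∧ ∑ i, p i = 1) ∧
        (∀ q : Fin n → ℝ, (∀ i, 0 ≤ q i) → ∑ i, q i = 1 →
          (∑ j, v j * ∏ i ∈ univ.erase j, q i) ≤ ∑ j, v j * ∏ i ∈ univ.erase j, p i) ∧
        (∑ j, v j * ∏ k ∈ univ.erase j, p k) = 4 * ((n : ℝ) - 1) * (∏ k, p k) / μ) ∧
    (((n : ℝ) - 2 < ∑ j ∈ univ.erase (⟨n - 1, by omega⟩ : Fin n),
        Real.sqrt (1 - v j / v ⟨n - 1, by omega⟩)) →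
      ∃ μ : ℝ, ∃ p : Fin n → ℝ,
        p = (fun i : Fin n => if (i : ℕ) < l then 1 / ((n : ℝ) - 1)
          else if i = (⟨n - 1, by omega⟩ : Fin n) then
            (1 - Real.sqrt (1 - μ * v i)) / (2 * ((n : ℝ) - 1))
          else (1 + Real.sqrt (1 - μ * v i)) / (2 * ((n : ℝ) - 1))) ∧
        (0 < μ ∧ μ < 1 / v ⟨n - 1, by omega⟩ ∧
          (∑ j ∈ univ.erase (⟨n - 1, by omega⟩ : Fin n), Real.sqrt (1 - μ * v j))
            - Real.sqrt (1 - μ * v ⟨n - 1, by omega⟩) = (n : ℝ) - 2) ∧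
        (∀ μ' : ℝ, 0 < μ' → μ' < 1 / v ⟨n - 1, by omega⟩ →
          (∑ j ∈ univ.erase (⟨n - 1, by omega⟩ : Fin n), Real.sqrt (1 - μ' * v j))
            - Real.sqrt (1 - μ' * v ⟨n - 1, by omega⟩) = (n : ℝ) - 2 → μ' = μ) ∧
        ((∀ i, 0 ≤ p i) ∧ ∑ i, p i = 1) ∧
        (∀ q : Fin n → ℝ, (∀ i, 0 ≤ q i) → ∑ i, q i = 1 →
          (∑ j, v j * ∏ i ∈ univ.erase j, q i) ≤ ∑ j, v j * ∏ i ∈ univ.erase j, p i) ∧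
        (∑ j, v j * ∏ k ∈ univ.erase j, p k) = 4 * ((n : ℝ) - 1) * (∏ k, p k) / μ) := by
  have hmtop : ∀ i : Fin n, i ≤ ⟨n - 1, by omega⟩ := fun i => Fin.mk_le_mk.2 (by omega)
  have hlm : (⟨l, by omega⟩ : Fin n) ≠ ⟨n - 1, by omega⟩ := by
    rw [Ne, Fin.mk.injEq]; omega
  generalize hm : (⟨n - 1, by omega⟩ : Fin n) = m at *
  have hml : ¬ (m : ℕ) < l := by rw [← hm]; exact not_lt.2 (show l ≤ n - 1 by omega)
  have hvm : ∀ i, v i ≤ v m := fun i => hmono (hmtop i)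
  have hv : ∀ i, 0 ≤ v i := fun i => by
    rcases lt_or_ge (i : ℕ) l with h | h
    · exact (hvzero i h).ge
    · exact hvl.le.trans (hmono (Fin.mk_le_mk.2 h))
  have hpos : 0 < v m := hvl.trans_le (hvm _)
  have hle_one : ∀ μ, 0 < μ → ∀ i, Real.sqrt (1 - μ * v i) ≤ 1 := fun μ hμ i =>
    Real.sqrt_le_one.2 (by nlinarith [hv i])
  have hsq : ∀ μ, 0 < μ → μ ≤ 1 / v m → ∀ i, Real.sqrt (1 - μ * v i) ^ 2 = 1 - μ * v i :=
    fun μ hμ hμ1 i => Real.sq_sqrt (by nlinarith [(le_div_iff₀ hpos).1 hμ1, hvm i])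
  constructor
  · intro hend
    obtain ⟨μ, ⟨hμ0, hμ1, hμ⟩, huniq⟩ := existsUnique_sum_sqrt v m ((n : ℝ) - 2) hv hpos
      (by simp) (by
        rw [← add_sum_erase _ _ (mem_univ m), div_self hpos.ne', sub_self, Real.sqrt_zero,
          zero_add]
        exact hend)
    refine ⟨μ, _, rfl, ⟨hμ0, hμ1, hμ⟩, huniq, ?_⟩
    refine isMax_of_sq_eq (by omega) v _ (fun i => Real.sqrt (1 - μ * v i)) μ hμ0 (fun i => ?_)
      (hsq μ hμ0 hμ1) (fun i => by linarith [Real.sqrt_nonneg (1 - μ * v i)]) (hle_one μ hμ0) hμ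
    split_ifs with h
    · rw [hvzero i h, mul_zero, sub_zero, Real.sqrt_one, one_add_one_eq_two,
        div_mul_eq_div_div, div_self two_ne_zero]
    · rfl
  · intro hend
    obtain ⟨μ, ⟨hμ0, hμ1, hμ⟩, huniq⟩ := existsUnique_sum_sqrt_sub v m ⟨l, by omega⟩ hv hvm hvl
      hsum hlm (by simpa using hend)
    rw [Fintype.card_fin] at hμ huniq
    refine ⟨μ, _, rfl, ⟨hμ0, hμ1, hμ⟩, huniq, ?_⟩
    refine isMax_of_sq_eq (by omega) v _
      (fun i => if i = m then -Real.sqrt (1 - μ * v i) else Real.sqrt (1 - μ * v i)) μ hμ0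
      (fun i => ?_) (fun i => ?_) (fun i => ?_) (fun i => ?_) ?_
    · by_cases h : (i : ℕ) < l
      · have him : i ≠ m := by rintro rfl; exact hml h
        simp only [if_pos h, if_neg him]
        rw [hvzero i h, mul_zero, sub_zero, Real.sqrt_one, one_add_one_eq_two,
          div_mul_eq_div_div, div_self two_ne_zero]
      · by_cases him : i = m
        · simp only [if_neg h, if_pos him, sub_eq_add_neg]
        · simp only [if_neg h, if_neg him]
    · split_ifs
      · rw [neg_sq, hsq μ hμ0 hμ1.le]
      · exact hsq μ hμ0 hμ1.le i
    · split_ifs with him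
      · rw [him, neg_lt_neg_iff, Real.sqrt_lt' one_pos]
        nlinarith
      · linarith [Real.sqrt_nonneg (1 - μ * v i)]
    · split_ifs
      · linarith [Real.sqrt_nonneg (1 - μ * v i)]
      · exact hle_one μ hμ0 i
    · rw [← add_sum_erase _ _ (mem_univ m), if_pos rfl, ← hμ, neg_add_eq_sub]
      congr 1
      exact sum_congr rfl fun i hi => if_neg (ne_of_mem_erase hi)
end
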